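/- Let $0<\mu<1$, $c>1$, $B>0$, $C>0$, and let $\delta>0$ be sufficiently small. Then for all sufficiently large $X$ and all real $t$ with $|t|\le X^{2/3-c-\delta}$, one has $\sum_{1<q\le (\log X)^{C}}\frac{1}{\varphi(q)}\sum^{*}_{\chi\ (\mathrm{mod}\ q)}\Big|\sum_{\mu X<n\le X}\Lambda(n)\chi(n)e(tn^{c})\Big|\ll \frac{X}{(\log X)^{B}}$, with the implied constant depending only on $\mu,c,B,C,\delta$. -/

import Mathlib

open Finset
open scoped Classical

/-- `e(x) = e^{2πix}`. -/
noncomputable def e (x : ℝ) : ℂ := Complex.exp (2 * Real.pi * Complex.I * x)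

lemma e_add (x y : ℝ) : e (x + y) = e x * e y := by
  simp only [e, ← Complex.exp_add]; congr 1; push_cast; ring

lemma norm_e (x : ℝ) : ‖e x‖ = 1 := by
  have : (2 * Real.pi * Complex.I * x : ℂ) = ((2 * Real.pi * x : ℝ) : ℂ) * Complex.I := by
    push_cast; ring
  rw [e, this, Complex.norm_exp_ofReal_mul_I]

lemma e_neg (x : ℝ) : e (-x) = (starRingEnd ℂ) (e x) := by
  simp only [e, ← Complex.exp_conj]; congr 1; simp [Complex.conj_ofNat]

lemma e_int (k : ℤ) : e k = 1 := by
  rw [e, Complex.exp_eq_one_iff]; exact ⟨k, by push_cast; ring⟩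

/-- Abel's inequality. -/
lemma norm_sum_mul_le_abel (a f : ℕ → ℂ) {m n : ℕ} (hmn : m ≤ n) {A : ℝ}
    (hA : ∀ k, m ≤ k → k ≤ n → ‖∑ i ∈ Ico m k, a i‖ ≤ A) :
    ‖∑ i ∈ Ico m n, a i * f i‖ ≤ A * (‖f n‖ + ∑ i ∈ Ico m n, ‖f (i + 1) - f i‖) := by
  have key : ∀ k, m ≤ k → ∑ i ∈ Ico m k, a i * f i = (∑ i ∈ Ico m k, a i) * f k
      - ∑ i ∈ Ico m k, (∑ j ∈ Ico m (i + 1), a j) * (f (i + 1) - f i) := by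
    intro k hk
    induction k, hk using Nat.le_induction with
    | base => simp
    | succ k hk ih =>
      rw [sum_Ico_succ_top hk, sum_Ico_succ_top hk,
          sum_Ico_succ_top (f := fun i => _ * (f (i+1) - f i)) hk, ih,
        sum_Ico_succ_top hk]
      ring
  rw [key n hmn]
  have hA0 : 0 ≤ A := (norm_nonneg _).trans (hA n hmn le_rfl)
  refine (norm_sub_le _ _).trans ?_
  rw [mul_add, norm_mul, mul_sum]
  refine add_le_add (by gcongr; exact hA n hmn le_rfl) ((norm_sum_le _ _).trans ?_)
  refine sum_le_sum fun i hi => ?_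
  rw [mem_Ico] at hi
  rw [norm_mul]
  gcongr
  exact hA _ (by omega) (by omega)

lemma inv_e_sub_one {x : ℝ} (hx : Real.sin (Real.pi * x) ≠ 0) :
    (e x - 1) * (-1 / 2 - Complex.I / 2 *
      ((Real.cos (Real.pi * x) / Real.sin (Real.pi * x) : ℝ) : ℂ))
      = 1 := by
  have h1 : e x = (Complex.exp (Real.pi * x * Complex.I)) ^ 2 := by
    rw [← Complex.exp_nat_mul, e]; congr 1; push_cast; ring
  have h2 : Complex.exp (Real.pi * x * Complex.I)
      = (Real.cos (Real.pi * x) : ℂ) + (Real.sin (Real.pi * x) : ℂ) * Complex.I := by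
    rw [Complex.exp_mul_I]; push_cast; ring
  have h3 : ((Real.cos (Real.pi * x) : ℝ) : ℂ) ^ 2 + ((Real.sin (Real.pi * x) : ℝ) : ℂ) ^ 2 =
      1 := by
    norm_cast; exact Real.cos_sq_add_sin_sq _
  have hs : ((Real.sin (Real.pi * x) : ℝ) : ℂ) ≠ 0 := by exact_mod_cast hx
  rw [h1, h2, Complex.ofReal_div]
  set s : ℂ := ((Real.sin (Real.pi * x) : ℝ) : ℂ)
  set c : ℂ := ((Real.cos (Real.pi * x) : ℝ) : ℂ)
  have hI : Complex.I ^ 2 = -1 := Complex.I_sq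
  have e1 : (c + s * Complex.I) ^ 2 - 1 = 2 * s * Complex.I * (c + s * Complex.I) := by
    linear_combination h3 - s ^ 2 * hI
  have e2 : (2 * s * Complex.I) * (-1 / 2 - Complex.I / 2 * (c / s)) = c - s * Complex.I := by
    field_simp
    linear_combination (-c) * hI
  rw [e1]
  linear_combination (c + s * Complex.I) * e2 + h3 - s ^ 2 * hI

/-- Discrete form of the Kusmin–Landau inequality. -/
lemma kusmin_landau (f : ℕ → ℝ) {m n : ℕ} {θ : ℝ} (hθ : 0 < θ) (hθ' : θ ≤ 1 / 2) (k : ℤ)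
    (hmono : ∀ i, m ≤ i → i + 1 < n → f (i + 1) - f i ≤ f (i + 2) - f (i + 1))
    (hlow : ∀ i, m ≤ i → i < n → k + θ ≤ f (i + 1) - f i)
    (hup : ∀ i, m ≤ i → i < n → f (i + 1) - f i ≤ k + 1 - θ) :
    ‖∑ i ∈ Ico m n, e (f i)‖ ≤ 3 / θ := by
  rcases le_or_gt n m with hnm | hmn
  · rw [Ico_eq_empty (by omega)]; simp; positivity
  obtain ⟨N, rfl⟩ : ∃ N, n = N + 1 := ⟨n - 1, by omega⟩
  have hmN : m ≤ N := by omega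
  set g : ℕ → ℝ := fun i => f (i + 1) - f i - k with hg
  have hsin : ∀ i, m ≤ i → i ≤ N → 2 * θ ≤ Real.sin (Real.pi * g i) := by
    intro i h1 h2
    have a1 := hlow i h1 (by omega)
    have a2 := hup i h1 (by omega)
    have b1 : θ ≤ g i := by simp only [hg]; linarith
    have b2 : g i ≤ 1 - θ := by simp only [hg]; linarith
    rcases le_total (g i) (1 / 2) with h | h
    · have := Real.mul_le_sin (x := Real.pi * g i) (by have := Real.pi_pos; nlinarith)
        (by have := Real.pi_pos; nlinarith)
      have e1 : 2 / Real.pi * (Real.pi * g i) = 2 * g i := by field_simp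
      linarith
    · have := Real.mul_le_sin (x := Real.pi * (1 - g i)) (by have := Real.pi_pos; nlinarith)
        (by have := Real.pi_pos; nlinarith)
      have e1 : 2 / Real.pi * (Real.pi * (1 - g i)) = 2 * (1 - g i) := by field_simp
      have e2 : Real.sin (Real.pi * (1 - g i)) = Real.sin (Real.pi * g i) := by
        rw [mul_sub, mul_one, Real.sin_pi_sub]
      linarith
  set h : ℕ → ℝ := fun i => Real.cos (Real.pi * g i) / Real.sin (Real.pi * g i) with hh
  set c : ℕ → ℂ := fun i => -1 / 2 - Complex.I / 2 * ((h i : ℝ) : ℂ) with hc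
  have habs : ∀ i, m ≤ i → i ≤ N → |h i| ≤ 1 / (2 * θ) := by
    intro i h1 h2
    have := hsin i h1 h2
    simp only [hh, abs_div]
    rw [abs_of_pos (show 0 < Real.sin (Real.pi * g i) by linarith)]
    gcongr
    exact Real.abs_cos_le_one _
  have hterm : ∀ i, m ≤ i → i ≤ N → e (f i) = (e (f (i + 1)) - e (f i)) * c i := by
    intro i h1 h2
    have hs : Real.sin (Real.pi * g i) ≠ 0 := by have := hsin i h1 h2; linarith
    have h3 := inv_e_sub_one hs
    have h4 : e (f (i + 1)) = e (f i) * e (g i) := by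
      rw [← e_add]
      have : f (i + 1) = f i + g i + (k : ℝ) := by simp only [hg]; ring
      rw [this, e_add _ (k : ℝ), e_int, mul_one]
    rw [h4]
    linear_combination (-(e (f i))) * h3
  have hanti : ∀ i, m ≤ i → i + 1 ≤ N → h (i + 1) ≤ h i := by
    intro i h1 h2
    have s1 := hsin i h1 (by omega)
    have s2 := hsin (i + 1) (by omega) h2
    have hm := hmono i h1 (by omega)
    have l1 := hlow i h1 (by omega)
    have l2 := hup (i + 1) (by omega) (by omega)
    have : 0 ≤ Real.sin (Real.pi * g (i + 1) - Real.pi * g i) := by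
      apply Real.sin_nonneg_of_nonneg_of_le_pi
      · have : g i ≤ g (i + 1) := by simp only [hg]; linarith
        have := Real.pi_pos
        nlinarith
      · have : g (i + 1) - g i ≤ 1 := by simp only [hg]; linarith
        have := Real.pi_pos
        nlinarith
    rw [Real.sin_sub] at this
    simp only [hh]
    rw [div_le_div_iff₀ (by linarith) (by linarith)]
    linarith
  rw [sum_Ico_succ_top hmN]
  have hsum : ∑ i ∈ Ico m N, e (f i) = ∑ i ∈ Ico m N, (e (f (i + 1)) - e (f i)) * c i := by
    refine sum_congr rfl fun i hi => ?_
    rw [mem_Ico] at hi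
    exact hterm i hi.1 (by omega)
  have habel := norm_sum_mul_le_abel (fun i => e (f (i + 1)) - e (f i)) c hmN (A := 2) (by
    intro j h1 h2
    rw [sum_Ico_eq_sub _ h1]
    rw [sum_range_sub (fun i => e (f i)), sum_range_sub (fun i => e (f i))]
    calc _ = ‖e (f j) - e (f m)‖ := by congr 1; ring
      _ ≤ _ := (norm_sub_le _ _).trans (by rw [norm_e, norm_e]; norm_num))
  have hcN : ‖c N‖ ≤ 1 / 2 + 1 / (4 * θ) := by
    refine (norm_sub_le _ _).trans ?_
    have := habs N hmN le_rfl
    rw [norm_mul]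
    simp only [Complex.norm_real, Real.norm_eq_abs]
    have e1 : ‖(-1 / 2 : ℂ)‖ = 1 / 2 := by simp
    have e2 : ‖(Complex.I / 2 : ℂ)‖ = 1 / 2 := by simp
    rw [e1, e2]
    have : 1 / (4 * θ) = 1 / 2 * (1 / (2 * θ)) := by field_simp; norm_num
    rw [this]
    gcongr
  have hvar : ∑ i ∈ Ico m N, ‖c (i + 1) - c i‖ ≤ 1 / (2 * θ) := by
    have : ∀ i ∈ Ico m N, ‖c (i + 1) - c i‖ = (-h (i + 1) / 2) - (-h i / 2) := by
      intro i hi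
      rw [mem_Ico] at hi
      have e1 : c (i + 1) - c i = Complex.I / 2 * ((h i - h (i + 1) : ℝ) : ℂ) := by
        simp only [hc]; push_cast; ring
      rw [e1, norm_mul, Complex.norm_real, Real.norm_eq_abs,
        abs_of_nonneg (by have := hanti i hi.1 (by omega); linarith)]
      have e2 : ‖(Complex.I / 2 : ℂ)‖ = 1 / 2 := by simp
      rw [e2]; ring
    rw [sum_congr rfl this, sum_Ico_eq_sub _ hmN, sum_range_sub (fun i => -h i / 2),
      sum_range_sub (fun i => -h i / 2)]
    have h1 := abs_le.mp (habs N hmN le_rfl)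
    have h2 := abs_le.mp (habs m le_rfl hmN)
    linarith
  calc _ ≤ ‖∑ i ∈ Ico m N, e (f i)‖ + 1 := (norm_add_le _ _).trans (by rw [norm_e])
    _ ≤ 2 * ((1 / 2 + 1 / (4 * θ)) + 1 / (2 * θ)) + 1 := by
        rw [hsum]; refine add_le_add (habel.trans ?_) le_rfl; gcongr
    _ ≤ 3 / θ := by
        have e1 : 1 / (4 * θ) = 1 / θ / 4 := by field_simp
        have e2 : 1 / (2 * θ) = 1 / θ / 2 := by field_simp
        have e3 : 3 / θ = 3 * (1 / θ) := by ring
        rw [e1, e2, e3]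
        have : 2 ≤ 1 / θ := by rw [le_div_iff₀ hθ]; linarith
        linarith

lemma Finset.eq_Ico_of_ordConnected {s : Finset ℕ}
    (hs : ∀ x ∈ s, ∀ y ∈ s, ∀ z, x ≤ z → z ≤ y → z ∈ s) : ∃ m n, s = Ico m n := by
  rcases s.eq_empty_or_nonempty with rfl | hne
  · exact ⟨0, 0, by simp⟩
  · refine ⟨s.min' hne, s.max' hne + 1, ?_⟩
    ext z
    rw [mem_Ico]
    refine ⟨fun hz => ⟨s.min'_le z hz, Nat.lt_succ_of_le (s.le_max' z hz)⟩, fun hz => ?_⟩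
    exact hs _ (s.min'_mem hne) _ (s.max'_mem hne) z hz.1 (by omega)

/-- Discrete form of van der Corput's second derivative test. -/
lemma van_der_corput (f : ℕ → ℝ) {a b : ℕ} {l h : ℝ} (hl : 0 < l) (hh : 1 ≤ h)
    (hlow : ∀ i, a ≤ i → i + 1 < b → l ≤ f (i + 2) - f (i + 1) - (f (i + 1) - f i))
    (hup : ∀ i, a ≤ i → i + 1 < b → f (i + 2) - f (i + 1) - (f (i + 1) - f i) ≤ h * l) :
    ‖∑ i ∈ Ico a b, e (f i)‖ ≤ (h * l * (b - a : ℕ) + 2) * (8 / √l) := by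
  have hsq : 0 < √l := Real.sqrt_pos.mpr hl
  have hsl : √l * √l = l := Real.mul_self_sqrt hl.le
  have htriv : ‖∑ i ∈ Ico a b, e (f i)‖ ≤ (b - a : ℕ) := by
    refine (norm_sum_le _ _).trans ?_
    simp [norm_e]
  rcases lt_or_ge (1 / 2) (√l) with hbig | hsmall
  · refine htriv.trans ?_
    have e1 : (h * l * (b - a : ℕ) + 2) * (8 / √l) = 8 * h * √l * (b - a : ℕ) + 16 / √l := by
      have : l / √l = √l := Real.div_sqrt
      linear_combination 8 * h * ((b - a : ℕ) : ℝ) * this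
    rw [e1]
    have : (1 : ℝ) ≤ 8 * h * √l := by nlinarith
    have h3 : (0 : ℝ) ≤ ((b - a : ℕ) : ℝ) := Nat.cast_nonneg _
    have : 0 < 16 / √l := by positivity
    nlinarith
  rcases le_or_gt b a with hba | hab
  · rw [Ico_eq_empty (by omega)]; simp; positivity
  set θ := √l with hθ
  set g : ℕ → ℝ := fun i => f (i + 1) - f i with hg
  have hg1 : ∀ i j, a ≤ i → i ≤ j → j < b → l * (j - i : ℕ) ≤ g j - g i := by
    intro i j h1 h2
    induction j, h2 using Nat.le_induction with
    | base => simp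
    | succ j hj ih =>
      intro h3
      have := ih (by omega)
      have h4 := hlow j (by omega) (by omega)
      rw [show j + 1 - i = (j - i) + 1 by omega]
      push_cast
      simp only [hg] at this ⊢
      linarith
  have hg2 : ∀ i j, a ≤ i → i ≤ j → j < b → g j - g i ≤ h * l * (j - i : ℕ) := by
    intro i j h1 h2
    induction j, h2 using Nat.le_induction with
    | base => simp
    | succ j hj ih =>
      intro h3
      have := ih (by omega)
      have h4 := hup j (by omega) (by omega)
      rw [show j + 1 - i = (j - i) + 1 by omega]
      push_cast
      simp only [hg] at this ⊢
      linarith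
  have hgm : ∀ i j, a ≤ i → i ≤ j → j < b → g i ≤ g j := by
    intro i j h1 h2 h3
    have := hg1 i j h1 h2 h3
    have : 0 ≤ l * ((j - i : ℕ) : ℝ) := by positivity
    linarith
  set κ : ℕ → ℤ := fun i => ⌊g i + θ⌋ with hκ
  have hmaps : ∀ i ∈ Ico a b, κ i ∈ Icc (κ a) (κ (b - 1)) := by
    intro i hi
    rw [mem_Ico] at hi
    rw [mem_Icc]
    constructor
    · exact Int.floor_mono (by have := hgm a i le_rfl hi.1 hi.2; linarith)
    · exact Int.floor_mono (by have := hgm i (b - 1) hi.1 (by omega) (by omega); linarith)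
  rw [← sum_fiberwise_of_maps_to hmaps]
  have hfib : ∀ k ∈ Icc (κ a) (κ (b - 1)), ‖∑ i ∈ Ico a b with κ i = k, e (f i)‖ ≤ 8 / θ := by
    intro k _
    rw [← sum_filter_add_sum_filter_not _ (fun i => g i + θ < k + 2 * θ)]
    set s1 := {i ∈ {i ∈ Ico a b | κ i = k} | g i + θ < k + 2 * θ} with hs1
    set s2 := {i ∈ {i ∈ Ico a b | κ i = k} | ¬ g i + θ < k + 2 * θ} with hs2
    have m1 : ∀ i, i ∈ s1 ↔ (a ≤ i ∧ i < b) ∧ k ≤ g i + θ ∧ g i + θ < k + 2 * θ := by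
      intro i
      simp only [hs1, mem_filter, mem_Ico, hκ, Int.floor_eq_iff]
      constructor
      · rintro ⟨⟨h1, h2⟩, h3⟩; exact ⟨h1, h2.1, h3⟩
      · rintro ⟨h1, h2, h3⟩; exact ⟨⟨h1, h2, by linarith⟩, h3⟩
    have m2 : ∀ i, i ∈ s2 ↔ (a ≤ i ∧ i < b) ∧ k + 2 * θ ≤ g i + θ ∧ g i + θ < k + 1 := by
      intro i
      simp only [hs2, mem_filter, mem_Ico, hκ, Int.floor_eq_iff, not_lt]
      constructor
      · rintro ⟨⟨h1, h2⟩, h3⟩; exact ⟨h1, h3, h2.2⟩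
      · rintro ⟨h1, h2, h3⟩; exact ⟨⟨h1, by linarith, h3⟩, h2⟩
    have b1 : ‖∑ i ∈ s1, e (f i)‖ ≤ 2 / θ + 1 := by
      obtain ⟨m, n, hmn⟩ := Finset.eq_Ico_of_ordConnected (s := s1) (by
        intro x hx y hy z h1 h2
        rw [m1] at hx hy ⊢
        have := hgm x z hx.1.1 h1 (by omega)
        have := hgm z y (by omega) h2 (by omega)
        exact ⟨by omega, by linarith [hx.2.1], by linarith [hy.2.2]⟩)
      refine (norm_sum_le _ _).trans ?_
      simp only [norm_e, sum_const, nsmul_eq_mul, mul_one]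
      rw [hmn, Nat.card_Ico]
      rcases le_or_gt n m with hh | hh
      · rw [Nat.sub_eq_zero_of_le hh]; simp; positivity
      have q1 := (m1 m).mp (by rw [hmn]; simp [hh])
      have q2 := (m1 (n - 1)).mp (by rw [hmn]; simp; omega)
      have q3 := hg1 m (n - 1) q1.1.1 (by omega) q2.1.2
      rw [show n - m = (n - 1 - m) + 1 by omega]
      push_cast
      have q4 : l * ((n - 1 - m : ℕ) : ℝ) ≤ 2 * θ := by linarith [q1.2.1, q2.2.2]
      have q5 : ((n - 1 - m : ℕ) : ℝ) ≤ 2 / θ := by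
        rw [le_div_iff₀ hsq]
        rw [← hsl] at q4
        nlinarith
      linarith
    have b2 : ‖∑ i ∈ s2, e (f i)‖ ≤ 3 / θ := by
      obtain ⟨m, n, hmn⟩ := Finset.eq_Ico_of_ordConnected (s := s2) (by
        intro x hx y hy z h1 h2
        rw [m2] at hx hy ⊢
        have := hgm x z hx.1.1 h1 (by omega)
        have := hgm z y (by omega) h2 (by omega)
        exact ⟨by omega, by linarith [hx.2.1], by linarith [hy.2.2]⟩)
      rw [hmn]
      have mm : ∀ i, m ≤ i → i < n → (a ≤ i ∧ i < b) ∧ k + 2 * θ ≤ g i + θ ∧ g i + θ < k + 1 := by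
        intro i h1 h2
        rw [← m2, hmn, mem_Ico]; exact ⟨h1, h2⟩
      refine kusmin_landau f hsq hsmall k ?_ ?_ ?_
      · intro i h1 h2
        exact hgm i (i + 1) (mm i h1 (by omega)).1.1 (by omega) (mm (i + 1) (by omega) h2).1.2
      · intro i h1 h2
        have := (mm i h1 h2).2.1
        simp only [hg] at this
        linarith
      · intro i h1 h2
        have := (mm i h1 h2).2.2
        simp only [hg] at this
        linarith
    have e3 : 2 / θ = 2 * (1 / θ) := by ring
    have e5 : 3 / θ = 3 * (1 / θ) := by ring
    have e4 : 8 / θ = 8 * (1 / θ) := by ring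
    have : 2 ≤ 1 / θ := by rw [le_div_iff₀ hsq]; linarith
    refine (norm_add_le _ _).trans ?_
    rw [e3] at b1; rw [e5] at b2; rw [e4]
    linarith
  refine (norm_sum_le _ _).trans ((sum_le_sum hfib).trans ?_)
  rw [sum_const, nsmul_eq_mul, Int.card_Icc]
  gcongr
  have k1 : κ a ≤ κ (b - 1) := Int.floor_mono (by
    have := hgm a (b - 1) le_rfl (by omega) (by omega)
    linarith)
  have k2 : ((κ (b - 1) + 1 - κ a).toNat : ℝ) = κ (b - 1) + 1 - κ a := by
    have : ((κ (b - 1) + 1 - κ a).toNat : ℤ) = κ (b - 1) + 1 - κ a := Int.toNat_of_nonneg (by omega)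
    exact_mod_cast this
  rw [k2]
  have k3 : (κ (b - 1) : ℝ) ≤ g (b - 1) + θ := Int.floor_le _
  have k4 : g a + θ < κ a + 1 := Int.lt_floor_add_one _
  have k5 := hg2 a (b - 1) le_rfl (by omega) (by omega)
  have k6 : h * l * ((b - 1 - a : ℕ) : ℝ) ≤ h * l * ((b - a : ℕ) : ℝ) := by
    gcongr; omega
  linarith

lemma exists_second_difference_rpow (c : ℝ) {u s : ℝ} (hu : 0 < u) (hs : 0 < s) :
    ∃ ξ, u < ξ ∧ ξ < u + 2 * s ∧
      (u + 2 * s) ^ c - (u + s) ^ c - ((u + s) ^ c - u ^ c) = c * (c - 1) * s ^ 2 *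
          ξ ^ (c - 2) := by
  have hd : ∀ v, 0 < v → HasDerivAt (fun v : ℝ => (v + s) ^ c - v ^ c)
      (c * ((v + s) ^ (c - 1) - v ^ (c - 1))) v := by
    intro v hv
    have h1 : HasDerivAt (fun v : ℝ => (v + s) ^ c) (1 * c * (v + s) ^ (c - 1)) v :=
      ((hasDerivAt_id v).add_const s).rpow_const (Or.inl (by simp; linarith))
    have h2 := Real.hasDerivAt_rpow_const (p := c) (Or.inl hv.ne' : v ≠ 0 ∨ 1 ≤ c)
    exact (h1.sub h2).congr_deriv (by ring)
  obtain ⟨v, hv, hv'⟩ := exists_hasDerivAt_eq_slope (fun v : ℝ => (v + s) ^ c - v ^ c)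
    (fun v => c * ((v + s) ^ (c - 1) - v ^ (c - 1))) (show u < u + s by linarith)
    (fun v hv => (hd v (by linarith [hv.1])).continuousAt.continuousWithinAt)
    (fun v hv => hd v (by linarith [hv.1]))
  have hd2 : ∀ w, 0 < w → HasDerivAt (fun w : ℝ => w ^ (c - 1)) ((c - 1) * w ^ (c - 2)) w := by
    intro w hw
    rw [show c - 2 = c - 1 - 1 by ring]
    exact Real.hasDerivAt_rpow_const (p := c - 1) (Or.inl hw.ne')
  have hv0 : 0 < v := by linarith [hv.1]
  obtain ⟨ξ, hξ, hξ'⟩ := exists_hasDerivAt_eq_slope (fun w : ℝ => w ^ (c - 1))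
    (fun w => (c - 1) * w ^ (c - 2)) (show v < v + s by linarith)
    (fun w hw => (hd2 w (by linarith [hw.1])).continuousAt.continuousWithinAt)
    (fun w hw => hd2 w (by linarith [hw.1]))
  refine ⟨ξ, by linarith [hξ.1, hv.1], by linarith [hξ.2, hv.2], ?_⟩
  rw [eq_div_iff (by linarith)] at hv' hξ'
  rw [show u + 2 * s = u + s + s by ring]
  linear_combination -hv' - s * c * hξ'

lemma rpow_ratio_bounds (κ : ℝ) {x ρ : ℝ} (hx : 1 ≤ x) (hxρ : x ≤ ρ) :
    ρ ^ (-|κ|) ≤ x ^ κ ∧ x ^ κ ≤ ρ ^ |κ| := by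
  have hx0 : 0 < x := by linarith
  constructor
  · calc ρ ^ (-|κ|) ≤ x ^ (-|κ|) :=
          Real.rpow_le_rpow_of_nonpos hx0 hxρ (by simp)
      _ ≤ x ^ κ := Real.rpow_le_rpow_of_exponent_le hx (neg_abs_le κ)
  · calc x ^ κ ≤ x ^ |κ| := Real.rpow_le_rpow_of_exponent_le hx (le_abs_self κ)
      _ ≤ ρ ^ |κ| := Real.rpow_le_rpow hx0.le hxρ (abs_nonneg κ)

/-- Exponential sums with phase `τ u ^ c` along an arithmetic progression. -/
lemma exists_norm_sum_e_rpow_le (c ρ : ℝ) (hc : 1 < c) (hρ : 1 ≤ ρ) :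
    ∃ K > 0, ∀ (τ Y s r : ℝ) (a b : ℕ), τ ≠ 0 → 0 < s → s ≤ Y →
      (∀ i ∈ Ico a b, Y ≤ s * i + r ∧ s * i + r ≤ ρ * Y) →
      ‖∑ i ∈ Ico a b, e (τ * (s * i + r) ^ c)‖
        ≤ K * (√(|τ| * Y ^ c) + Y / (s * √(|τ| * Y ^ c))) := by
  set κ := c * (c - 1) * ρ ^ (-|c - 2|) with hκ
  have hρ0 : 0 < ρ := by linarith
  have hκ0 : 0 < κ := by
    have : 0 < c - 1 := by linarith
    positivity
  set h := ρ ^ (2 * |c - 2|) with hh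
  have hh1 : 1 ≤ h := Real.one_le_rpow hρ (by positivity)
  set K1 := 8 * h * √κ * (ρ + 1) + 16 / √κ with hK1
  have hsκ : 0 < √κ := Real.sqrt_pos.mpr hκ0
  have hK1p : 0 < K1 := by positivity
  refine ⟨K1 + 1, by positivity, ?_⟩
  intro τ Y s r a b hτ hs hsY hrange
  have hY : 0 < Y := by linarith
  have hτ0 : 0 < |τ| := abs_pos.mpr hτ
  set Z := √(|τ| * Y ^ c) with hZ
  have hZ0 : 0 < Z := Real.sqrt_pos.mpr (by positivity)
  have hone : 1 ≤ Z + Y / (s * Z) := by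
    have h1 : 1 / Z ≤ Y / (s * Z) := by
      rw [div_le_div_iff₀ hZ0 (by positivity)]; nlinarith
    have h2 : 1 ≤ Z + 1 / Z := by
      rcases le_total 1 Z with h | h
      · have : 0 < 1 / Z := by positivity
        linarith
      · have : 1 ≤ 1 / Z := by rw [le_div_iff₀ hZ0]; linarith
        linarith
    linarith
  rcases le_or_gt b a with hba | hab
  · rw [Ico_eq_empty (by omega)]; simp; positivity
  obtain ⟨N, rfl⟩ : ∃ N, b = N + 1 := ⟨b - 1, by omega⟩
  have haN : a ≤ N := by omega
  rw [sum_Ico_succ_top haN]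
  refine (norm_add_le _ _).trans ?_
  rw [norm_e, add_mul, one_mul]
  refine add_le_add ?_ hone
  -- the signed phase
  wlog hpos : 0 < τ generalizing τ with H
  · have hneg : 0 < -τ := by
      rcases lt_or_gt_of_ne hτ with h | h
      · linarith
      · exact absurd h hpos
    have := H (-τ) (by simpa using hτ) (by rwa [abs_neg]) (by rw [abs_neg])
      (by rwa [abs_neg]) (by rwa [abs_neg]) hneg
    rw [abs_neg] at this
    refine le_trans (le_of_eq ?_) this
    rw [← Complex.norm_conj, map_sum]
    congr 1
    refine sum_congr rfl fun i _ => ?_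
    rw [← e_neg]; ring_nf
  rw [abs_of_pos hpos] at hZ hτ0
  set l := κ * s ^ 2 * τ * Y ^ (c - 2) with hl
  have hl0 : 0 < l := by positivity
  have hsec : ∀ i, a ≤ i → i + 1 < N → ∃ x, 1 ≤ x ∧ x ≤ ρ ∧
      τ * (s * ((i + 2 : ℕ) : ℝ) + r) ^ c - τ * (s * ((i + 1 : ℕ) : ℝ) + r) ^ c
        - (τ * (s * ((i + 1 : ℕ) : ℝ) + r) ^ c - τ * (s * (i : ℝ) + r) ^ c)
        = c * (c - 1) * s ^ 2 * τ * Y ^ (c - 2) * x ^ (c - 2) := by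
    intro i h1 h2
    have r1 := hrange i (by rw [mem_Ico]; omega)
    have r2 := hrange (i + 2) (by rw [mem_Ico]; omega)
    obtain ⟨ξ, k1, k2, k3⟩ := exists_second_difference_rpow c (u := s * i + r) (by linarith) hs
    push_cast at r2 ⊢
    have k4 : ξ = Y * (ξ / Y) := by field_simp
    refine ⟨ξ / Y, by rw [le_div_iff₀ hY]; linarith, by rw [div_le_iff₀ hY]; nlinarith, ?_⟩
    have k5 : ξ ^ (c - 2) = Y ^ (c - 2) * (ξ / Y) ^ (c - 2) := by
      conv_lhs => rw [k4]
      rw [Real.mul_rpow hY.le]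
      exact div_nonneg (by linarith) hY.le
    rw [k5] at k3
    rw [show s * ((i : ℝ) + 2) + r = s * i + r + 2 * s by ring,
      show s * ((i : ℝ) + 1) + r = s * i + r + s by ring]
    linear_combination τ * k3
  have hvdc := van_der_corput (fun i => τ * (s * i + r) ^ c) (a := a) (b := N) hl0 hh1 (by
      intro i h1 h2
      obtain ⟨x, x1, x2, hx⟩ := hsec i h1 h2
      rw [hx]
      have := (rpow_ratio_bounds (c - 2) x1 x2).1
      have hcc : 0 ≤ c * (c - 1) * s ^ 2 * τ * Y ^ (c - 2) := by
        have : 0 < c - 1 := by linarith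
        positivity
      calc l = c * (c - 1) * s ^ 2 * τ * Y ^ (c - 2) * ρ ^ (-|c - 2|) := by
            rw [hl, hκ]; ring
        _ ≤ _ := by gcongr) (by
      intro i h1 h2
      obtain ⟨x, x1, x2, hx⟩ := hsec i h1 h2
      rw [hx]
      have := (rpow_ratio_bounds (c - 2) x1 x2).2
      have hcc : 0 ≤ c * (c - 1) * s ^ 2 * τ * Y ^ (c - 2) := by
        have : 0 < c - 1 := by linarith
        positivity
      calc c * (c - 1) * s ^ 2 * τ * Y ^ (c - 2) * x ^ (c - 2)
          ≤ c * (c - 1) * s ^ 2 * τ * Y ^ (c - 2) * ρ ^ |c - 2| := by gcongr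
        _ = h * l := by
            rw [hl, hκ, hh, show 2 * |c - 2| = |c - 2| + |c - 2| by ring, Real.rpow_add hρ0,
              Real.rpow_neg hρ0.le]
            field_simp)
  refine hvdc.trans ?_
  have hsl : √l = √κ * (s / Y * Z) := by
    have : l = κ * ((s / Y) ^ 2 * (τ * Y ^ c)) := by
      rw [hl, Real.rpow_sub hY, Real.rpow_two]; field_simp
    clear_value κ
    rw [this, Real.sqrt_mul hκ0.le, Real.sqrt_mul (by positivity), Real.sqrt_sq (by positivity), hZ]
  have hlen : ((N - a : ℕ) : ℝ) ≤ (ρ + 1) * (Y / s) := by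
    have r1 := (hrange a (by rw [mem_Ico]; omega)).1
    have r2 := (hrange N (by rw [mem_Ico]; omega)).2
    rw [Nat.cast_sub haN, ← mul_div_assoc, le_div_iff₀ hs]
    nlinarith
  have hsl0 : 0 < √l := Real.sqrt_pos.mpr hl0
  have e1 : l / √l = √l := Real.div_sqrt
  calc (h * l * ((N - a : ℕ) : ℝ) + 2) * (8 / √l)
      = 8 * h * √l * ((N - a : ℕ) : ℝ) + 16 / √l := by
        linear_combination (8 * h * ((N - a : ℕ) : ℝ)) * e1
    _ ≤ 8 * h * √l * ((ρ + 1) * (Y / s)) + 16 / √l := by gcongr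
    _ = (8 * h * √κ * (ρ + 1)) * Z + 16 / √κ * (Y / (s * Z)) := by
        rw [hsl]; field_simp
    _ ≤ K1 * Z + K1 * (Y / (s * Z)) := by
        gcongr
        · rw [hK1]; have : 0 < 16 / √κ := by positivity
          linarith
        · rw [hK1]; have : 0 < 8 * h * √κ * (ρ + 1) := by positivity
          linarith
    _ = _ := by ring

/-- Exponential sums with phase `τ m ^ c` twisted by a bounded periodic function. -/
lemma exists_norm_sum_periodic_e_rpow_le (c ρ : ℝ) (hc : 1 < c) (hρ : 1 ≤ ρ) :
    ∃ K > 0, ∀ (τ Y : ℝ) (q a b : ℕ) (χ : ZMod q → ℂ), τ ≠ 0 → 0 < q → q ≤ Y →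
      (∀ x, ‖χ x‖ ≤ 1) → (∀ i ∈ Ico a b, Y ≤ i ∧ i ≤ ρ * Y) →
      ‖∑ i ∈ Ico a b, χ (i : ZMod q) * e (τ * (i : ℝ) ^ c)‖
        ≤ K * (q * √(|τ| * Y ^ c) + Y / √(|τ| * Y ^ c)) := by
  obtain ⟨K, hK, H⟩ := exists_norm_sum_e_rpow_le c ρ hc hρ
  refine ⟨K, hK, ?_⟩
  intro τ Y q a b χ hτ hq hqY hχ hrange
  have hq' : (0 : ℝ) < q := by exact_mod_cast hq
  rw [← sum_fiberwise_of_maps_to (t := range q) (g := fun i => i % q)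
    (fun i _ => mem_range.mpr (Nat.mod_lt _ hq))]
  have hfib : ∀ r ∈ range q, ‖∑ i ∈ Ico a b with i % q = r, χ (i : ZMod q) * e (τ * (i : ℝ) ^ c)‖
      ≤ K * (√(|τ| * Y ^ c) + Y / (q * √(|τ| * Y ^ c))) := by
    intro r hr
    rw [mem_range] at hr
    obtain ⟨m, n, hmn⟩ := Finset.eq_Ico_of_ordConnected
      (s := {i ∈ range b | a ≤ q * i + r ∧ q * i + r < b}) (by
        intro x hx y hy z h1 h2
        simp only [mem_filter, mem_range] at hx hy ⊢
        have : q * x ≤ q * z := Nat.mul_le_mul_left q h1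
        have : q * z ≤ q * y := Nat.mul_le_mul_left q h2
        omega)
    have hmem : ∀ j, j ∈ Ico m n ↔ (a ≤ q * j + r ∧ q * j + r < b) := by
      intro j
      rw [← hmn, mem_filter, mem_range]
      refine ⟨fun h => h.2, fun h => ⟨?_, h⟩⟩
      have : j ≤ q * j := Nat.le_mul_of_pos_left j hq
      omega
    have hre : ∑ i ∈ Ico a b with i % q = r, χ (i : ZMod q) * e (τ * (i : ℝ) ^ c)
        = ∑ j ∈ Ico m n, χ (r : ZMod q) * e (τ * ((q : ℝ) * j + r) ^ c) := by
      symm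
      refine sum_nbij (fun j => q * j + r) ?_ ?_ ?_ ?_
      · intro j hj
        have := (hmem j).mp hj
        simp only [mem_filter, mem_Ico]
        exact ⟨this, by rw [Nat.mul_add_mod, Nat.mod_eq_of_lt hr]⟩
      · intro x _ y _ hxy
        simp only at hxy
        exact Nat.eq_of_mul_eq_mul_left hq (by omega)
      · intro i hi
        simp only [coe_filter, mem_Ico, Set.mem_ofPred_eq] at hi
        have hdm := Nat.div_add_mod i q
        refine ⟨i / q, ?_, ?_⟩
        · rw [mem_coe, hmem]; rw [hi.2] at hdm; omega
        · simp only; rw [hi.2] at hdm; exact hdm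
      · intro j _
        push_cast
        simp
    rw [hre, ← mul_sum, norm_mul]
    refine (mul_le_of_le_one_left (norm_nonneg _) (hχ _)).trans ?_
    refine H τ Y q r m n hτ hq' hqY ?_
    intro j hj
    have := hrange (q * j + r) (by rw [mem_Ico]; exact (hmem j).mp hj)
    push_cast at this
    exact this
  refine (norm_sum_le _ _).trans ((sum_le_sum hfib).trans (le_of_eq ?_))
  rw [sum_const, card_range, nsmul_eq_mul]
  field_simp

lemma sum_range_one_div_sqrt_le (n : ℕ) : ∑ k ∈ range (n + 1), 1 / √(k : ℝ) ≤ 2 * √(n : ℝ) := by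
  induction n with
  | zero => simp
  | succ n ih =>
    rw [sum_range_succ]
    refine (add_le_add ih le_rfl).trans ?_
    have h1 : 0 < √((n + 1 : ℕ) : ℝ) := Real.sqrt_pos.mpr (by positivity)
    have h0 : 0 ≤ √(n : ℝ) := Real.sqrt_nonneg _
    have h2 : √((n + 1 : ℕ) : ℝ) ^ 2 = n + 1 := by rw [Real.sq_sqrt (by positivity)]; simp
    have h3 : √(n : ℝ) ^ 2 = n := Real.sq_sqrt (by positivity)
    have : 1 / √((n + 1 : ℕ) : ℝ) ≤ 2 * (√((n + 1 : ℕ) : ℝ) - √(n : ℝ)) := by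
      rw [div_le_iff₀ h1]
      nlinarith [sq_nonneg (√((n + 1 : ℕ) : ℝ) - √(n : ℝ))]
    linarith

lemma sum_one_div_sqrt_abs_sub_le (M m : ℕ) (hm : m ∈ Ico M (2 * M)) :
    ∑ k ∈ Ico M (2 * M), 1 / √|(m : ℝ) - k| ≤ 4 * √(M : ℝ) := by
  rw [mem_Ico] at hm
  have hsplit : Ico M (2 * M) = Ico M m ∪ Ico m (2 * M) :=
    (Ico_union_Ico_eq_Ico hm.1 hm.2.le).symm
  rw [hsplit, sum_union (Ico_disjoint_Ico_consecutive _ _ _)]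
  have h1 : ∑ k ∈ Ico M m, 1 / √|(m : ℝ) - k| ≤ 2 * √(M : ℝ) := by
    have e1 : ∑ k ∈ Ico M m, 1 / √|(m : ℝ) - k|
        = ∑ j ∈ (Ico M m).image (fun k => m - k), 1 / √(j : ℝ) := by
      rw [sum_image]
      · refine sum_congr rfl fun k hk => ?_
        rw [mem_Ico] at hk
        rw [Nat.cast_sub hk.2.le, abs_of_nonneg]
        have : (k : ℝ) ≤ m := by exact_mod_cast hk.2.le
        linarith
      · intro x hx y hy hxy
        simp only [coe_Ico, Set.mem_Ico] at hx hy hxy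
        omega
    rw [e1]
    refine le_trans (sum_le_sum_of_subset_of_nonneg (t := range (M + 1)) ?_
      fun _ _ _ => by positivity)
      (sum_range_one_div_sqrt_le M)
    intro j hj
    simp only [mem_image, mem_Ico, mem_range] at hj ⊢
    omega
  have h2 : ∑ k ∈ Ico m (2 * M), 1 / √|(m : ℝ) - k| ≤ 2 * √(M : ℝ) := by
    have e1 : ∑ k ∈ Ico m (2 * M), 1 / √|(m : ℝ) - k|
        = ∑ j ∈ (Ico m (2 * M)).image (fun k => k - m), 1 / √(j : ℝ) := by
      rw [sum_image]
      · refine sum_congr rfl fun k hk => ?_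
        rw [mem_Ico] at hk
        have : (m : ℝ) ≤ k := by exact_mod_cast hk.1
        rw [Nat.cast_sub hk.1, abs_of_nonpos (by linarith), neg_sub]
      · intro x hx y hy hxy
        simp only [coe_Ico, Set.mem_Ico] at hx hy hxy
        omega
    rw [e1]
    refine le_trans (sum_le_sum_of_subset_of_nonneg (t := range (M + 1)) ?_
      fun _ _ _ => by positivity)
      (sum_range_one_div_sqrt_le M)
    intro j hj
    simp only [mem_image, mem_Ico, mem_range] at hj ⊢
    omega
  linarith

lemma rpow_sub_rpow_ge {c : ℝ} (hc : 1 < c) {M x y : ℝ} (hM : 0 < M) (hx : M ≤ x) (hxy : x ≤ y) :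
    M ^ (c - 1) * (y - x) ≤ y ^ c - x ^ c := by
  have hx0 : 0 < x := by linarith
  have e1 : ∀ z : ℝ, 0 < z → z ^ c = z * z ^ (c - 1) := by
    intro z hz
    rw [Real.rpow_sub_one hz.ne']; field_simp
  rw [e1 x hx0, e1 y (by linarith)]
  have h1 : M ^ (c - 1) ≤ x ^ (c - 1) := Real.rpow_le_rpow hM.le hx (by linarith)
  have h2 : x ^ (c - 1) ≤ y ^ (c - 1) := Real.rpow_le_rpow hx0.le hxy (by linarith)
  nlinarith [mul_le_mul_of_nonneg_left h2 (show 0 ≤ y by linarith),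
    mul_le_mul_of_nonneg_left h1 (show 0 ≤ y - x by linarith)]

lemma abs_rpow_sub_rpow_ge {c : ℝ} (hc : 1 < c) {M x y : ℝ} (hM : 0 < M) (hx : M ≤ x) (hy : M ≤ y) :
    M ^ (c - 1) * |x - y| ≤ |x ^ c - y ^ c| := by
  rcases le_total x y with h | h
  · rw [abs_sub_comm, abs_sub_comm (x ^ c), abs_of_nonneg (sub_nonneg.mpr h)]
    exact (rpow_sub_rpow_ge hc hM hx h).trans (le_abs_self _)
  · rw [abs_of_nonneg (sub_nonneg.mpr h)]
    exact (rpow_sub_rpow_ge hc hM hy h).trans (le_abs_self _)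

/-- The off-diagonal correlation sums in the dispersion of a bilinear form. -/
lemma exists_norm_correlation_le (μ c : ℝ) (hμ0 : 0 < μ) (hμ1 : μ < 1) (hc : 1 < c) :
    ∃ K > 0, ∀ (X t : ℝ) (M m₁ m₂ : ℕ), t ≠ 0 → 0 < M → 2 * M ≤ μ * X →
      m₁ ∈ Ico M (2 * M) → m₂ ∈ Ico M (2 * M) → m₁ ≠ m₂ → ∀ s : Finset ℕ,
      (∀ n, n ∈ s ↔ (⌊μ * X⌋₊ < m₁ * n ∧ m₁ * n ≤ ⌊X⌋₊) ∧ (⌊μ * X⌋₊ < m₂ * n ∧ m₂ * n ≤ ⌊X⌋₊)) →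
      ‖∑ n ∈ s, e (t * ((m₁ : ℝ) ^ c - (m₂ : ℝ) ^ c) * (n : ℝ) ^ c)‖
        ≤ K * (√(|t| * X ^ c) + X / √M / √(|t| * X ^ c) * (1 / √|(m₁ : ℝ) - m₂|)) := by
  obtain ⟨K, hK, H⟩ := exists_norm_sum_e_rpow_le c (2 / μ) hc (by rw [le_div_iff₀ hμ0]; linarith)
  set κ := √((2 / μ) ^ c) with hκ
  have hκ0 : 0 < κ := Real.sqrt_pos.mpr (by positivity)
  refine ⟨K * (1 + κ), by positivity, ?_⟩
  intro X t M m₁ m₂ ht hM hMX h1 h2 hne s hs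
  rw [mem_Ico] at h1 h2
  have hM' : (0 : ℝ) < M := by exact_mod_cast hM
  have hX : 0 < X := by
    by_contra h
    push Not at h
    nlinarith
  obtain ⟨m, n, hmn⟩ := Finset.eq_Ico_of_ordConnected (s := s) (by
    intro x hx y hy z k1 k2
    rw [hs] at hx hy ⊢
    have q1 : m₁ * x ≤ m₁ * z := Nat.mul_le_mul_left _ k1
    have q2 : m₁ * z ≤ m₁ * y := Nat.mul_le_mul_left _ k2
    have q3 : m₂ * x ≤ m₂ * z := Nat.mul_le_mul_left _ k1
    have q4 : m₂ * z ≤ m₂ * y := Nat.mul_le_mul_left _ k2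
    omega)
  rw [hmn]
  set Y := μ * X / (2 * M) with hY
  have hY0 : 0 < Y := by positivity
  have hm1 : (M : ℝ) ≤ m₁ := by exact_mod_cast h1.1
  have hm2 : (M : ℝ) ≤ m₂ := by exact_mod_cast h2.1
  have hm1' : (m₁ : ℝ) ≤ 2 * M := by exact_mod_cast h1.2.le
  have hm2' : (m₂ : ℝ) ≤ 2 * M := by exact_mod_cast h2.2.le
  have hΔ : 0 < |(m₁ : ℝ) - m₂| := abs_pos.mpr (sub_ne_zero.mpr (by exact_mod_cast hne))
  set Δ := |(m₁ : ℝ) - m₂| with hΔdef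
  have hdiff := abs_rpow_sub_rpow_ge hc hM' hm1 hm2
  have hdiff0 : 0 < |(m₁ : ℝ) ^ c - (m₂ : ℝ) ^ c| := lt_of_lt_of_le (by positivity) hdiff
  have hτ : t * ((m₁ : ℝ) ^ c - (m₂ : ℝ) ^ c) ≠ 0 := mul_ne_zero ht (abs_pos.mp hdiff0)
  have hP := H (t * ((m₁ : ℝ) ^ c - (m₂ : ℝ) ^ c)) Y 1 0 m n hτ one_pos (by
    rw [hY, le_div_iff₀ (by positivity)]; linarith) (by
    intro i hi
    rw [← hmn, hs] at hi
    have k1 : μ * X < (m₁ * i : ℕ) := (Nat.floor_lt' (by omega)).mp hi.1.1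
    have k2 : ((m₁ * i : ℕ) : ℝ) ≤ X := (Nat.le_floor_iff hX.le).mp hi.1.2
    push_cast at k1 k2
    have hi0 : (0 : ℝ) ≤ i := Nat.cast_nonneg _
    constructor
    · rw [hY, div_le_iff₀ (by positivity)]
      nlinarith
    · have : 2 / μ * Y = X / M := by rw [hY]; field_simp
      rw [this, le_div_iff₀ hM']
      nlinarith)
  simp only [one_mul, add_zero] at hP
  refine hP.trans ?_
  rw [abs_mul]
  set T := |t| * X ^ c with hT
  have ht0 : 0 < |t| := abs_pos.mpr ht
  have hT0 : 0 < T := by positivity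
  have hYc : Y ^ c = μ ^ c * X ^ c / ((2 : ℝ) ^ c * (M : ℝ) ^ c) := by
    rw [hY, Real.div_rpow (by positivity) (by positivity), Real.mul_rpow hμ0.le hX.le,
      Real.mul_rpow (by norm_num) hM'.le]
  have up : |t| * |(m₁ : ℝ) ^ c - (m₂ : ℝ) ^ c| * Y ^ c ≤ T := by
    have : |(m₁ : ℝ) ^ c - (m₂ : ℝ) ^ c| ≤ (2 * M : ℝ) ^ c := by
      have a1 : (m₁ : ℝ) ^ c ≤ (2 * M : ℝ) ^ c := Real.rpow_le_rpow (by positivity) hm1'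
          (by linarith)
      have a2 : (m₂ : ℝ) ^ c ≤ (2 * M : ℝ) ^ c := Real.rpow_le_rpow (by positivity) hm2'
          (by linarith)
      have a3 : 0 ≤ (m₁ : ℝ) ^ c := by positivity
      have a4 : 0 ≤ (m₂ : ℝ) ^ c := by positivity
      rw [abs_le]; constructor <;> linarith
    calc _ ≤ |t| * (2 * M : ℝ) ^ c * Y ^ c := by gcongr
      _ = T * μ ^ c := by
        rw [hYc, hT, Real.mul_rpow (by norm_num) hM'.le]; field_simp
      _ ≤ T * 1 := by gcongr; exact Real.rpow_le_one hμ0.le hμ1.le (by linarith)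
      _ = T := mul_one _
  have low : T * (μ / 2) ^ c * (Δ / M) ≤ |t| * |(m₁ : ℝ) ^ c - (m₂ : ℝ) ^ c| * Y ^ c := by
    calc T * (μ / 2) ^ c * (Δ / M) = |t| * ((M : ℝ) ^ (c - 1) * Δ) * Y ^ c := by
          rw [hYc, hT, Real.rpow_sub_one hM'.ne', Real.div_rpow hμ0.le (by norm_num)]; field_simp
      _ ≤ _ := by gcongr
  clear_value T
  have hsq1 : √(|t| * |(m₁ : ℝ) ^ c - (m₂ : ℝ) ^ c| * Y ^ c) ≤ √T := Real.sqrt_le_sqrt up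
  have hsq2 : √T / κ * (√Δ / √M) ≤ √(|t| * |(m₁ : ℝ) ^ c - (m₂ : ℝ) ^ c| * Y ^ c) := by
    refine le_trans (le_of_eq ?_) (Real.sqrt_le_sqrt low)
    rw [Real.sqrt_mul (by positivity), Real.sqrt_mul hT0.le, Real.sqrt_div hΔ.le, hκ,
      show (μ / 2) = (2 / μ)⁻¹ by rw [inv_div], Real.inv_rpow (by positivity), Real.sqrt_inv]
    ring
  have hMs : 0 < √(M : ℝ) := Real.sqrt_pos.mpr hM'
  have hΔs : 0 < √Δ := Real.sqrt_pos.mpr hΔ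
  have hTs : 0 < √T := Real.sqrt_pos.mpr hT0
  have hYle : Y ≤ X / M := by
    rw [hY, div_le_div_iff₀ (by positivity) hM']; nlinarith [mul_pos hX hM']
  have hlast : Y / √(|t| * |(m₁ : ℝ) ^ c - (m₂ : ℝ) ^ c| * Y ^ c)
      ≤ κ * (X / √M / √T * (1 / √Δ)) := by
    calc _ ≤ (X / M) / (√T / κ * (√Δ / √M)) := by gcongr
      _ = κ * (X / √M / √T * (1 / √Δ)) := by
        have : (M : ℝ) = √M * √M := (Real.mul_self_sqrt hM'.le).symm
        rw [show X / (M : ℝ) = X / (√M * √M) by rw [← this]]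
        field_simp
  have hp1 : 0 ≤ X / √M / √T * (1 / √Δ) := by positivity
  calc _ ≤ K * (√T + κ * (X / √M / √T * (1 / √Δ))) := by gcongr
    _ ≤ K * (1 + κ) * (√T + X / √M / √T * (1 / √Δ)) := by
      rw [mul_assoc]
      gcongr
      nlinarith [mul_pos hκ0 hTs]

lemma sum_norm_sum_sq_le {ι κ : Type*} (I : Finset ι) (J : Finset κ) (A : ι → κ → ℂ) :
    ∑ n ∈ J, ‖∑ m ∈ I, A m n‖ ^ 2
      ≤ ∑ m₁ ∈ I, ∑ m₂ ∈ I, ‖∑ n ∈ J, A m₁ n * (starRingEnd ℂ) (A m₂ n)‖ := by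
  have h1 : ((∑ n ∈ J, ‖∑ m ∈ I, A m n‖ ^ 2 : ℝ) : ℂ)
      = ∑ m₁ ∈ I, ∑ m₂ ∈ I, ∑ n ∈ J, A m₁ n * (starRingEnd ℂ) (A m₂ n) := by
    push_cast
    rw [sum_congr rfl fun n _ => by
      rw [← Complex.mul_conj', map_sum, sum_mul_sum], sum_comm]
    exact sum_congr rfl fun m _ => sum_comm
  have h2 : ∑ n ∈ J, ‖∑ m ∈ I, A m n‖ ^ 2
      = ‖((∑ n ∈ J, ‖∑ m ∈ I, A m n‖ ^ 2 : ℝ) : ℂ)‖ := by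
    rw [Complex.norm_real, Real.norm_of_nonneg (by positivity)]
  rw [h2, h1]
  exact (norm_sum_le _ _).trans (sum_le_sum fun m _ => norm_sum_le _ _)

/-- A dyadic block of a bilinear sum. -/
lemma exists_norm_bilinear_block_le (μ c : ℝ) (hμ0 : 0 < μ) (hμ1 : μ < 1) (hc : 1 < c) :
    ∃ K > 0, ∀ (X t : ℝ) (M : ℕ) (α β : ℕ → ℂ), t ≠ 0 → 0 < M → 2 * M ≤ μ * X →
      (∀ m, ‖α m‖ ≤ 1) → (∀ n, ‖β n‖ ≤ 1) →
      ‖∑ m ∈ Ico M (2 * M), ∑ n ∈ Icc 1 ⌊X⌋₊,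
        (if ⌊μ * X⌋₊ < m * n ∧ m * n ≤ ⌊X⌋₊ then
          α m * β n * e (t * ((m : ℝ) * n) ^ c) else 0)‖ ^ 2
        ≤ K * (X ^ 2 / M + M * X * √(|t| * X ^ c) + X ^ 2 / √(|t| * X ^ c)) := by
  obtain ⟨K, hK, H⟩ := exists_norm_correlation_le μ c hμ0 hμ1 hc
  refine ⟨1 + 4 * K, by positivity, ?_⟩
  intro X t M α β ht hM hMX hα hβ
  have hM' : (0 : ℝ) < M := by exact_mod_cast hM
  have hX : 0 < X := by
    by_contra h
    push Not at h
    nlinarith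
  set a := ⌊μ * X⌋₊ with ha
  set b := ⌊X⌋₊ with hb
  set T := |t| * X ^ c with hT
  have hT0 : 0 < T := by have := abs_pos.mpr ht; positivity
  set I := Ico M (2 * M) with hI
  set J := Icc 1 (b / M) with hJ
  have hJc : (#J : ℝ) ≤ X / M := by
    rw [hJ, Nat.card_Icc, Nat.add_sub_cancel, le_div_iff₀ hM']
    calc ((b / M : ℕ) : ℝ) * M = ((b / M * M : ℕ) : ℝ) := by push_cast; ring
      _ ≤ b := by exact_mod_cast Nat.div_mul_le_self _ _
      _ ≤ X := Nat.floor_le hX.le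
  set A : ℕ → ℕ → ℂ := fun m n => if a < m * n ∧ m * n ≤ b then
    α m * e (t * ((m : ℝ) * n) ^ c) else 0 with hA
  have hS : ∑ m ∈ I, ∑ n ∈ Icc 1 b, (if a < m * n ∧ m * n ≤ b then
          α m * β n * e (t * ((m : ℝ) * n) ^ c) else 0) = ∑ n ∈ J, β n * ∑ m ∈ I, A m n := by
    rw [sum_congr rfl fun n _ => mul_sum _ _ _, sum_comm (s := J)]
    refine sum_congr rfl fun m hm => ?_
    rw [hI, mem_Ico] at hm
    symm
    rw [sum_congr rfl (g := fun n => if a < m * n ∧ m * n ≤ b then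
          α m * β n * e (t * ((m : ℝ) * n) ^ c) else 0) (by
      intro n _
      simp only [hA]
      split_ifs
      · ring
      · simp)]
    refine sum_subset ?_ ?_
    · intro n hn
      rw [hJ, mem_Icc] at hn
      rw [mem_Icc]
      exact ⟨hn.1, hn.2.trans (Nat.div_le_self _ _)⟩
    · intro n hn hn'
      rw [if_neg]
      rintro ⟨-, h2⟩
      apply hn'
      rw [mem_Icc] at hn
      rw [hJ, mem_Icc, Nat.le_div_iff_mul_le hM]
      refine ⟨hn.1, le_trans ?_ h2⟩
      rw [mul_comm n]
      exact Nat.mul_le_mul_right _ hm.1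
  rw [hS]
  have h1 : ‖∑ n ∈ J, β n * ∑ m ∈ I, A m n‖ ≤ ∑ n ∈ J, ‖∑ m ∈ I, A m n‖ := by
    refine (norm_sum_le _ _).trans (sum_le_sum fun n _ => ?_)
    rw [norm_mul]
    exact mul_le_of_le_one_left (norm_nonneg _) (hβ n)
  have hpair : ∀ m₁ ∈ I, ∀ m₂ ∈ I, ‖∑ n ∈ J, A m₁ n * (starRingEnd ℂ) (A m₂ n)‖
      ≤ (if m₁ = m₂ then X / M else 0)
        + K * (√T + X / √M / √T * (1 / √|(m₁ : ℝ) - m₂|)) := by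
    intro m₁ h1 m₂ h2
    by_cases hne : m₁ = m₂
    · rw [if_pos hne]
      have : ‖∑ n ∈ J, A m₁ n * (starRingEnd ℂ) (A m₂ n)‖ ≤ X / M := by
        refine (norm_sum_le _ _).trans (le_trans (sum_le_card_nsmul _ _ 1 ?_) (by simpa using hJc))
        intro n _
        have hb : ∀ m, ‖A m n‖ ≤ 1 := by
          intro m
          simp only [hA]
          split_ifs
          · rw [norm_mul, norm_e, mul_one]; exact hα m
          · simp
        rw [norm_mul, RCLike.norm_conj]
        exact mul_le_one₀ (hb _) (norm_nonneg _) (hb _)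
      have : 0 ≤ K * (√T + X / √M / √T * (1 / √|(m₁ : ℝ) - m₂|)) := by positivity
      linarith
    · rw [if_neg hne, zero_add]
      set s := J.filter fun n => (a < m₁ * n ∧ m₁ * n ≤ b) ∧ (a < m₂ * n ∧ m₂ * n ≤ b) with hs
      have heq : ∑ n ∈ J, A m₁ n * (starRingEnd ℂ) (A m₂ n) = α m₁ * (starRingEnd ℂ) (α m₂) *
          ∑ n ∈ s, e (t * ((m₁ : ℝ) ^ c - (m₂ : ℝ) ^ c) * (n : ℝ) ^ c) := by
        rw [hs, sum_filter, mul_sum]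
        refine sum_congr rfl fun n _ => ?_
        simp only [hA]
        by_cases c1 : a < m₁ * n ∧ m₁ * n ≤ b
        · by_cases c2 : a < m₂ * n ∧ m₂ * n ≤ b
          · rw [if_pos c1, if_pos c2, if_pos ⟨c1, c2⟩, map_mul, ← e_neg]
            rw [Real.mul_rpow (by positivity) (by positivity),
              Real.mul_rpow (by positivity) (by positivity),
              show t * ((m₁ : ℝ) ^ c - (m₂ : ℝ) ^ c) * (n : ℝ) ^ c
                = t * ((m₁ : ℝ) ^ c * (n : ℝ) ^ c) + -(t * ((m₂ : ℝ) ^ c * (n : ℝ) ^ c)) by ring,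
              e_add]
            ring
          · rw [if_neg c2, if_neg (not_and_of_not_right _ c2)]; simp
        · rw [if_neg c1, if_neg (not_and_of_not_left _ c1)]; simp
      rw [heq, norm_mul, norm_mul, RCLike.norm_conj]
      refine (mul_le_of_le_one_left (norm_nonneg _)
        (mul_le_one₀ (hα _) (norm_nonneg _) (hα _))).trans ?_
      refine H X t M m₁ m₂ ht hM hMX h1 h2 hne s ?_
      intro n
      rw [hs, mem_filter, and_iff_right_iff_imp]
      rintro ⟨⟨k1, k2⟩, -⟩
      rw [hI, mem_Ico] at h1
      rw [hJ, mem_Icc, Nat.le_div_iff_mul_le hM]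
      refine ⟨?_, le_trans ?_ k2⟩
      · rcases Nat.eq_zero_or_pos n with h0 | h0
        · rw [h0] at k1; omega
        · exact h0
      · rw [mul_comm n]; exact Nat.mul_le_mul_right _ h1.1
  have hIc : (#I : ℝ) = M := by rw [hI, Nat.card_Ico]; congr 1; omega
  have hrow : ∀ m₁ ∈ I, ∑ m₂ ∈ I, ‖∑ n ∈ J, A m₁ n * (starRingEnd ℂ) (A m₂ n)‖
      ≤ X / M + K * (M * √T + 4 * (X / √T)) := by
    intro m₁ h1
    refine (sum_le_sum fun m₂ h2 => hpair m₁ h1 m₂ h2).trans ?_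
    rw [sum_add_distrib, sum_ite_eq, if_pos h1, ← mul_sum, sum_add_distrib, sum_const,
      nsmul_eq_mul, hIc, ← mul_sum]
    have hMs : 0 < √(M : ℝ) := Real.sqrt_pos.mpr hM'
    have : X / √M / √T * ∑ i ∈ I, 1 / √|(m₁ : ℝ) - i| ≤ 4 * (X / √T) := by
      calc _ ≤ X / √M / √T * (4 * √M) := by
            gcongr; exact sum_one_div_sqrt_abs_sub_le M m₁ h1
        _ = _ := by field_simp
    gcongr
  have hTs : 0 < √T := Real.sqrt_pos.mpr hT0
  calc ‖∑ n ∈ J, β n * ∑ m ∈ I, A m n‖ ^ 2 ≤ (∑ n ∈ J, ‖∑ m ∈ I, A m n‖) ^ 2 := by gcongr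
    _ ≤ #J * ∑ n ∈ J, ‖∑ m ∈ I, A m n‖ ^ 2 := sq_sum_le_card_mul_sum_sq
    _ ≤ X / M * ∑ m₁ ∈ I, (X / M + K * (M * √T + 4 * (X / √T))) := by
      gcongr
      exact (sum_norm_sum_sq_le I J A).trans (sum_le_sum hrow)
    _ = X ^ 2 / M + K * (M * X * √T) + 4 * K * (X ^ 2 / √T) := by
      rw [sum_const, nsmul_eq_mul, hIc]; field_simp; ring
    _ ≤ _ := by
      have p1 : 0 ≤ X ^ 2 / M := by positivity
      have p2 : 0 ≤ M * X * √T := by positivity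
      have p3 : 0 ≤ X ^ 2 / √T := by positivity
      nlinarith [mul_nonneg hK.le p1, mul_nonneg hK.le p2, mul_nonneg hK.le p3]

lemma sum_range_sum_Ico_dyadic (V J : ℕ) (f : ℕ → ℂ) :
    ∑ j ∈ range J, ∑ m ∈ Ico (V * 2 ^ j) (2 * (V * 2 ^ j)), f m = ∑ m ∈ Ico V (V * 2 ^ J), f m := by
  induction J with
  | zero => simp
  | succ k ih =>
    rw [sum_range_succ, ih, show 2 * (V * 2 ^ k) = V * 2 ^ (k + 1) by ring]
    refine sum_Ico_consecutive _ (Nat.le_mul_of_pos_right _ (by positivity)) ?_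
    exact Nat.mul_le_mul_left _ (Nat.pow_le_pow_right (by norm_num) (by omega))

lemma natLog_two_floor_add_one_le {X : ℝ} (hX : Real.exp 1 ≤ X) :
    ((Nat.log 2 ⌊X⌋₊ + 1 : ℕ) : ℝ) ≤ 3 * Real.log X := by
  have hX0 : 0 < X := (Real.exp_pos 1).trans_le hX
  have hL : 1 ≤ Real.log X := by rwa [Real.le_log_iff_exp_le hX0]
  have hb : ⌊X⌋₊ ≠ 0 := by
    refine (Nat.floor_pos.mpr ?_).ne'
    have := Real.add_one_le_exp (1 : ℝ)
    linarith
  have h1 : ((2 ^ Nat.log 2 ⌊X⌋₊ : ℕ) : ℝ) ≤ X :=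
    (Nat.cast_le.mpr (Nat.pow_log_le_self 2 hb)).trans (Nat.floor_le hX0.le)
  have h2 := Real.log_le_log (by positivity) h1
  push_cast at h2
  rw [Real.log_pow] at h2
  push_cast
  nlinarith [Real.log_two_gt_d9, Nat.cast_nonneg (α := ℝ) (Nat.log 2 ⌊X⌋₊)]

/-- A bilinear sum one of whose variables is at most the square root of the length. -/
lemma exists_norm_bilinear_half_le (μ c : ℝ) (hμ0 : 0 < μ) (hμ1 : μ < 1) (hc : 1 < c) :
    ∃ K > 0, ∀ (X t : ℝ) (U : ℕ) (α β : ℕ → ℂ), t ≠ 0 → Real.exp 1 ≤ X → 4 / μ ^ 2 ≤ X →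
      X ^ (1 / 3 : ℝ) ≤ U + 1 → |t| * X ^ c ≤ X ^ (2 / 3 : ℝ) →
      (∀ m, ‖α m‖ ≤ 1) → (∀ n, ‖β n‖ ≤ 1) → (∀ m, α m ≠ 0 → U < m ∧ m * m ≤ ⌊X⌋₊) →
      ‖∑ m ∈ Icc 1 ⌊X⌋₊, ∑ n ∈ Icc 1 ⌊X⌋₊,
        (if ⌊μ * X⌋₊ < m * n ∧ m * n ≤ ⌊X⌋₊ then
          α m * β n * e (t * ((m : ℝ) * n) ^ c) else 0)‖
        ≤ K * Real.log X * (X ^ (11 / 12 : ℝ) + X / √√(|t| * X ^ c)) := by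
  obtain ⟨K, hK, H⟩ := exists_norm_bilinear_block_le μ c hμ0 hμ1 hc
  refine ⟨3 * √(2 * K), by positivity, ?_⟩
  intro X t U α β ht hXe hXμ hU hT hα hβ hsupp
  have hX : 0 < X := (Real.exp_pos 1).trans_le hXe
  have hX1 : 1 ≤ X := (by have := Real.add_one_le_exp (1 : ℝ); linarith)
  set f : ℕ → ℂ := fun m => ∑ n ∈ Icc 1 ⌊X⌋₊,
        (if ⌊μ * X⌋₊ < m * n ∧ m * n ≤ ⌊X⌋₊ then
          α m * β n * e (t * ((m : ℝ) * n) ^ c) else 0) with hf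
  have hf0 : ∀ m, ¬ (U < m ∧ m * m ≤ ⌊X⌋₊) → f m = 0 := by
    intro m hm
    have : α m = 0 := by by_contra h; exact hm (hsupp m h)
    simp [hf, this]
  set J := Nat.log 2 ⌊X⌋₊ + 1 with hJ
  have hsum : ∑ m ∈ Icc 1 ⌊X⌋₊, f m
      = ∑ j ∈ range J, ∑ m ∈ Ico ((U + 1) * 2 ^ j) (2 * ((U + 1) * 2 ^ j)), f m := by
    rw [sum_range_sum_Ico_dyadic]
    refine sum_congr_of_eq_on_inter ?_ ?_ (fun _ _ _ => rfl)
    · intro m hm hm'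
      apply hf0
      rintro ⟨h1, h2⟩
      apply hm'
      rw [mem_Icc] at hm
      rw [mem_Ico]
      refine ⟨h1, ?_⟩
      have := Nat.lt_pow_succ_log_self (b := 2) (by norm_num) ⌊X⌋₊
      calc m ≤ ⌊X⌋₊ := hm.2
        _ < 2 ^ J := this
        _ ≤ (U + 1) * 2 ^ J := Nat.le_mul_of_pos_left _ (by omega)
    · intro m hm hm'
      apply hf0
      rintro ⟨h1, h2⟩
      apply hm'
      rw [mem_Icc]
      refine ⟨by omega, le_trans ?_ h2⟩
      exact Nat.le_mul_of_pos_left _ (by omega)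
  change ‖∑ m ∈ Icc 1 ⌊X⌋₊, f m‖ ≤ _
  rw [hsum]
  set T := |t| * X ^ c with hTdef
  have hT0 : 0 < T := by have := abs_pos.mpr ht; positivity
  clear_value T
  have hblock : ∀ j ∈ range J, ‖∑ m ∈ Ico ((U + 1) * 2 ^ j) (2 * ((U + 1) * 2 ^ j)), f m‖
      ≤ √(2 * K) * (X ^ (11 / 12 : ℝ) + X / √√T) := by
    intro j _
    set M := (U + 1) * 2 ^ j with hM
    have hMU : U + 1 ≤ M := Nat.le_mul_of_pos_right _ (by positivity)
    by_cases hMM : M * M ≤ ⌊X⌋₊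
    · have hM2 : (M : ℝ) * M ≤ X := by
        have := (Nat.le_floor_iff hX.le).mp hMM
        exact_mod_cast this
      have hMX : (M : ℝ) ≤ √X := Real.le_sqrt_of_sq_le (by rw [sq]; exact hM2)
      have h2M : 2 * (M : ℝ) ≤ μ * X := by
        have h4 : 2 / μ ≤ √X := Real.le_sqrt_of_sq_le (by rw [div_pow]; norm_num; exact hXμ)
        rw [div_le_iff₀ hμ0] at h4
        have := Real.mul_self_sqrt hX.le
        nlinarith [Real.sqrt_nonneg X]
      have hM0 : 0 < M := by omega
      have := H X t M α β ht hM0 h2M hα hβ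
      rw [← hTdef] at this
      refine (sq_le_sq₀ (norm_nonneg _) (by positivity)).mp ?_
      refine this.trans ?_
      have q1 : X ^ 2 / M ≤ X ^ (11 / 6 : ℝ) := by
        have hM3 : X ^ (1 / 3 : ℝ) ≤ M := hU.trans (by exact_mod_cast hMU)
        have hM6 : X ^ (1 / 6 : ℝ) ≤ M :=
          (Real.rpow_le_rpow_of_exponent_le hX1 (by norm_num)).trans hM3
        rw [div_le_iff₀ (by positivity)]
        calc X ^ 2 = X ^ (11 / 6 : ℝ) * X ^ (1 / 6 : ℝ) := by
              rw [← Real.rpow_add hX, ← Real.rpow_natCast]; norm_num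
          _ ≤ _ := by gcongr
      have q2 : M * X * √T ≤ X ^ (11 / 6 : ℝ) := by
        calc M * X * √T ≤ √X * X * √(X ^ (2 / 3 : ℝ)) := by gcongr
          _ = X ^ (1 / 2 : ℝ) * X ^ (1 : ℝ) * X ^ (1 / 3 : ℝ) := by
            rw [Real.sqrt_eq_rpow, Real.sqrt_eq_rpow, ← Real.rpow_mul hX.le, Real.rpow_one]
            norm_num
          _ = _ := by rw [← Real.rpow_add hX, ← Real.rpow_add hX]; norm_num
      have q3 : X ^ 2 / √T = (X / √√T) ^ 2 := by
        rw [div_pow, Real.sq_sqrt (Real.sqrt_nonneg _)]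
      have q4 : X ^ (11 / 6 : ℝ) = (X ^ (11 / 12 : ℝ)) ^ 2 := by
        rw [← Real.rpow_natCast, ← Real.rpow_mul hX.le]; norm_num
      rw [mul_pow, Real.sq_sqrt (by positivity),
        show ∀ y : ℝ, 2 * K * y = K * (2 * y) by intro y; ring]
      refine mul_le_mul_of_nonneg_left ?_ hK.le
      rw [q3]
      rw [q4] at q1 q2
      have : 0 ≤ X ^ (11 / 12 : ℝ) * (X / √√T) := by positivity
      nlinarith [sq_nonneg (X / √√T)]
    · rw [sum_eq_zero, norm_zero]
      · positivity
      · intro m hm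
        apply hf0
        rintro ⟨-, h2⟩
        rw [mem_Ico] at hm
        exact hMM ((Nat.mul_le_mul hm.1 hm.1).trans h2)
  calc _ ≤ ∑ j ∈ range J, √(2 * K) * (X ^ (11 / 12 : ℝ) + X / √√T) :=
        (norm_sum_le _ _).trans (sum_le_sum hblock)
    _ = J * (√(2 * K) * (X ^ (11 / 12 : ℝ) + X / √√T)) := by
      rw [sum_const, card_range, nsmul_eq_mul]
    _ ≤ 3 * Real.log X * (√(2 * K) * (X ^ (11 / 12 : ℝ) + X / √√T)) := by
      gcongr
      exact natLog_two_floor_add_one_le hXe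
    _ = _ := by ring

/-- A bilinear sum with both variables large. -/
lemma exists_norm_bilinear_le (μ c : ℝ) (hμ0 : 0 < μ) (hμ1 : μ < 1) (hc : 1 < c) :
    ∃ K > 0, ∀ (X t : ℝ) (U : ℕ) (α β : ℕ → ℂ), t ≠ 0 → Real.exp 1 ≤ X → 4 / μ ^ 2 ≤ X →
      X ^ (1 / 3 : ℝ) ≤ U + 1 → |t| * X ^ c ≤ X ^ (2 / 3 : ℝ) →
      (∀ m, ‖α m‖ ≤ 1) → (∀ n, ‖β n‖ ≤ 1) → (∀ m, α m ≠ 0 → U < m) → (∀ m, β m ≠ 0 → U < m) →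
      ‖∑ m ∈ Icc 1 ⌊X⌋₊, ∑ n ∈ Icc 1 ⌊X⌋₊,
        (if ⌊μ * X⌋₊ < m * n ∧ m * n ≤ ⌊X⌋₊ then
          α m * β n * e (t * ((m : ℝ) * n) ^ c) else 0)‖
        ≤ K * Real.log X * (X ^ (11 / 12 : ℝ) + X / √√(|t| * X ^ c)) := by
  obtain ⟨K, hK, H⟩ := exists_norm_bilinear_half_le μ c hμ0 hμ1 hc
  refine ⟨K + K, by positivity, ?_⟩
  intro X t U α β ht hXe hXμ hU hT hα hβ hsα hsβ
  set α₁ : ℕ → ℂ := fun m => if m * m ≤ ⌊X⌋₊ then α m else 0 with hα₁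
  set α₂ : ℕ → ℂ := fun m => if m * m ≤ ⌊X⌋₊ then 0 else α m with hα₂
  set β₁ : ℕ → ℂ := fun m => if m * m ≤ ⌊X⌋₊ then β m else 0 with hβ₁
  have hn1 : ∀ m, ‖α₁ m‖ ≤ 1 := by
    intro m; simp only [hα₁]; split_ifs
    · exact hα m
    · simp
  have hn2 : ∀ m, ‖α₂ m‖ ≤ 1 := by
    intro m; simp only [hα₂]; split_ifs
    · simp
    · exact hα m
  have hn3 : ∀ m, ‖β₁ m‖ ≤ 1 := by
    intro m; simp only [hβ₁]; split_ifs
    · exact hβ m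
    · simp
  have A1 := H X t U α₁ β ht hXe hXμ hU hT hn1 hβ (by
    intro m hm
    by_cases h : m * m ≤ ⌊X⌋₊
    · simp only [hα₁, if_pos h] at hm; exact ⟨hsα m hm, h⟩
    · simp only [hα₁, if_neg h] at hm; exact absurd rfl hm)
  have A2 := H X t U β₁ α₂ ht hXe hXμ hU hT hn3 hn2 (by
    intro m hm
    by_cases h : m * m ≤ ⌊X⌋₊
    · simp only [hβ₁, if_pos h] at hm; exact ⟨hsβ m hm, h⟩
    · simp only [hβ₁, if_neg h] at hm; exact absurd rfl hm)
  rw [sum_comm] at A2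
  have key : ∀ m n : ℕ, (if ⌊μ * X⌋₊ < m * n ∧ m * n ≤ ⌊X⌋₊ then
          α m * β n * e (t * ((m : ℝ) * n) ^ c) else 0)
      = (if ⌊μ * X⌋₊ < m * n ∧ m * n ≤ ⌊X⌋₊ then
          α₁ m * β n * e (t * ((m : ℝ) * n) ^ c) else 0)
      + (if ⌊μ * X⌋₊ < n * m ∧ n * m ≤ ⌊X⌋₊ then
          β₁ n * α₂ m * e (t * ((n : ℝ) * m) ^ c) else 0) := by
    intro m n
    rw [mul_comm n m, mul_comm (n : ℝ)]
    by_cases h : ⌊μ * X⌋₊ < m * n ∧ m * n ≤ ⌊X⌋₊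
    · simp only [if_pos h]
      by_cases h1 : m * m ≤ ⌊X⌋₊
      · simp only [hα₁, hα₂, if_pos h1]; ring
      · have h2 : n * n ≤ ⌊X⌋₊ := by
          by_contra h3
          rcases le_total m n with h4 | h4
          · exact h1 ((Nat.mul_le_mul_left _ h4).trans h.2)
          · exact h3 ((Nat.mul_le_mul_right _ h4).trans h.2)
        simp only [hα₁, hα₂, hβ₁, if_neg h1, if_pos h2]; ring
    · simp only [if_neg h, add_zero]
  simp only [key, sum_add_distrib]
  refine (norm_add_le _ _).trans ((add_le_add A1 A2).trans (le_of_eq (by ring)))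

/-- Sums of a character twisted by `e (t (d i) ^ c)` along an interval. -/
lemma exists_norm_sum_char_e_le (μ c : ℝ) (hμ0 : 0 < μ) (hμ1 : μ < 1) (hc : 1 < c) :
    ∃ K > 0, ∀ (X t : ℝ) (q d m n : ℕ) (χ : ZMod q → ℂ), t ≠ 0 → 0 < X → 0 < q → 0 < d →
      q * d ≤ μ * X → (∀ x, ‖χ x‖ ≤ 1) →
      (∀ i ∈ Ico m n, ⌊μ * X⌋₊ < d * i ∧ d * i ≤ ⌊X⌋₊) →
      ‖∑ i ∈ Ico m n, χ (i : ZMod q) * e (t * ((d : ℝ) * i) ^ c)‖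
        ≤ K * (q * √(|t| * X ^ c) + X / d / √(|t| * X ^ c)) := by
  obtain ⟨K, hK, H⟩ := exists_norm_sum_periodic_e_rpow_le c (1 / μ) hc
    (by rw [le_div_iff₀ hμ0]; linarith)
  set κ := √(μ ^ c) with hκ
  have hκ0 : 0 < κ := Real.sqrt_pos.mpr (by positivity)
  refine ⟨K * (κ + 1 / κ), by positivity, ?_⟩
  intro X t q d m n χ ht hX hq hd hqd hχ hi
  have hd' : (0 : ℝ) < d := by exact_mod_cast hd
  have ht' := abs_pos.mpr ht
  have hA := H (t * (d : ℝ) ^ c) (μ * X / d) q m n χ (mul_ne_zero ht (by positivity)) hq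
    (by rw [le_div_iff₀ hd']; exact hqd) hχ (by
    intro i h
    obtain ⟨h1, h2⟩ := hi i h
    have k1 : μ * X < (d * i : ℕ) := (Nat.floor_lt (by positivity)).mp h1
    have k2 : ((d * i : ℕ) : ℝ) ≤ X := (Nat.le_floor_iff hX.le).mp h2
    push_cast at k1 k2
    constructor
    · rw [div_le_iff₀ hd']; linarith
    · rw [show 1 / μ * (μ * X / d) = X / d by field_simp, le_div_iff₀ hd']; linarith)
  have e1 : |t * (d : ℝ) ^ c| * (μ * X / d) ^ c = μ ^ c * (|t| * X ^ c) := by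
    rw [abs_mul, abs_of_pos (show 0 < (d : ℝ) ^ c by positivity),
      Real.div_rpow (by positivity) hd'.le, Real.mul_rpow hμ0.le hX.le]
    field_simp
  rw [e1, Real.sqrt_mul (by positivity), ← hκ] at hA
  set T := |t| * X ^ c with hT
  have hT0 : 0 < T := by positivity
  clear_value T
  have hTs : 0 < √T := Real.sqrt_pos.mpr hT0
  rw [sum_congr rfl fun i _ => by
    rw [Real.mul_rpow (by positivity) (by positivity), ← mul_assoc]]
  refine hA.trans ?_
  rw [mul_assoc K]
  refine mul_le_mul_of_nonneg_left ?_ hK.le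
  have p1 : μ * X / d / (κ * √T) ≤ 1 / κ * (X / d / √T) := by
    calc μ * X / d / (κ * √T) ≤ 1 * X / d / (κ * √T) := by gcongr
      _ = _ := by field_simp
  have p2 : 0 ≤ 1 / κ * (q * √T) := by positivity
  have p3 : 0 ≤ κ * (X / d / √T) := by positivity
  nlinarith

/-- The same with a weight of bounded variation. -/
lemma exists_norm_sum_char_e_weight_le (μ c : ℝ) (hμ0 : 0 < μ) (hμ1 : μ < 1) (hc : 1 < c) :
    ∃ K > 0, ∀ (X t W : ℝ) (q d : ℕ) (χ : ZMod q → ℂ) (w : ℕ → ℝ), t ≠ 0 → 0 < X → 0 < q → 0 < d →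
      q * d ≤ μ * X → (∀ x, ‖χ x‖ ≤ 1) →
      (∀ m n, 1 ≤ m → m ≤ n → n ≤ ⌊X⌋₊ + 1 → |w n| + ∑ i ∈ Ico m n, |w (i + 1) - w i| ≤ W) →
      ‖∑ i ∈ Icc 1 ⌊X⌋₊, (if ⌊μ * X⌋₊ < d * i ∧ d * i ≤ ⌊X⌋₊ then
          χ (i : ZMod q) * e (t * ((d : ℝ) * i) ^ c) * w i else 0)‖
        ≤ K * W * (q * √(|t| * X ^ c) + X / d / √(|t| * X ^ c)) := by
  obtain ⟨K, hK, H⟩ := exists_norm_sum_char_e_le μ c hμ0 hμ1 hc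
  refine ⟨K, hK, ?_⟩
  intro X t W q d χ w ht hX hq hd hqd hχ hw
  have hW : 0 ≤ W := by
    have := hw 1 1 le_rfl le_rfl (by omega)
    simp at this
    exact (abs_nonneg _).trans this
  rw [← sum_filter]
  obtain ⟨m, n, hmn⟩ := Finset.eq_Ico_of_ordConnected
    (s := (Icc 1 ⌊X⌋₊).filter fun i => ⌊μ * X⌋₊ < d * i ∧ d * i ≤ ⌊X⌋₊) (by
    intro x hx y hy z k1 k2
    rw [mem_filter, mem_Icc] at hx hy ⊢
    have q1 : d * x ≤ d * z := Nat.mul_le_mul_left _ k1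
    have q2 : d * z ≤ d * y := Nat.mul_le_mul_left _ k2
    omega)
  rw [hmn]
  rcases le_or_gt n m with h | h
  · rw [Ico_eq_empty (by omega), sum_empty, norm_zero]
    positivity
  have hmem : ∀ i ∈ Ico m n, (1 ≤ i ∧ i ≤ ⌊X⌋₊) ∧ ⌊μ * X⌋₊ < d * i ∧ d * i ≤ ⌊X⌋₊ := by
    intro i hi
    rw [← hmn, mem_filter, mem_Icc] at hi
    exact hi
  have hm := hmem m (mem_Ico.mpr ⟨le_rfl, h⟩)
  have hn := hmem (n - 1) (mem_Ico.mpr ⟨by omega, by omega⟩)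
  refine (norm_sum_mul_le_abel (fun i => χ (i : ZMod q) * e (t * ((d : ℝ) * i) ^ c))
    (fun i => (w i : ℂ)) h.le (A := K * (q * √(|t| * X ^ c) + X / d / √(|t| * X ^ c))) ?_).trans ?_
  · intro k h1 h2
    refine H X t q d m k χ ht hX hq hd hqd hχ ?_
    intro i hi
    rw [mem_Ico] at hi
    exact (hmem i (mem_Ico.mpr ⟨hi.1, by omega⟩)).2
  · rw [mul_right_comm K W]
    gcongr
    refine le_trans (le_of_eq ?_) (hw m n hm.1.1 h.le (by omega))
    congr 1
    · simp
    · refine sum_congr rfl fun i _ => ?_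
      rw [← Complex.ofReal_sub, Complex.norm_real, Real.norm_eq_abs]

/-- Linear (type I) sums. -/
lemma exists_norm_linear_le (μ c : ℝ) (hμ0 : 0 < μ) (hμ1 : μ < 1) (hc : 1 < c) :
    ∃ K > 0, ∀ (X t W D : ℝ) (q : ℕ) (χ : ZMod q → ℂ) (α : ℕ → ℂ) (w : ℕ → ℝ), t ≠ 0 →
      Real.exp 1 ≤ X → 0 < q → 0 ≤ D → q * D ≤ μ * X → (∀ x, ‖χ x‖ ≤ 1) → (∀ d, ‖α d‖ ≤ 1) →
      (∀ d, α d ≠ 0 → d ≤ D) →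
      (∀ m n, 1 ≤ m → m ≤ n → n ≤ ⌊X⌋₊ + 1 → |w n| + ∑ i ∈ Ico m n, |w (i + 1) - w i| ≤ W) →
      ‖∑ d ∈ Icc 1 ⌊X⌋₊, ∑ i ∈ Icc 1 ⌊X⌋₊, (if ⌊μ * X⌋₊ < d * i ∧ d * i ≤ ⌊X⌋₊ then
          α d * (χ (i : ZMod q) * e (t * ((d : ℝ) * i) ^ c) * w i) else 0)‖
        ≤ K * W * (q * D * √(|t| * X ^ c) + 2 * Real.log X * X / √(|t| * X ^ c)) := by
  obtain ⟨K, hK, H⟩ := exists_norm_sum_char_e_weight_le μ c hμ0 hμ1 hc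
  refine ⟨K, hK, ?_⟩
  intro X t W D q χ α w ht hXe hq hD hqD hχ hα hαD hw
  have hX : 0 < X := (Real.exp_pos 1).trans_le hXe
  have hL : 1 ≤ Real.log X := by rwa [Real.le_log_iff_exp_le hX]
  have hW : 0 ≤ W := by
    have := hw 1 1 le_rfl le_rfl (by omega)
    simp at this
    exact (abs_nonneg _).trans this
  set T := |t| * X ^ c with hT
  have h1 : ∀ d ∈ Icc 1 ⌊X⌋₊, ‖∑ i ∈ Icc 1 ⌊X⌋₊, (if ⌊μ * X⌋₊ < d * i ∧ d * i ≤ ⌊X⌋₊ then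
          α d * (χ (i : ZMod q) * e (t * ((d : ℝ) * i) ^ c) * w i) else 0)‖
      ≤ if (d : ℝ) ≤ D then K * W * (q * √T + X / d / √T) else 0 := by
    intro d hd
    rw [mem_Icc] at hd
    rw [sum_congr rfl fun i _ => (mul_ite_zero _ _ _).symm, ← mul_sum, norm_mul]
    split_ifs with h
    · refine (mul_le_of_le_one_left (norm_nonneg _) (hα d)).trans ?_
      refine H X t W q d χ w ht hX hq (by omega) (le_trans ?_ hqD) hχ hw
      gcongr
    · have : α d = 0 := by by_contra h0; exact h (hαD d h0)
      simp [this]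
  refine (norm_sum_le _ _).trans ((sum_le_sum h1).trans ?_)
  rw [← sum_filter, ← mul_sum]
  refine mul_le_mul_of_nonneg_left ?_ (by positivity)
  rw [sum_add_distrib]
  gcongr
  · rw [sum_const, nsmul_eq_mul]
    have : (#((Icc 1 ⌊X⌋₊).filter fun d : ℕ => (d : ℝ) ≤ D) : ℝ) ≤ D := by
      refine le_trans ?_ (Nat.floor_le hD)
      have : #((Icc 1 ⌊X⌋₊).filter fun d : ℕ => (d : ℝ) ≤ D) ≤ #(Icc 1 ⌊D⌋₊) := by
        refine card_le_card fun x hx => ?_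
        rw [mem_filter, mem_Icc] at hx
        exact mem_Icc.mpr ⟨hx.1.1, Nat.le_floor hx.2⟩
      rw [Nat.card_Icc, Nat.add_sub_cancel] at this
      exact_mod_cast this
    calc _ ≤ D * (q * √T) := by gcongr
      _ = _ := by ring
  · calc _ ≤ ∑ d ∈ Icc 1 ⌊X⌋₊, X / d / √T :=
          sum_le_sum_of_subset_of_nonneg (filter_subset _ _) fun _ _ _ => by positivity
      _ = (∑ d ∈ Icc 1 ⌊X⌋₊, (d : ℝ)⁻¹) * (X / √T) := by
        rw [sum_mul]; refine sum_congr rfl fun _ _ => ?_; ring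
      _ ≤ (2 * Real.log X) * (X / √T) := by
        gcongr
        have h2 := harmonic_le_one_add_log ⌊X⌋₊
        rw [harmonic_eq_sum_Icc] at h2
        push_cast at h2
        have h3 : Real.log ⌊X⌋₊ ≤ Real.log X := by
          rcases Nat.eq_zero_or_pos ⌊X⌋₊ with h0 | h0
          · rw [h0]; simp; linarith
          · exact Real.log_le_log (by exact_mod_cast h0) (Nat.floor_le hX.le)
        linarith
      _ = _ := by ring

/-- The restriction of an arithmetic function to `[1, U]`. -/
def ArithmeticFunction.truncate (U : ℕ) (f : ArithmeticFunction ℝ) : ArithmeticFunction ℝ :=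
  ⟨fun n => if n ≤ U then f n else 0, by simp⟩

lemma ArithmeticFunction.truncate_apply (U : ℕ) (f : ArithmeticFunction ℝ) (n : ℕ) :
    f.truncate U n = if n ≤ U then f n else 0 := rfl

lemma ArithmeticFunction.vaughan (M N : ArithmeticFunction ℝ) :
    (ArithmeticFunction.vonMangoldt : ArithmeticFunction ℝ) = N + M * ArithmeticFunction.log
      - (M * N) * (ArithmeticFunction.zeta : ArithmeticFunction ℝ)
      + ((ArithmeticFunction.moebius : ArithmeticFunction ℝ) - M)
        * ((ArithmeticFunction.vonMangoldt - N)
          * (ArithmeticFunction.zeta : ArithmeticFunction ℝ)) := by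
  rw [← ArithmeticFunction.vonMangoldt_mul_zeta]
  have h : (ArithmeticFunction.moebius : ArithmeticFunction ℝ)
      * (ArithmeticFunction.zeta : ArithmeticFunction ℝ) = 1 :=
    ArithmeticFunction.coe_moebius_mul_coe_zeta
  set Z := (ArithmeticFunction.zeta : ArithmeticFunction ℝ)
  set m := (ArithmeticFunction.moebius : ArithmeticFunction ℝ)
  set L : ArithmeticFunction ℝ := ArithmeticFunction.vonMangoldt
  linear_combination (N - L) * h

lemma sum_Ioc_mul_arith (f g : ArithmeticFunction ℝ) (G : ℕ → ℂ) (a b : ℕ) :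
    ∑ n ∈ Ioc a b, (((f * g) n : ℝ) : ℂ) * G n
      = ∑ d ∈ Icc 1 b, ∑ m ∈ Icc 1 b, if a < d * m ∧ d * m ≤ b then
          (f d : ℂ) * g m * G (d * m) else 0 := by
  rw [← sum_product', ← sum_filter]
  rw [← sum_fiberwise_of_maps_to (t := Ioc a b) (g := fun p : ℕ × ℕ => p.1 * p.2) (by
    intro p hp
    rw [mem_filter] at hp
    exact mem_Ioc.mpr hp.2)]
  refine sum_congr rfl fun n hn => ?_
  rw [mem_Ioc] at hn
  rw [ArithmeticFunction.mul_apply]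
  push_cast
  rw [sum_mul]
  refine sum_congr ?_ ?_
  · ext p
    rw [Nat.mem_divisorsAntidiagonal, mem_filter, mem_filter, mem_product, mem_Icc, mem_Icc]
    constructor
    · rintro ⟨h1, h2⟩
      have h3 : p.1 ≠ 0 := by rintro h; rw [h] at h1; omega
      have h4 : p.2 ≠ 0 := by rintro h; rw [h] at h1; omega
      have h5 : p.1 ≤ p.1 * p.2 := Nat.le_mul_of_pos_right _ (by omega)
      have h6 : p.2 ≤ p.1 * p.2 := Nat.le_mul_of_pos_left _ (by omega)
      omega
    · rintro ⟨h1, h2⟩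
      omega
  · intro p hp
    rw [mem_filter] at hp
    rw [hp.2]

lemma ArithmeticFunction.sub_apply' (f g : ArithmeticFunction ℝ) (n : ℕ) :
    (f - g) n = f n - g n := by
  rw [sub_eq_add_neg, sub_eq_add_neg, ArithmeticFunction.add_apply]; rfl

lemma abs_mul_apply_le_log (f g : ArithmeticFunction ℝ) (hf : ∀ n, |f n| ≤ 1)
    (hg : ∀ n, |g n| ≤ ArithmeticFunction.vonMangoldt n) (n : ℕ) :
    |(f * g) n| ≤ Real.log n := by
  rw [ArithmeticFunction.mul_apply, ← ArithmeticFunction.vonMangoldt_sum,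
    ← Nat.sum_divisorsAntidiagonal' (f := fun _ j => ArithmeticFunction.vonMangoldt j)]
  refine (abs_sum_le_sum_abs _ _).trans (sum_le_sum fun p _ => ?_)
  rw [abs_mul]
  exact (mul_le_of_le_one_left (abs_nonneg _) (hf _)).trans (hg _)

lemma mul_apply_eq_zero_of_support {f g : ArithmeticFunction ℝ} {n : ℕ}
    (h : ∀ d m, d * m = n → f d = 0 ∨ g m = 0) : (f * g) n = 0 := by
  rw [ArithmeticFunction.mul_apply]
  refine sum_eq_zero fun p hp => ?_
  rw [Nat.mem_divisorsAntidiagonal] at hp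
  exact mul_eq_zero.mpr (h _ _ hp.1)

lemma abs_log_add_variation_le {X : ℝ} (hX : Real.exp 1 ≤ X) (m n : ℕ) (hm : 1 ≤ m) (hmn : m ≤ n)
    (hn : n ≤ ⌊X⌋₊ + 1) :
    |ArithmeticFunction.log n|
      + ∑ i ∈ Ico m n, |ArithmeticFunction.log (i + 1) - ArithmeticFunction.log i|
      ≤ 4 * Real.log X := by
  have hX0 : 0 < X := (Real.exp_pos 1).trans_le hX
  have hX2 : 2 ≤ X := (by have := Real.add_one_le_exp (1 : ℝ); linarith)
  have h1 : ∀ i ∈ Ico m n, |ArithmeticFunction.log (i + 1) - ArithmeticFunction.log i|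
      = Real.log ((i + 1 : ℕ) : ℝ) - Real.log (i : ℝ) := by
    intro i hi
    rw [mem_Ico] at hi
    rw [ArithmeticFunction.log_apply, ArithmeticFunction.log_apply, abs_of_nonneg]
    rw [sub_nonneg]
    refine Real.log_le_log ?_ (by push_cast; linarith)
    exact_mod_cast (by omega : 0 < i)
  rw [sum_congr rfl h1, sum_Ico_eq_sub _ hmn, sum_range_sub (fun i : ℕ => Real.log (i : ℝ)),
    sum_range_sub (fun i : ℕ => Real.log (i : ℝ)), ArithmeticFunction.log_apply,
    abs_of_nonneg (Real.log_natCast_nonneg n)]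
  have h2 : 0 ≤ Real.log (m : ℝ) := Real.log_natCast_nonneg m
  have h3 : Real.log (n : ℝ) ≤ 2 * Real.log X := by
    have : (n : ℝ) ≤ X ^ 2 := by
      have h4 : (n : ℝ) ≤ ⌊X⌋₊ + 1 := by exact_mod_cast hn
      have := Nat.floor_le hX0.le
      nlinarith
    have h5 := Real.log_le_log (by exact_mod_cast (by omega : 0 < n)) this
    rwa [Real.log_pow] at h5
  linarith

/-- Vaughan's identity bound for `∑ Λ(n) χ(n) e(t n ^ c)`. -/
lemma exists_norm_sum_vonMangoldt_le (μ c : ℝ) (hμ0 : 0 < μ) (hμ1 : μ < 1) (hc : 1 < c) :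
    ∃ K > 0, ∀ (X t : ℝ) (q : ℕ) (χ : DirichletCharacter ℂ q), t ≠ 0 →
      Real.exp 1 ≤ X → 4 / μ ^ 2 ≤ X → 0 < q → q ≤ μ * X ^ (1 / 3 : ℝ) →
      |t| * X ^ c ≤ X ^ (2 / 3 : ℝ) →
      ‖∑ n ∈ Ioc ⌊μ * X⌋₊ ⌊X⌋₊, (ArithmeticFunction.vonMangoldt n : ℂ) * χ (n : ZMod q)
          * e (t * (n : ℝ) ^ c)‖
        ≤ K * Real.log X ^ 2 * (q * X ^ (2 / 3 : ℝ) * √(|t| * X ^ c) + X / √(|t| * X ^ c)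
          + (X ^ (11 / 12 : ℝ) + X / √√(|t| * X ^ c))) := by
  obtain ⟨K₁, hK₁, H₁⟩ := exists_norm_linear_le μ c hμ0 hμ1 hc
  obtain ⟨K₂, hK₂, H₂⟩ := exists_norm_bilinear_le μ c hμ0 hμ1 hc
  refine ⟨10 * K₁ + K₂, by positivity, ?_⟩
  intro X t q χ ht hXe hXμ hq hqX hTX
  have hX : 0 < X := (Real.exp_pos 1).trans_le hXe
  have hL : 1 ≤ Real.log X := by rwa [Real.le_log_iff_exp_le hX]
  have hX1 : 1 ≤ X := (by have := Real.add_one_le_exp (1 : ℝ); linarith)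
  set U := ⌊X ^ (1 / 3 : ℝ)⌋₊ with hU
  have hUX : (U : ℝ) ≤ X ^ (1 / 3 : ℝ) := Nat.floor_le (by positivity)
  have hU1 : X ^ (1 / 3 : ℝ) ≤ U + 1 := (Nat.lt_floor_add_one _).le
  set a := ⌊μ * X⌋₊ with ha
  set b := ⌊X⌋₊ with hb
  have hUa : U ≤ a := by
    refine Nat.floor_le_floor ?_
    have h4 : 2 / μ ≤ √X := Real.le_sqrt_of_sq_le (by rw [div_pow]; norm_num; exact hXμ)
    rw [div_le_iff₀ hμ0] at h4
    have h5 : X ^ (1 / 3 : ℝ) ≤ √X := by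
      rw [Real.sqrt_eq_rpow]; exact Real.rpow_le_rpow_of_exponent_le hX1 (by norm_num)
    have := Real.mul_self_sqrt hX.le
    nlinarith [Real.sqrt_nonneg X]
  have hlogb : ∀ n ∈ Icc 1 b, Real.log (n : ℝ) ≤ Real.log X := by
    intro n hn
    rw [mem_Icc] at hn
    refine Real.log_le_log (by exact_mod_cast hn.1) ?_
    exact (Nat.cast_le.mpr hn.2).trans (Nat.floor_le hX.le)
  have hχ : ∀ x : ZMod q, ‖χ x‖ ≤ 1 := fun x => DirichletCharacter.norm_le_one χ x
  set G : ℕ → ℂ := fun n => χ (n : ZMod q) * e (t * (n : ℝ) ^ c) with hG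
  have hGmul : ∀ d m : ℕ, G (d * m)
      = χ (d : ZMod q) * χ (m : ZMod q) * e (t * ((d : ℝ) * m) ^ c) := by
    intro d m; simp only [hG]; push_cast; rw [map_mul]
  set M := (ArithmeticFunction.moebius : ArithmeticFunction ℝ).truncate U with hM
  set N := (ArithmeticFunction.vonMangoldt : ArithmeticFunction ℝ).truncate U with hN
  have hMb : ∀ n, |M n| ≤ 1 := by
    intro n
    rw [hM, ArithmeticFunction.truncate_apply]
    split_ifs
    · rw [ArithmeticFunction.intCoe_apply, ← Int.cast_abs]
      exact_mod_cast ArithmeticFunction.abs_moebius_le_one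
    · simp
  have hNb : ∀ n, |N n| ≤ ArithmeticFunction.vonMangoldt n := by
    intro n
    rw [hN, ArithmeticFunction.truncate_apply]
    split_ifs
    · rw [abs_of_nonneg ArithmeticFunction.vonMangoldt_nonneg]
    · simp
  have hsplit : ∑ n ∈ Ioc a b, (ArithmeticFunction.vonMangoldt n : ℂ) * χ (n : ZMod q)
          * e (t * (n : ℝ) ^ c)
      = ∑ n ∈ Ioc a b, (((M * ArithmeticFunction.log) n : ℝ) : ℂ) * G n
        - ∑ n ∈ Ioc a b, ((((M * N) * (ArithmeticFunction.zeta : ArithmeticFunction ℝ)) n : ℝ) : ℂ)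
            * G n
        + ∑ n ∈ Ioc a b, (((((ArithmeticFunction.moebius : ArithmeticFunction ℝ) - M)
        * ((ArithmeticFunction.vonMangoldt - N) * (ArithmeticFunction.zeta : ArithmeticFunction ℝ)))
          n : ℝ) : ℂ) * G n := by
    rw [← sum_sub_distrib, ← sum_add_distrib]
    refine sum_congr rfl fun n hn => ?_
    rw [mem_Ioc] at hn
    have h0 : N n = 0 := by
      rw [hN, ArithmeticFunction.truncate_apply, if_neg (by omega)]
    conv_lhs => rw [ArithmeticFunction.vaughan M N]
    simp only [ArithmeticFunction.add_apply, ArithmeticFunction.sub_apply', h0]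
    push_cast
    simp only [hG]
    ring
  set T := |t| * X ^ c with hT
  have hT0 : 0 < T := by have := abs_pos.mpr ht; positivity
  -- the two linear sums
  have hqD : ∀ D : ℝ, D ≤ X ^ (2 / 3 : ℝ) → q * D ≤ μ * X := by
    intro D hD
    calc (q : ℝ) * D ≤ q * X ^ (2 / 3 : ℝ) := by gcongr
      _ ≤ μ * X ^ (1 / 3 : ℝ) * X ^ (2 / 3 : ℝ) := by gcongr
      _ = μ * X := by rw [mul_assoc, ← Real.rpow_add hX]; norm_num
  have hU2 : (U : ℝ) ≤ X ^ (2 / 3 : ℝ) :=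
    hUX.trans (Real.rpow_le_rpow_of_exponent_le hX1 (by norm_num))
  have hUU : (U : ℝ) * U ≤ X ^ (2 / 3 : ℝ) := by
    calc (U : ℝ) * U ≤ X ^ (1 / 3 : ℝ) * X ^ (1 / 3 : ℝ) := by gcongr
      _ = _ := by rw [← Real.rpow_add hX]; norm_num
  have S1 : ‖∑ n ∈ Ioc a b, (((M * ArithmeticFunction.log) n : ℝ) : ℂ) * G n‖
      ≤ K₁ * (4 * Real.log X) * (q * X ^ (2 / 3 : ℝ) * √T + 2 * Real.log X * X / √T) := by
    rw [sum_Ioc_mul_arith]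
    have := H₁ X t (4 * Real.log X) (X ^ (2 / 3 : ℝ)) q (fun x => χ x)
      (fun d => (M d : ℂ) * χ (d : ZMod q))
      (fun n => ArithmeticFunction.log n) ht hXe hq (by positivity) (hqD _ le_rfl) hχ
      (by
        intro d
        rw [norm_mul, Complex.norm_real]
        exact mul_le_one₀ (hMb d) (norm_nonneg _) (hχ _))
      (by
        intro d hd
        by_contra h
        apply hd
        have : M d = 0 := by
          rw [hM, ArithmeticFunction.truncate_apply, if_neg]
          intro h1
          exact h ((Nat.cast_le.mpr h1).trans hU2)
        rw [this]; simp)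
      (fun m n => abs_log_add_variation_le hXe m n)
    refine le_trans (le_of_eq ?_) this
    congr 1
    refine sum_congr rfl fun d _ => sum_congr rfl fun m _ => ?_
    rw [hGmul]
    split_ifs
    · ring
    · rfl
  have S2 : ‖∑ n ∈ Ioc a b,
      ((((M * N) * (ArithmeticFunction.zeta : ArithmeticFunction ℝ)) n : ℝ) : ℂ) * G n‖
      ≤ Real.log X * (K₁ * 1 * (q * X ^ (2 / 3 : ℝ) * √T + 2 * Real.log X * X / √T)) := by
    rw [sum_Ioc_mul_arith]
    have := H₁ X t 1 (X ^ (2 / 3 : ℝ)) q (fun x => χ x)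
      (fun d => if d ∈ Icc 1 b then ((M * N) d : ℂ) / Real.log X * χ (d : ZMod q) else 0)
      (fun n => 1) ht hXe hq (by positivity) (hqD _ le_rfl) hχ
      (by
        intro d
        split_ifs with h
        · rw [norm_mul, norm_div, Complex.norm_real, Complex.norm_real,
            Real.norm_of_nonneg (show 0 ≤ Real.log X by linarith)]
          refine mul_le_one₀ ?_ (norm_nonneg _) (hχ _)
          rw [div_le_one (by linarith)]
          exact (abs_mul_apply_le_log M N hMb hNb d).trans (hlogb d h)
        · simp)
      (by
        intro d hd
        by_contra h
        apply hd
        have : (M * N) d = 0 := by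
          refine mul_apply_eq_zero_of_support fun x y hxy => ?_
          rw [hM, hN, ArithmeticFunction.truncate_apply, ArithmeticFunction.truncate_apply]
          by_cases h1 : x ≤ U
          · by_cases h2 : y ≤ U
            · exfalso
              apply h
              refine le_trans ?_ hUU
              rw [← hxy]
              exact_mod_cast Nat.mul_le_mul h1 h2
            · right; rw [if_neg h2]
          · left; rw [if_neg h1]
        rw [this]; simp)
      (by intro m n _ _ _; simp)
    have h2 : ∑ d ∈ Icc 1 b, ∑ m ∈ Icc 1 b, (if a < d * m ∧ d * m ≤ b then
          ((M * N) d : ℂ) * (ArithmeticFunction.zeta : ArithmeticFunction ℝ) m * G (d * m) else 0)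
        = Real.log X * ∑ d ∈ Icc 1 b, ∑ m ∈ Icc 1 b, (if a < d * m ∧ d * m ≤ b then
          (if d ∈ Icc 1 b then ((M * N) d : ℂ) / Real.log X * χ (d : ZMod q) else 0)
            * (χ (m : ZMod q) * e (t * ((d : ℝ) * m) ^ c) * ((1 : ℝ) : ℂ)) else 0) := by
      rw [mul_sum]
      refine sum_congr rfl fun d hd => ?_
      rw [mul_sum]
      refine sum_congr rfl fun m hm => ?_
      rw [if_pos hd, hGmul]
      split_ifs
      · rw [ArithmeticFunction.natCoe_apply, ArithmeticFunction.zeta_apply_ne (by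
          rw [mem_Icc] at hm; omega)]
        have : (Real.log X : ℂ) ≠ 0 := by exact_mod_cast (by linarith : Real.log X ≠ 0)
        push_cast
        field_simp
      · simp
    rw [h2, norm_mul, Complex.norm_real, Real.norm_of_nonneg (by linarith)]
    gcongr
  have S3 : ‖∑ n ∈ Ioc a b, (((((ArithmeticFunction.moebius : ArithmeticFunction ℝ) - M)
        * ((ArithmeticFunction.vonMangoldt - N) * (ArithmeticFunction.zeta : ArithmeticFunction ℝ)))
          n : ℝ) : ℂ) * G n‖
      ≤ Real.log X * (K₂ * Real.log X * (X ^ (11 / 12 : ℝ) + X / √√T)) := by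
    rw [sum_Ioc_mul_arith]
    set P := (ArithmeticFunction.moebius : ArithmeticFunction ℝ) - M with hP
    set Q := (ArithmeticFunction.vonMangoldt - N) * (ArithmeticFunction.zeta : ArithmeticFunction ℝ)
      with hQ
    have hPv : ∀ n, P n = if n ≤ U then 0 else (ArithmeticFunction.moebius n : ℝ) := by
      intro n
      rw [hP, ArithmeticFunction.sub_apply', hM, ArithmeticFunction.truncate_apply,
        ArithmeticFunction.intCoe_apply]
      split_ifs <;> simp
    have hΛv : ∀ n, (ArithmeticFunction.vonMangoldt - N) n
        = if n ≤ U then 0 else ArithmeticFunction.vonMangoldt n := by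
      intro n
      rw [ArithmeticFunction.sub_apply', hN, ArithmeticFunction.truncate_apply]
      split_ifs <;> simp
    have hQb : ∀ n, |Q n| ≤ Real.log n := by
      intro n
      rw [hQ, mul_comm]
      refine abs_mul_apply_le_log _ _ ?_ ?_ n
      · intro m
        rw [ArithmeticFunction.natCoe_apply, ArithmeticFunction.zeta_apply]
        split_ifs <;> simp
      · intro m
        rw [hΛv]
        split_ifs
        · simp
        · rw [abs_of_nonneg ArithmeticFunction.vonMangoldt_nonneg]
    have := H₂ X t U (fun d => (P d : ℂ) * χ (d : ZMod q))
      (fun d => if d ∈ Icc 1 b then (Q d : ℂ) / Real.log X * χ (d : ZMod q) else 0)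
      ht hXe hXμ hU1 hTX
      (by
        intro d
        rw [norm_mul, Complex.norm_real]
        refine mul_le_one₀ ?_ (norm_nonneg _) (hχ _)
        rw [hPv]
        split_ifs
        · simp
        · rw [Real.norm_eq_abs, ← Int.cast_abs]
          exact_mod_cast ArithmeticFunction.abs_moebius_le_one)
      (by
        intro d
        split_ifs with h
        · rw [norm_mul, norm_div, Complex.norm_real, Complex.norm_real,
            Real.norm_of_nonneg (show 0 ≤ Real.log X by linarith)]
          refine mul_le_one₀ ?_ (norm_nonneg _) (hχ _)
          rw [div_le_one (by linarith)]
          exact (hQb d).trans (hlogb d h)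
        · simp)
      (by
        intro d hd
        by_contra h
        apply hd
        rw [hPv, if_pos (by omega)]; simp)
      (by
        intro d hd
        by_contra h
        apply hd
        split_ifs with hdb
        · have : Q d = 0 := by
            rw [mem_Icc] at hdb
            refine mul_apply_eq_zero_of_support fun x y hxy => ?_
            left
            rw [hΛv, if_pos]
            have : x ≤ d := Nat.le_of_dvd (by omega) ⟨y, hxy.symm⟩
            omega
          rw [this]; simp
        · rfl)
    have h2 : ∑ d ∈ Icc 1 b, ∑ m ∈ Icc 1 b, (if a < d * m ∧ d * m ≤ b then
          (P d : ℂ) * Q m * G (d * m) else 0)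
        = Real.log X * ∑ d ∈ Icc 1 b, ∑ m ∈ Icc 1 b, (if a < d * m ∧ d * m ≤ b then
          (P d : ℂ) * χ (d : ZMod q) * (if m ∈ Icc 1 b then
            (Q m : ℂ) / Real.log X * χ (m : ZMod q) else 0)
            * e (t * ((d : ℝ) * m) ^ c) else 0) := by
      rw [mul_sum]
      refine sum_congr rfl fun d hd => ?_
      rw [mul_sum]
      refine sum_congr rfl fun m hm => ?_
      rw [if_pos hm, hGmul]
      split_ifs
      · have : (Real.log X : ℂ) ≠ 0 := by exact_mod_cast (by linarith : Real.log X ≠ 0)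
        field_simp
      · simp
    rw [h2, norm_mul, Complex.norm_real, Real.norm_of_nonneg (by linarith)]
    gcongr
  rw [hsplit]
  refine (norm_add_le _ _).trans ((add_le_add ((norm_sub_le _ _).trans (add_le_add S1 S2))
      S3).trans ?_)
  clear_value T
  have p1 : 0 ≤ q * X ^ (2 / 3 : ℝ) * √T := by positivity
  have p2 : 0 ≤ X / √T := by positivity
  have p3 : 0 ≤ X ^ (11 / 12 : ℝ) + X / √√T := by positivity
  set A := q * X ^ (2 / 3 : ℝ) * √T
  rw [mul_div_assoc]
  set B := X / √T
  set D := X ^ (11 / 12 : ℝ) + X / √√T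
  set L := Real.log X
  have e1 : L * A ≤ L ^ 2 * A := by
    refine mul_le_mul_of_nonneg_right ?_ p1
    nlinarith
  have e2 := mul_le_mul_of_nonneg_left e1 hK₁.le
  have e3 : 0 ≤ K₁ * L ^ 2 * A := by positivity
  have e4 : 0 ≤ K₁ * L ^ 2 * D := by positivity
  have e5 : 0 ≤ K₂ * L ^ 2 * (A + B) := by positivity
  nlinarith

lemma hasDerivAt_ofReal_cpow_neg {u : ℝ} (hu : 0 < u) (s : ℂ) :
    HasDerivAt (fun y : ℝ => (y : ℂ) ^ (-s)) (-s * (u : ℂ) ^ (-s - 1)) u := by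
  have h := (hasDerivAt_id (u : ℂ)).cpow_const (c := -s) (Or.inl (by simpa using hu))
  simpa using h.comp_ofReal

lemma norm_natCast_cpow_neg {n : ℕ} (hn : 0 < n) (s : ℂ) :
    ‖(n : ℂ) ^ (-s)‖ = (n : ℝ) ^ (-s.re) := by
  rw [Complex.norm_natCast_cpow_of_pos hn, Complex.neg_re]

lemma norm_cpow_neg_sub_le {s : ℂ} (hs : 0 < s.re) {x y : ℝ} (hx : 0 < x) (hxy : x ≤ y) :
    ‖(y : ℂ) ^ (-s) - (x : ℂ) ^ (-s)‖ ≤ ‖s‖ / s.re * (x ^ (-s.re) - y ^ (-s.re)) := by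
  have hB : ∀ u : ℝ, 0 < u → HasDerivAt (fun u => ‖s‖ / s.re * (x ^ (-s.re) - u ^ (-s.re)))
      (‖s‖ * u ^ (-s.re - 1)) u := by
    intro u hu0
    have := (((Real.hasDerivAt_rpow_const (p := -s.re) (Or.inl hu0.ne')).const_sub
      (x ^ (-s.re))).const_mul (‖s‖ / s.re))
    refine this.congr_deriv ?_
    field_simp
  have key := image_norm_le_of_norm_deriv_right_le_deriv_boundary' (a := x) (b := y)
    (f := fun u : ℝ => (u : ℂ) ^ (-s) - (x : ℂ) ^ (-s))
    (f' := fun u : ℝ => -s * (u : ℂ) ^ (-s - 1))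
    (B := fun u => ‖s‖ / s.re * (x ^ (-s.re) - u ^ (-s.re)))
    (B' := fun u => ‖s‖ * u ^ (-s.re - 1)) ?_ ?_ ?_ ?_ ?_ ?_ (Set.right_mem_Icc.mpr hxy)
  · exact key
  · intro u hu
    exact ((hasDerivAt_ofReal_cpow_neg (hx.trans_le hu.1) s).sub_const
        _).continuousAt.continuousWithinAt
  · intro u hu
    exact ((hasDerivAt_ofReal_cpow_neg (hx.trans_le hu.1) s).sub_const _).hasDerivWithinAt
  · simp
  · intro u hu
    exact (hB u (hx.trans_le hu.1)).continuousAt.continuousWithinAt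
  · intro u hu
    exact (hB u (hx.trans_le hu.1)).hasDerivWithinAt
  · intro u hu
    rw [norm_mul, norm_neg, Complex.norm_cpow_eq_rpow_re_of_pos (hx.trans_le hu.1)]
    simp

/-- Tails of Dirichlet series whose coefficients have bounded partial sums. -/
lemma norm_sum_Ico_mul_cpow_le {a : ℕ → ℂ} {A : ℝ} (hA : ∀ m n, ‖∑ i ∈ Ico m n, a i‖ ≤ A)
    {s : ℂ} (hs : 0 < s.re) {m n : ℕ} (hm : 1 ≤ m) :
    ‖∑ i ∈ Ico m n, a i * (i : ℂ) ^ (-s)‖ ≤ A * (1 + ‖s‖ / s.re) * (m : ℝ) ^ (-s.re) := by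
  have hA0 : 0 ≤ A := (norm_nonneg _).trans (hA 0 0)
  have hm' : (0 : ℝ) < m := by exact_mod_cast hm
  rcases lt_or_ge n m with h | h
  · rw [Ico_eq_empty (by omega), sum_empty, norm_zero]; positivity
  refine (norm_sum_mul_le_abel a (fun i : ℕ => (i : ℂ) ^ (-s)) h (fun k _ _ => hA m k)).trans ?_
  rw [mul_assoc]
  refine mul_le_mul_of_nonneg_left ?_ hA0
  have h1 : ∑ i ∈ Ico m n, ‖((i + 1 : ℕ) : ℂ) ^ (-s) - (i : ℂ) ^ (-s)‖
      ≤ ∑ i ∈ Ico m n, (‖s‖ / s.re * (i : ℝ) ^ (-s.re) - ‖s‖ / s.re *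
          ((i + 1 : ℕ) : ℝ) ^ (-s.re)) := by
    refine sum_le_sum fun i hi => ?_
    rw [mem_Ico] at hi
    have hi0 : (0 : ℝ) < i := by exact_mod_cast (by omega : 0 < i)
    have := norm_cpow_neg_sub_le hs hi0 (y := ((i + 1 : ℕ) : ℝ)) (by push_cast; linarith)
    rw [mul_sub] at this
    simpa using this
  have h1' : ∑ i ∈ Ico m n, (‖s‖ / s.re * (i : ℝ) ^ (-s.re)
      - ‖s‖ / s.re * ((i + 1 : ℕ) : ℝ) ^ (-s.re))
      = ‖s‖ / s.re * (m : ℝ) ^ (-s.re) - ‖s‖ / s.re * (n : ℝ) ^ (-s.re) := by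
    rw [sum_Ico_eq_sub _ h, sum_range_sub' (fun i : ℕ => ‖s‖ / s.re * (i : ℝ) ^ (-s.re)),
      sum_range_sub' (fun i : ℕ => ‖s‖ / s.re * (i : ℝ) ^ (-s.re))]
    ring
  rw [h1'] at h1
  rw [norm_natCast_cpow_neg (by omega)]
  have h2 : (n : ℝ) ^ (-s.re) ≤ (m : ℝ) ^ (-s.re) :=
    Real.rpow_le_rpow_of_nonpos hm' (by exact_mod_cast h) (by linarith)
  have h3 : 0 ≤ ‖s‖ / s.re * (n : ℝ) ^ (-s.re) := by positivity
  linarith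

lemma norm_natCast_cpow_neg_sub_le {s : ℂ} (hs : 0 < s.re) (hs1 : s ≠ 1) {n : ℕ} (hn : 1 ≤ n) :
    ‖(n : ℂ) ^ (-s) - ((n : ℂ) ^ (1 - s) - ((n + 1 : ℕ) : ℂ) ^ (1 - s)) / (s - 1)‖
      ≤ ‖s‖ / s.re * ((n : ℝ) ^ (-s.re) - ((n + 1 : ℕ) : ℝ) ^ (-s.re)) := by
  have hn' : (0 : ℝ) < n := by exact_mod_cast hn
  have hs1' : s - 1 ≠ 0 := sub_ne_zero.mpr hs1
  have hd : ∀ u ∈ Set.Icc (n : ℝ) ((n + 1 : ℕ) : ℝ), HasDerivWithinAt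
      (fun u : ℝ => (u : ℂ) * (n : ℂ) ^ (-s) + (u : ℂ) ^ (-(s - 1)) / (s - 1))
      ((n : ℂ) ^ (-s) - (u : ℂ) ^ (-s)) (Set.Icc (n : ℝ) ((n + 1 : ℕ) : ℝ)) u := by
    intro u hu
    have h1 := (hasDerivAt_ofReal_cpow_neg (hn'.trans_le hu.1) (s - 1)).div_const (s - 1)
    have h2 := ((hasDerivAt_id (u : ℂ)).comp_ofReal).mul_const ((n : ℂ) ^ (-s))
    refine ((h2.add h1).congr_deriv ?_).hasDerivWithinAt
    rw [show -(s - 1) - 1 = -s by ring]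
    field_simp
    ring
  have key := Convex.norm_image_sub_le_of_norm_hasDerivWithin_le
    (C := ‖s‖ / s.re * ((n : ℝ) ^ (-s.re) - ((n + 1 : ℕ) : ℝ) ^ (-s.re))) hd ?_
    (convex_Icc _ _) (Set.left_mem_Icc.mpr (by push_cast; linarith))
    (Set.right_mem_Icc.mpr (by push_cast; linarith))
  · have e1 : ((((n + 1 : ℕ) : ℝ) : ℂ) * (n : ℂ) ^ (-s) +
        (((n + 1 : ℕ) : ℝ) : ℂ) ^ (-(s - 1)) / (s - 1))
        - (((n : ℝ) : ℂ) * (n : ℂ) ^ (-s) + ((n : ℝ) : ℂ) ^ (-(s - 1)) / (s - 1))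
        = (n : ℂ) ^ (-s) - ((n : ℂ) ^ (1 - s) - ((n + 1 : ℕ) : ℂ) ^ (1 - s)) / (s - 1) := by
      rw [neg_sub]
      push_cast
      ring
    rw [e1] at key
    refine key.trans (le_of_eq ?_)
    push_cast
    simp
  · intro u hu
    rw [norm_sub_rev]
    have hu0 := hn'.trans_le hu.1
    have := norm_cpow_neg_sub_le hs hn' hu.1
    refine le_trans (by simpa using this) ?_
    have h2 : ((n + 1 : ℕ) : ℝ) ^ (-s.re) ≤ u ^ (-s.re) :=
      Real.rpow_le_rpow_of_nonpos hu0 hu.2 (by linarith)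
    gcongr

/-- Tails of the zeta series, to the right of the line `Re s = 1`. -/
lemma norm_sum_Ico_cpow_le {s : ℂ} (hs : 1 < s.re) {m n : ℕ} (hm : 1 ≤ m) (hmn : m ≤ n) :
    ‖∑ i ∈ Ico m n, (i : ℂ) ^ (-s)‖ ≤ 2 / ‖s - 1‖ + ‖s‖ / m := by
  have hs1 : s ≠ 1 := by rintro rfl; simp at hs
  have hs0 : 0 < s.re := by linarith
  have hm' : (0 : ℝ) < m := by exact_mod_cast hm
  have h1 : ∑ i ∈ Ico m n, (((i : ℂ) ^ (1 - s) - ((i + 1 : ℕ) : ℂ) ^ (1 - s)) / (s - 1))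
      = ((m : ℂ) ^ (1 - s) - (n : ℂ) ^ (1 - s)) / (s - 1) := by
    rw [← sum_div, sum_Ico_eq_sub _ hmn, sum_range_sub' (fun i : ℕ => (i : ℂ) ^ (1 - s)),
      sum_range_sub' (fun i : ℕ => (i : ℂ) ^ (1 - s))]
    ring
  have h2 : ‖∑ i ∈ Ico m n, ((i : ℂ) ^ (-s)
      - ((i : ℂ) ^ (1 - s) - ((i + 1 : ℕ) : ℂ) ^ (1 - s)) / (s - 1))‖ ≤ ‖s‖ / m := by
    calc _ ≤ ∑ i ∈ Ico m n, ‖s‖ / s.re * ((i : ℝ) ^ (-s.re) - ((i + 1 : ℕ) : ℝ) ^ (-s.re)) := by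
          refine (norm_sum_le _ _).trans (sum_le_sum fun i hi => ?_)
          rw [mem_Ico] at hi
          exact norm_natCast_cpow_neg_sub_le hs0 hs1 (by omega)
      _ = ‖s‖ / s.re * ((m : ℝ) ^ (-s.re) - (n : ℝ) ^ (-s.re)) := by
          rw [← mul_sum, sum_Ico_eq_sub _ hmn, sum_range_sub' (fun i : ℕ => (i : ℝ) ^ (-s.re)),
            sum_range_sub' (fun i : ℕ => (i : ℝ) ^ (-s.re))]
          ring
      _ ≤ ‖s‖ / 1 * (m : ℝ) ^ (-1 : ℝ) := by
          have h3 : 0 ≤ (n : ℝ) ^ (-s.re) := by positivity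
          have h4 : (m : ℝ) ^ (-s.re) ≤ (m : ℝ) ^ (-1 : ℝ) :=
            Real.rpow_le_rpow_of_exponent_le (by exact_mod_cast hm) (by linarith)
          have h5 : ‖s‖ / s.re ≤ ‖s‖ / 1 := by gcongr
          have h6 : (n : ℝ) ^ (-s.re) ≤ (m : ℝ) ^ (-s.re) :=
            Real.rpow_le_rpow_of_nonpos hm' (by exact_mod_cast hmn) (by linarith)
          exact mul_le_mul h5 (by linarith) (by linarith) (by positivity)
      _ = _ := by rw [Real.rpow_neg_one]; ring
  have h3 : ‖((m : ℂ) ^ (1 - s) - (n : ℂ) ^ (1 - s)) / (s - 1)‖ ≤ 2 / ‖s - 1‖ := by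
    have hle : ∀ k : ℕ, 1 ≤ k → ‖(k : ℂ) ^ (1 - s)‖ ≤ 1 := by
      intro k hk
      rw [Complex.norm_natCast_cpow_of_pos hk]
      exact Real.rpow_le_one_of_one_le_of_nonpos (by exact_mod_cast hk) (by simp; linarith)
    rw [norm_div]
    gcongr
    refine (norm_sub_le _ _).trans ?_
    linarith [hle m hm, hle n (hm.trans hmn)]
  rw [sum_sub_distrib, h1] at h2
  calc _ = ‖((m : ℂ) ^ (1 - s) - (n : ℂ) ^ (1 - s)) / (s - 1) + (∑ i ∈ Ico m n, (i : ℂ) ^ (-s)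
        - ((m : ℂ) ^ (1 - s) - (n : ℂ) ^ (1 - s)) / (s - 1))‖ := by congr 1; ring
    _ ≤ _ := (norm_add_le _ _).trans (add_le_add h3 h2)

lemma norm_sum_Ico_le_of_periodic {q : ℕ} (hq : 0 < q) {a : ℕ → ℂ} (hper : ∀ n, a (n + q) = a n)
    (h0 : ∑ i ∈ range q, a i = 0) {D : ℝ} (hD : ∀ n, ‖a n‖ ≤ D) (m n : ℕ) :
    ‖∑ i ∈ Ico m n, a i‖ ≤ q * D := by
  have hD0 : 0 ≤ D := (norm_nonneg _).trans (hD 0)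
  have hwin : ∀ k, ∑ i ∈ Ico k (k + q), a i = 0 := by
    intro k
    induction k with
    | zero => simpa using h0
    | succ k ih =>
      rw [sum_eq_sum_Ico_succ_bot (by omega)] at ih
      rw [show k + 1 + q = (k + q) + 1 by ring, sum_Ico_succ_top (by omega), hper, add_comm]
      exact ih
  induction n using Nat.strong_induction_on with
  | _ n ih =>
    by_cases h : n < m + q
    · refine (norm_sum_le _ _).trans ((sum_le_sum fun i _ => hD i).trans ?_)
      rw [sum_const, Nat.card_Ico, nsmul_eq_mul]
      gcongr
      omega
    · have h1 := ih (n - q) (by omega)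
      rw [← sum_Ico_consecutive a (by omega : m ≤ n - q) (by omega : n - q ≤ n)]
      have h2 := hwin (n - q)
      rw [show n - q + q = n by omega] at h2
      rwa [h2, add_zero]

lemma norm_sum_Ico_dirichletCharacter_le {q : ℕ} [NeZero q] {χ : DirichletCharacter ℂ q}
    (hχ : χ ≠ 1) (m n : ℕ) : ‖∑ i ∈ Ico m n, χ (i : ZMod q)‖ ≤ q := by
  have h := norm_sum_Ico_le_of_periodic (NeZero.pos q) (a := fun i : ℕ => χ (i : ZMod q)) (D := 1)
    (by simp) ?_ (fun n => χ.norm_le_one _) m n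
  · simpa using h
  · rw [← MulChar.sum_eq_zero_of_ne_one hχ]
    refine sum_bij (fun i _ => (i : ZMod q)) (by simp) ?_ ?_ (by simp)
    · intro i hi j hj hij
      rw [mem_range] at hi hj
      have := (ZMod.natCast_eq_natCast_iff' i j q).mp hij
      rwa [Nat.mod_eq_of_lt hi, Nat.mod_eq_of_lt hj] at this
    · intro b _
      exact ⟨b.val, by simpa using ZMod.val_lt b, ZMod.natCast_zmod_val b⟩

lemma tendsto_const_mul_natCast_rpow_neg (D : ℝ) {σ : ℝ} (hσ : 0 < σ) :
    Filter.Tendsto (fun m : ℕ => D * (m : ℝ) ^ (-σ)) Filter.atTop (nhds 0) := by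
  simpa using ((tendsto_rpow_neg_atTop hσ).comp tendsto_natCast_atTop_atTop).const_mul D

/-- A Dirichlet series whose coefficients have bounded partial sums converges to an analytic
function on the right half plane. -/
lemma exists_differentiableOn_tendsto {a : ℕ → ℂ} {A : ℝ} (hA : ∀ m n, ‖∑ i ∈ Ico m n, a i‖ ≤ A) :
    ∃ g : ℂ → ℂ, DifferentiableOn ℂ g {s | 0 < s.re} ∧
      (∀ s : ℂ, 0 < s.re → Filter.Tendsto (fun n => ∑ i ∈ Ico 1 n, a i * (i : ℂ) ^ (-s))
        Filter.atTop (nhds (g s))) ∧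
      ∀ s : ℂ, 0 < s.re → ∀ m : ℕ, 1 ≤ m → ‖g s - ∑ i ∈ Ico 1 m, a i * (i : ℂ) ^ (-s)‖
        ≤ A * (1 + ‖s‖ / s.re) * (m : ℝ) ^ (-s.re) := by
  have hA0 : 0 ≤ A := (norm_nonneg _).trans (hA 0 0)
  have hdiff : ∀ s : ℂ, 0 < s.re → ∀ m n : ℕ, 1 ≤ m → m ≤ n →
      ‖∑ i ∈ Ico 1 n, a i * (i : ℂ) ^ (-s) - ∑ i ∈ Ico 1 m, a i * (i : ℂ) ^ (-s)‖
        ≤ A * (1 + ‖s‖ / s.re) * (m : ℝ) ^ (-s.re) := by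
    intro s hs m n hm hmn
    rw [← sum_Ico_consecutive _ hm hmn, add_sub_cancel_left]
    exact norm_sum_Ico_mul_cpow_le hA hs hm
  have hlim : ∀ s : ℂ, 0 < s.re → ∃ z, Filter.Tendsto
      (fun n => ∑ i ∈ Ico 1 n, a i * (i : ℂ) ^ (-s)) Filter.atTop (nhds z) := by
    intro s hs
    refine cauchySeq_tendsto_of_complete (Metric.cauchySeq_iff'.mpr fun ε hε => ?_)
    obtain ⟨N, hN, hN1⟩ := (((tendsto_const_mul_natCast_rpow_neg (A * (1 + ‖s‖ / s.re))
        hs).eventually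
      (gt_mem_nhds hε)).and (Filter.eventually_ge_atTop 1)).exists
    refine ⟨N, fun n hn => ?_⟩
    rw [dist_eq_norm]
    exact (hdiff s hs N n hN1 hn).trans_lt hN
  choose! g hg using hlim
  have hbd : ∀ s : ℂ, 0 < s.re → ∀ m : ℕ, 1 ≤ m → ‖g s - ∑ i ∈ Ico 1 m, a i * (i : ℂ) ^ (-s)‖
        ≤ A * (1 + ‖s‖ / s.re) * (m : ℝ) ^ (-s.re) := by
    intro s hs m hm
    refine le_of_tendsto ((hg s hs).sub_const _).norm ?_
    filter_upwards [Filter.eventually_ge_atTop m] with n hn using hdiff s hs m n hm hn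
  refine ⟨g, ?_, hg, hbd⟩
  have hopen : IsOpen {s : ℂ | 0 < s.re} := isOpen_lt continuous_const Complex.continuous_re
  refine TendstoLocallyUniformlyOn.differentiableOn
    (F := fun n : ℕ => fun s : ℂ => ∑ i ∈ Ico 1 n, a i * (i : ℂ) ^ (-s)) (φ := Filter.atTop) ?_ ?_
        hopen
  · rw [Metric.tendstoLocallyUniformlyOn_iff]
    intro ε hε x hx
    have hx' : 0 < x.re / 2 := half_pos hx
    refine ⟨{y | x.re / 2 < y.re} ∩ Metric.ball x 1, mem_nhdsWithin_of_mem_nhds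
      (Filter.inter_mem ?_ (Metric.ball_mem_nhds x one_pos)), ?_⟩
    · have h : x.re / 2 < x.re := half_lt_self hx
      exact (isOpen_lt continuous_const Complex.continuous_re).mem_nhds h
    filter_upwards [((tendsto_const_mul_natCast_rpow_neg
      (A * (1 + (‖x‖ + 1) / (x.re / 2))) hx').eventually (gt_mem_nhds hε)),
      Filter.eventually_ge_atTop 1] with m hm hm1 y hy
    have hy1 : x.re / 2 < y.re := hy.1
    have hy2 : ‖y‖ ≤ ‖x‖ + 1 := by
      have := mem_ball_iff_norm.mp hy.2
      linarith [norm_le_norm_add_norm_sub' y x]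
    rw [dist_eq_norm]
    refine ((hbd y (hx'.trans hy1) m hm1).trans ?_).trans_lt hm
    have hm1' : (1 : ℝ) ≤ m := by exact_mod_cast hm1
    have h3 : (m : ℝ) ^ (-y.re) ≤ (m : ℝ) ^ (-(x.re / 2)) :=
      Real.rpow_le_rpow_of_exponent_le hm1' (by linarith)
    gcongr
  · refine Filter.Eventually.of_forall fun n => ?_
    intro s _
    refine DifferentiableAt.differentiableWithinAt ?_
    refine DifferentiableAt.fun_sum fun i hi => ?_
    have hi0 : (i : ℂ) ≠ 0 := by
      rw [mem_Ico] at hi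
      exact_mod_cast (by omega : i ≠ 0)
    exact (differentiableAt_id.neg.const_cpow (Or.inl hi0)).const_mul _

lemma tendsto_sum_Ico_LSeries {a : ℕ → ℂ} {s : ℂ} (h : LSeriesSummable a s) :
    Filter.Tendsto (fun n => ∑ i ∈ Ico 1 n, a i * (i : ℂ) ^ (-s)) Filter.atTop
      (nhds (LSeries a s)) := by
  refine h.hasSum.tendsto_sum_nat.congr' ?_
  filter_upwards [Filter.eventually_ge_atTop 1] with n hn
  rw [range_eq_Ico, sum_eq_sum_Ico_succ_bot (by omega), LSeries.term_zero, zero_add]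
  refine sum_congr rfl fun i hi => ?_
  rw [mem_Ico] at hi
  rw [LSeries.term_of_ne_zero (by omega), Complex.cpow_neg, div_eq_mul_inv]

section
variable {q : ℕ} [NeZero q] {χ : DirichletCharacter ℂ q}

lemma tendsto_sum_Ico_LFunction_and_norm_sub_le (hχ : χ ≠ 1) {s : ℂ} (hs : 0 < s.re) :
    Filter.Tendsto (fun n : ℕ => ∑ i ∈ Ico 1 n, χ (i : ZMod q) * (i : ℂ) ^ (-s)) Filter.atTop
      (nhds (χ.LFunction s)) ∧
    ∀ m : ℕ, 1 ≤ m → ‖χ.LFunction s - ∑ i ∈ Ico 1 m, χ (i : ZMod q) * (i : ℂ) ^ (-s)‖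
        ≤ q * (1 + ‖s‖ / s.re) * (m : ℝ) ^ (-s.re) := by
  obtain ⟨g, hg, hlim, hbd⟩ := exists_differentiableOn_tendsto
    (a := fun i : ℕ => χ (i : ZMod q)) (norm_sum_Ico_dirichletCharacter_le hχ)
  have hopen : IsOpen {s : ℂ | 0 < s.re} := isOpen_lt continuous_const Complex.continuous_re
  have heq : Set.EqOn χ.LFunction g {s : ℂ | 0 < s.re} := by
    refine AnalyticOnNhd.eqOn_of_preconnected_of_eventuallyEq (z₀ := 2)
      ((DirichletCharacter.differentiable_LFunction hχ).differentiableOn.analyticOnNhd hopen)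
      (hg.analyticOnNhd hopen) (convex_halfSpace_re_gt 0).isPreconnected (by simp) ?_
    have h1 : ∀ᶠ z : ℂ in nhds 2, 1 < z.re :=
      (isOpen_lt continuous_const Complex.continuous_re).mem_nhds (by simp)
    filter_upwards [h1] with z hz
    rw [DirichletCharacter.LFunction_eq_LSeries χ hz]
    exact tendsto_nhds_unique (tendsto_sum_Ico_LSeries (χ.LSeriesSummable_of_one_lt_re hz))
      (hlim z (by linarith))
  rw [heq hs]
  exact ⟨hlim s hs, hbd s hs⟩

end

lemma sum_Ico_inv_le (N : ℕ) : ∑ i ∈ Ico 1 N, (i : ℝ)⁻¹ ≤ 1 + Real.log N := by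
  have h := harmonic_le_one_add_log N
  rw [harmonic_eq_sum_Icc] at h
  push_cast at h
  refine le_trans (sum_le_sum_of_subset_of_nonneg ?_ fun i _ _ => by positivity) h
  exact fun i hi => by rw [mem_Ico] at hi; rw [mem_Icc]; omega

lemma sum_Ico_rpow_neg_le {N : ℕ} (hN : 1 ≤ N) {η σ : ℝ} (hη : 0 < η) (hσ : 1 - η ≤ σ) :
    ∑ i ∈ Ico 1 N, (i : ℝ) ^ (-σ) ≤ (1 + 1 / η) * (N : ℝ) ^ (2 * η) := by
  have hN' : (1 : ℝ) ≤ N := by exact_mod_cast hN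
  have h1 : ∀ i ∈ Ico 1 N, (i : ℝ) ^ (-σ) ≤ (N : ℝ) ^ η * (i : ℝ)⁻¹ := by
    intro i hi
    rw [mem_Ico] at hi
    have hi1 : (1 : ℝ) ≤ i := by exact_mod_cast hi.1
    calc (i : ℝ) ^ (-σ) ≤ (i : ℝ) ^ (η + -1) :=
          Real.rpow_le_rpow_of_exponent_le hi1 (by linarith)
      _ = (i : ℝ) ^ η * (i : ℝ)⁻¹ := by rw [Real.rpow_add (by linarith), Real.rpow_neg_one]
      _ ≤ _ := by
          have : (i : ℝ) ≤ N := by exact_mod_cast hi.2.le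
          gcongr
  calc _ ≤ ∑ i ∈ Ico 1 N, (N : ℝ) ^ η * (i : ℝ)⁻¹ := sum_le_sum h1
    _ ≤ (N : ℝ) ^ η * (1 + Real.log N) := by
        rw [← mul_sum]
        exact mul_le_mul_of_nonneg_left (sum_Ico_inv_le N) (by positivity)
    _ ≤ (N : ℝ) ^ η * ((N : ℝ) ^ η + (N : ℝ) ^ η / η) := by
        have h2 := Real.log_le_rpow_div (by linarith : (0 : ℝ) ≤ N) hη
        have h3 := Real.one_le_rpow hN' hη.le
        gcongr
    _ = _ := by
        rw [two_mul, Real.rpow_add (by linarith)]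
        ring

lemma norm_sum_Ico_mul_cpow_le_rpow {a : ℕ → ℂ} (ha : ∀ n, ‖a n‖ ≤ 1) {N : ℕ} (hN : 1 ≤ N)
    {η : ℝ} (hη : 0 < η) {s : ℂ} (hs : 1 - η ≤ s.re) :
    ‖∑ i ∈ Ico 1 N, a i * (i : ℂ) ^ (-s)‖ ≤ (1 + 1 / η) * (N : ℝ) ^ (2 * η) := by
  refine (norm_sum_le _ _).trans (le_trans (sum_le_sum fun i hi => ?_)
    (sum_Ico_rpow_neg_le hN hη hs))
  rw [mem_Ico] at hi
  rw [norm_mul, norm_natCast_cpow_neg (by omega)]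
  exact mul_le_of_le_one_left (by positivity) (ha i)

lemma natCeil_rpow_le {V : ℝ} (hV : 1 ≤ V) {ε : ℝ} (hε : 0 < ε) (hε1 : ε ≤ 1) :
    (⌈V⌉₊ : ℝ) ^ ε ≤ 2 * V ^ ε := by
  have h1 : (⌈V⌉₊ : ℝ) ≤ 2 * V := by linarith [Nat.ceil_lt_add_one (by linarith : 0 ≤ V)]
  calc (⌈V⌉₊ : ℝ) ^ ε ≤ (2 * V) ^ ε := by gcongr
    _ = 2 ^ ε * V ^ ε := Real.mul_rpow (by norm_num) (by linarith)
    _ ≤ 2 ^ (1 : ℝ) * V ^ ε := by gcongr; norm_num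
    _ = _ := by rw [Real.rpow_one]

lemma norm_le_add_abs_im {s : ℂ} {b : ℝ} (h0 : 0 ≤ s.re) (h : s.re ≤ b) : ‖s‖ ≤ b + |s.im| := by
  have := Complex.norm_le_abs_re_add_abs_im s
  rw [abs_of_nonneg h0] at this
  linarith

section
variable {q : ℕ} [NeZero q] {χ : DirichletCharacter ℂ q}

lemma two_le_natCast_mul (q : ℕ) [NeZero q] {T : ℝ} (hT : 0 ≤ T) : 2 ≤ (q : ℝ) * (T + 2) := by
  have : (1 : ℝ) ≤ q := by exact_mod_cast NeZero.pos q
  nlinarith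

lemma norm_LFunction_le (hχ : χ ≠ 1) {ε : ℝ} (hε : 0 < ε) (hε1 : ε ≤ 1) {s : ℂ} {T : ℝ}
    (hT : |s.im| ≤ T) (hs : 1 - ε / 2 ≤ s.re) (hs3 : s.re ≤ 3) :
    ‖χ.LFunction s‖ ≤ (10 + 4 / ε) * (q * (T + 2)) ^ ε := by
  have hT0 : 0 ≤ T := (abs_nonneg _).trans hT
  have hV2 := two_le_natCast_mul q hT0
  have hq : (1 : ℝ) ≤ q := by exact_mod_cast NeZero.pos q
  set V : ℝ := q * (T + 2) with hV
  set N := ⌈V⌉₊ with hN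
  have hNV : V ≤ N := Nat.le_ceil V
  have hN1 : 1 ≤ N := by exact_mod_cast (by linarith : (1 : ℝ) ≤ N)
  have hN0 : (0 : ℝ) < N := by linarith
  have hs0 : 1 / 2 ≤ s.re := by linarith
  have hNε := natCeil_rpow_le (by linarith : 1 ≤ V) hε hε1
  have h1 := (tendsto_sum_Ico_LFunction_and_norm_sub_le hχ (by linarith : 0 < s.re)).2 N hN1
  have h2 := norm_sum_Ico_mul_cpow_le_rpow (a := fun i : ℕ => χ (i : ZMod q))
    (fun n => χ.norm_le_one _) hN1 (half_pos hε) hs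
  rw [show 2 * (ε / 2) = ε by ring, show 1 + 1 / (ε / 2) = 1 + 2 / ε by field_simp] at h2
  have h3 : (q : ℝ) * (1 + ‖s‖ / s.re) * (N : ℝ) ^ (-s.re) ≤ 4 * (N : ℝ) ^ ε := by
    have e1 : ‖s‖ / s.re ≤ (3 + T) / (1 / 2) := by
      have := norm_le_add_abs_im (by linarith) hs3
      gcongr
      linarith
    have e2 : (N : ℝ) ^ (-s.re) ≤ (N : ℝ)⁻¹ * (N : ℝ) ^ ε := by
      rw [← Real.rpow_neg_one, ← Real.rpow_add hN0]
      exact Real.rpow_le_rpow_of_exponent_le (by linarith) (by linarith)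
    calc _ ≤ (q : ℝ) * (1 + (3 + T) / (1 / 2)) * ((N : ℝ)⁻¹ * (N : ℝ) ^ ε) := by gcongr
      _ ≤ 4 * N * ((N : ℝ)⁻¹ * (N : ℝ) ^ ε) := by
          refine mul_le_mul_of_nonneg_right ?_ (by positivity)
          have : (q : ℝ) * (1 + (3 + T) / (1 / 2)) ≤ 4 * V := by
            rw [hV]
            nlinarith [mul_nonneg (by linarith : (0 : ℝ) ≤ q) hT0]
          linarith
      _ = _ := by field_simp
  have h4 : ‖χ.LFunction s‖ ≤ (5 + 2 / ε) * (N : ℝ) ^ ε := by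
    have := norm_le_norm_add_norm_sub' (χ.LFunction s)
      (∑ i ∈ Ico 1 N, χ (i : ZMod q) * (i : ℂ) ^ (-s))
    calc _ ≤ _ := this
      _ ≤ (1 + 2 / ε) * (N : ℝ) ^ ε + 4 * (N : ℝ) ^ ε := add_le_add h2 (h1.trans h3)
      _ = _ := by ring
  calc _ ≤ _ := h4
    _ ≤ (5 + 2 / ε) * (2 * V ^ ε) := by gcongr
    _ = _ := by ring

lemma norm_LSeries_one_le {ε : ℝ} (hε : 0 < ε) (hε1 : ε ≤ 1) {s : ℂ} {T : ℝ}
    (hT : |s.im| ≤ T) (hs : 1 < s.re) (hs2 : s.re ≤ 2) :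
    ‖LSeries (fun n : ℕ => (1 : DirichletCharacter ℂ q) (n : ZMod q)) s‖
      ≤ (10 + 4 / ε) * (q * (T + 2)) ^ ε + 2 / ‖s - 1‖ := by
  have hT0 : 0 ≤ T := (abs_nonneg _).trans hT
  have hV2 := two_le_natCast_mul q hT0
  have hq : (1 : ℝ) ≤ q := by exact_mod_cast NeZero.pos q
  set V : ℝ := q * (T + 2) with hV
  set N := ⌈V⌉₊ with hN
  have hNV : V ≤ N := Nat.le_ceil V
  have hN1 : 1 ≤ N := by exact_mod_cast (by linarith : (1 : ℝ) ≤ N)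
  have hN0 : (0 : ℝ) < N := by linarith
  have hNε := natCeil_rpow_le (by linarith : 1 ≤ V) hε hε1
  have hsn := norm_le_add_abs_im (by linarith) hs2
  set a : ℕ → ℂ := fun n => (1 : DirichletCharacter ℂ q) (n : ZMod q) with ha
  have ha1 : ∀ n, ‖a n‖ ≤ 1 := fun n => (1 : DirichletCharacter ℂ q).norm_le_one _
  set m : ℂ := (∑ i ∈ range q, a i) / q with hm
  have hm1 : ‖m‖ ≤ 1 := by
    rw [hm, norm_div, Complex.norm_natCast, div_le_one (by linarith)]
    refine (norm_sum_le _ _).trans ((sum_le_sum fun i _ => ha1 i).trans ?_)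
    simp
  have hper : ∀ k n, ‖∑ i ∈ Ico k n, (a i - m)‖ ≤ q * 2 := by
    refine norm_sum_Ico_le_of_periodic (NeZero.pos q) (by simp [ha]) ?_ ?_
    · have : (q : ℂ) ≠ 0 := by exact_mod_cast NeZero.ne q
      rw [sum_sub_distrib, sum_const, card_range, nsmul_eq_mul, hm]
      field_simp
      simp
    · exact fun n => (norm_sub_le _ _).trans (by linarith [ha1 n])
  have h2 := norm_sum_Ico_mul_cpow_le_rpow ha1 hN1 (half_pos hε) (s := s) (by linarith)
  rw [show 2 * (ε / 2) = ε by ring, show 1 + 1 / (ε / 2) = 1 + 2 / ε by field_simp] at h2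
  have hVε : 1 ≤ V ^ ε := Real.one_le_rpow (by linarith) hε.le
  refine le_of_tendsto (tendsto_sum_Ico_LSeries
    ((1 : DirichletCharacter ℂ q).LSeriesSummable_of_one_lt_re hs)).norm ?_
  filter_upwards [Filter.eventually_ge_atTop N] with n hn
  rw [← sum_Ico_consecutive _ hN1 hn]
  have h3 : ∑ i ∈ Ico N n, a i * (i : ℂ) ^ (-s) = ∑ i ∈ Ico N n, (a i - m) * (i : ℂ) ^ (-s)
      + m * ∑ i ∈ Ico N n, (i : ℂ) ^ (-s) := by
    rw [mul_sum, ← sum_add_distrib]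
    exact sum_congr rfl fun i _ => by ring
  have h4 : ‖∑ i ∈ Ico N n, (a i - m) * (i : ℂ) ^ (-s)‖ ≤ 4 := by
    refine (norm_sum_Ico_mul_cpow_le hper (by linarith) hN1).trans ?_
    have e1 : ‖s‖ / s.re ≤ (2 + T) / 1 := by gcongr; linarith
    have e2 : (N : ℝ) ^ (-s.re) ≤ (N : ℝ)⁻¹ := by
      rw [← Real.rpow_neg_one]
      exact Real.rpow_le_rpow_of_exponent_le (by linarith) (by linarith)
    calc _ ≤ (q : ℝ) * 2 * (1 + (2 + T) / 1) * (N : ℝ)⁻¹ := by gcongr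
      _ ≤ 4 * N * (N : ℝ)⁻¹ := by
          refine mul_le_mul_of_nonneg_right ?_ (by positivity)
          have : (q : ℝ) * 2 * (1 + (2 + T) / 1) ≤ 4 * V := by
            rw [hV]
            nlinarith [mul_nonneg (by linarith : (0 : ℝ) ≤ q) hT0]
          linarith
      _ = 4 := by field_simp
  have h5 : ‖m * ∑ i ∈ Ico N n, (i : ℂ) ^ (-s)‖ ≤ 2 / ‖s - 1‖ + 1 := by
    rw [norm_mul]
    refine (mul_le_of_le_one_left (norm_nonneg _) hm1).trans
      ((norm_sum_Ico_cpow_le hs hN1 hn).trans ?_)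
    gcongr
    rw [div_le_one hN0]
    have : 2 + T ≤ V := by rw [hV]; nlinarith
    linarith
  rw [h3]
  calc _ ≤ (1 + 2 / ε) * (N : ℝ) ^ ε + (4 + (2 / ‖s - 1‖ + 1)) :=
        (norm_add_le _ _).trans (add_le_add h2 ((norm_add_le _ _).trans (add_le_add h4 h5)))
    _ ≤ (1 + 2 / ε) * (2 * V ^ ε) + 5 * V ^ ε + 2 / ‖s - 1‖ := by
        have : (1 + 2 / ε) * (N : ℝ) ^ ε ≤ (1 + 2 / ε) * (2 * V ^ ε) := by gcongr
        linarith
    _ ≤ _ := by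
        have e : (10 + 4 / ε) * V ^ ε = (1 + 2 / ε) * (2 * V ^ ε) + 8 * V ^ ε := by ring
        linarith

lemma norm_deriv_LFunction_le (hχ : χ ≠ 1) {ε : ℝ} (hε : 0 < ε) (hε1 : ε ≤ 1) {s : ℂ} {T : ℝ}
    (hT : |s.im| ≤ T) (hs : 1 - ε / 4 ≤ s.re) (hs2 : s.re ≤ 2) :
    ‖deriv χ.LFunction s‖ ≤ (80 / ε + 32 / ε ^ 2) * (q * (T + 2)) ^ ε := by
  have hT0 : 0 ≤ T := (abs_nonneg _).trans hT
  have hq : (1 : ℝ) ≤ q := by exact_mod_cast NeZero.pos q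
  have h := Complex.norm_deriv_le_of_forall_mem_sphere_norm_le (c := s) (R := ε / 4)
    (f := χ.LFunction) (C := (10 + 4 / ε) * (q * (T + 1 + 2)) ^ ε) (by linarith)
    (DirichletCharacter.differentiable_LFunction hχ).diffContOnCl ?_
  · refine h.trans ?_
    have h1 : ((q : ℝ) * (T + 1 + 2)) ^ ε ≤ 2 * (q * (T + 2)) ^ ε := by
      calc _ ≤ (2 * ((q : ℝ) * (T + 2))) ^ ε := by
            refine Real.rpow_le_rpow (by positivity) ?_ hε.le
            nlinarith [mul_nonneg (by linarith : (0 : ℝ) ≤ q) hT0]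
        _ = 2 ^ ε * (q * (T + 2)) ^ ε := Real.mul_rpow (by norm_num) (by positivity)
        _ ≤ 2 ^ (1 : ℝ) * (q * (T + 2)) ^ ε := by gcongr; norm_num
        _ = _ := by rw [Real.rpow_one]
    calc _ ≤ (10 + 4 / ε) * (2 * (q * (T + 2)) ^ ε) / (ε / 4) := by gcongr
      _ = _ := by field_simp; ring
  · intro z hz
    rw [mem_sphere_iff_norm] at hz
    have e1 := (abs_le.mp ((Complex.abs_re_le_norm (z - s)).trans hz.le))
    have e2 := (Complex.abs_im_le_norm (z - s)).trans hz.le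
    rw [Complex.sub_re] at e1
    rw [Complex.sub_im] at e2
    refine norm_LFunction_le hχ hε hε1 ?_ (by linarith) (by linarith)
    have := abs_sub_abs_le_abs_sub z.im s.im
    linarith

lemma norm_LFunction_sub_le (hχ : χ ≠ 1) {ε : ℝ} (hε : 0 < ε) (hε1 : ε ≤ 1) {z w : ℂ} {T : ℝ}
    (hz : |z.im| ≤ T) (hw : |w.im| ≤ T) (hz1 : 1 - ε / 4 ≤ z.re) (hz2 : z.re ≤ 2)
    (hw1 : 1 - ε / 4 ≤ w.re) (hw2 : w.re ≤ 2) :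
    ‖χ.LFunction z - χ.LFunction w‖
      ≤ (80 / ε + 32 / ε ^ 2) * (q * (T + 2)) ^ ε * ‖z - w‖ := by
  refine Convex.norm_image_sub_le_of_norm_deriv_le (s := Complex.re ⁻¹' Set.Icc (1 - ε / 4) 2
    ∩ Complex.im ⁻¹' Set.Icc (-T) T)
    (fun x _ => (DirichletCharacter.differentiable_LFunction hχ).differentiableAt) ?_ ?_ ?_ ?_
  · rintro x ⟨⟨h1, h2⟩, h3⟩
    exact norm_deriv_LFunction_le hχ hε hε1 (abs_le.mpr h3) h1 h2
  · exact ((convex_Icc _ _).linear_preimage Complex.reLm).inter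
      ((convex_Icc _ _).linear_preimage Complex.imLm)
  · exact ⟨⟨hw1, hw2⟩, abs_le.mp hw⟩
  · exact ⟨⟨hz1, hz2⟩, abs_le.mp hz⟩

end

lemma iteratedDeriv_sub_one_inv (k : ℕ) (z : ℂ) :
    iteratedDeriv k (fun z : ℂ => (z - 1)⁻¹) z = (-1) ^ k * k.factorial *
        (z - 1) ^ (-1 - k : ℤ) := by
  rw [congrFun (iteratedDeriv_comp_sub_const k (fun z : ℂ => z⁻¹) 1) z, iteratedDeriv_eq_iterate]
  exact iter_deriv_inv k (z - 1)

lemma exists_pow_le_half {M : ℝ} (hM : 1 ≤ M) {r : ℝ} (hr0 : 0 ≤ r) :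
    ∃ K : ℕ, 6 * M * (32 / 5) * (27 / 32 : ℝ) ^ K ≤ 1 / 2 ∧
      (1 + r) ^ K ≤ Real.exp (r * (7 * Real.log (77 * M) + 1)) := by
  have hL : 0 ≤ Real.log (77 * M) := Real.log_nonneg (by linarith)
  set K := ⌈7 * Real.log (77 * M)⌉₊ with hK
  have h1 : 7 * Real.log (77 * M) ≤ K := Nat.le_ceil _
  have h2 : (K : ℝ) < 7 * Real.log (77 * M) + 1 := Nat.ceil_lt_add_one (by linarith)
  refine ⟨K, ?_, ?_⟩
  · have h3 : (27 / 32 : ℝ) ≤ Real.exp (-(5 / 32)) := by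
      have := Real.add_one_le_exp (-(5 / 32) : ℝ)
      linarith
    have h4 : (27 / 32 : ℝ) ^ K ≤ (77 * M)⁻¹ := by
      calc (27 / 32 : ℝ) ^ K ≤ Real.exp (-(5 / 32)) ^ K := by gcongr
        _ = Real.exp (K * (-(5 / 32))) := by rw [← Real.exp_nat_mul]
        _ ≤ Real.exp (-Real.log (77 * M)) := by
            rw [Real.exp_le_exp]
            linarith
        _ = _ := by rw [Real.exp_neg, Real.exp_log (by linarith)]
    calc _ ≤ 6 * M * (32 / 5) * (77 * M)⁻¹ := by gcongr
      _ = 6 * (32 / 5) / 77 := by field_simp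
      _ ≤ _ := by norm_num
  · calc (1 + r) ^ K ≤ Real.exp r ^ K := by
          gcongr
          linarith [Real.add_one_le_exp r]
      _ = Real.exp (r * K) := by rw [← Real.exp_nat_mul, mul_comm]
      _ ≤ _ := by gcongr

open ComplexOrder in
/-- Estermann's lower bound for the residue of a Dirichlet series with nonnegative coefficients. -/
lemma le_re_apply_one_of_LSeries {H : ℂ → ℂ} (hH : Differentiable ℂ H) {a : ℕ → ℂ} (ha : 0 ≤ a)
    (ha1 : 1 ≤ a 1) (habs : LSeries.abscissaOfAbsConv a ≤ 1)
    (hL : ∀ s : ℂ, 1 < s.re → H s = (s - 1) * LSeries a s) {M : ℝ} (hM : 1 ≤ M)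
    (hHM : ∀ z ∈ Metric.closedBall (2 : ℂ) (4 / 3), ‖H z‖ ≤ M) {β : ℝ} (hβ : 7 / 8 ≤ β)
    (hβ1 : β < 1) (hHβ : 0 ≤ (H β).re) :
    (1 - β) / 2 * Real.exp (-((1 - β) * (7 * Real.log (77 * M) + 1))) ≤ (H 1).re := by
  set f := dslope H 1 with hf
  set l := (H 1).re with hl
  have hfd : Differentiable ℂ f := by
    rw [← differentiableOn_univ, hf, Complex.differentiableOn_dslope Filter.univ_mem]
    exact hH.differentiableOn
  have hfne : ∀ z : ℂ, z ≠ 1 → f z = (z - 1)⁻¹ * (H z - H 1) := by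
    intro z hz
    rw [hf, dslope_of_ne _ hz, slope_def_field, div_eq_inv_mul]
  have hre : ∀ᶠ z : ℂ in nhds 2, 1 < z.re :=
    (isOpen_lt continuous_const Complex.continuous_re).mem_nhds (by simp)
  have habs2 : LSeries.abscissaOfAbsConv a < ((2 : ℝ) : EReal) :=
    habs.trans_lt (by exact_mod_cast (by norm_num : (1 : ℝ) < 2))
  have hsum2 : LSeriesSummable a 2 := LSeriesSummable_of_abscissaOfAbsConv_lt_re
      (by simpa using habs2)
  have hder : ∀ k : ℕ, iteratedDeriv k f 2
      = iteratedDeriv k (LSeries a) 2 - H 1 * ((-1) ^ k * k.factorial) := by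
    intro k
    have h1 : f =ᶠ[nhds 2] fun z => LSeries a z - H 1 * (z - 1)⁻¹ := by
      filter_upwards [hre] with z hz
      have hz1 : z - 1 ≠ 0 := by
        intro h
        rw [sub_eq_zero] at h
        rw [h] at hz
        simp at hz
      rw [hfne z (sub_ne_zero.mp hz1), hL z hz]
      field_simp
    have h2 : ContDiffAt ℂ k (LSeries a) 2 :=
      (LSeries_analyticOnNhd a 2 (by simpa using habs2)).contDiffAt
    have h3 : ContDiffAt ℂ k (fun z : ℂ => (z - 1)⁻¹) 2 :=
      (contDiffAt_id.sub contDiffAt_const).inv (by norm_num)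
    rw [h1.iteratedDeriv_eq k, iteratedDeriv_fun_sub h2 (contDiffAt_const.mul h3),
      iteratedDeriv_const_mul_field, iteratedDeriv_sub_one_inv]
    norm_num
  have hH1 : ‖H 1‖ ≤ M := hHM 1 (by
    rw [Metric.mem_closedBall, dist_eq_norm]; norm_num)
  have hfM : ∀ z ∈ Metric.sphere (2 : ℂ) (4 / 3), ‖f z‖ ≤ 6 * M := by
    intro z hz
    have hz' : ‖z - 2‖ = 4 / 3 := by simpa [dist_eq_norm] using hz
    have h1 : 1 / 3 ≤ ‖z - 1‖ := by
      have h2 := norm_sub_norm_le (z - 2) (-1)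
      rw [show z - 2 - -1 = z - 1 by ring, hz'] at h2
      norm_num at h2
      linarith
    have hz1 : z ≠ 1 := by
      rintro rfl
      norm_num at h1
    rw [hfne z hz1, norm_mul, norm_inv]
    calc _ ≤ (1 / 3)⁻¹ * (M + M) := by
          gcongr
          exact (norm_sub_le _ _).trans (add_le_add (hHM z (Metric.sphere_subset_closedBall hz))
              hH1)
      _ = _ := by ring
  set u : ℕ → ℝ := fun k => ((k.factorial : ℂ)⁻¹ • ((β : ℂ) - 2) ^ k • iteratedDeriv k f 2).re
      with hu
  have hsum : HasSum u (f β).re := by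
    exact Complex.hasSum_re (Complex.hasSum_taylorSeries_of_entire hfd 2 β)
  have hub : ∀ k, |u k| ≤ 6 * M * (27 / 32) ^ k := by
    intro k
    refine (Complex.abs_re_le_norm _).trans ?_
    have h1 := Complex.norm_iteratedDeriv_le_of_forall_mem_sphere_norm_le k
      (by norm_num : (0 : ℝ) < 4 / 3) hfd.diffContOnCl hfM
    have hb : ‖(β : ℂ) - 2‖ ≤ 9 / 8 := by
      rw [← Complex.ofReal_ofNat, ← Complex.ofReal_sub, Complex.norm_real, Real.norm_eq_abs, abs_le]
      constructor <;> linarith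
    have hk : (0 : ℝ) < k.factorial := by exact_mod_cast k.factorial_pos
    rw [norm_smul, norm_smul, norm_inv, norm_pow, Complex.norm_natCast]
    calc _ ≤ (k.factorial : ℝ)⁻¹ *
          ((9 / 8) ^ k * (k.factorial * (6 * M) / (4 / 3) ^ k)) := by gcongr
      _ = 6 * M * ((9 / 8) ^ k / (4 / 3) ^ k) := by field_simp
      _ = _ := by rw [← div_pow]; norm_num
  have hulow : ∀ k, -(l * (2 - β) ^ k) + (if k = 0 then 1 else 0) ≤ u k := by
    intro k
    have hk : (0 : ℝ) < k.factorial := by exact_mod_cast k.factorial_pos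
    have h1 : u k = (2 - β) ^ k / k.factorial * ((-1) ^ k * iteratedDeriv k (LSeries a) 2).re
        - l * (2 - β) ^ k := by
      have e1 : ((k.factorial : ℂ)⁻¹ • ((β : ℂ) - 2) ^ k • iteratedDeriv k f 2)
          = (((2 - β) ^ k / k.factorial : ℝ) : ℂ) * ((-1) ^ k * iteratedDeriv k (LSeries a) 2)
            - H 1 * (((2 - β) ^ k : ℝ) : ℂ) := by
        have hk' : (k.factorial : ℂ) ≠ 0 := by exact_mod_cast k.factorial_ne_zero
        rw [hder, show (β : ℂ) - 2 = (-1) * (2 - β) by ring, mul_pow]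
        push_cast
        simp only [smul_eq_mul]
        field_simp
        have hone : (-1 : ℂ) ^ k * (-1) ^ k = 1 := by rw [← mul_pow]; simp
        linear_combination (-(2 - (β : ℂ)) ^ k * k.factorial * H 1) * hone
      rw [hu]
      simp only
      rw [e1, Complex.sub_re, Complex.re_ofReal_mul, Complex.re_mul_ofReal]
    rw [h1]
    have h2 := (Complex.nonneg_iff.mp (LSeries.iteratedDeriv_alternating ha habs2 k)).1
    rw [Complex.ofReal_ofNat] at h2
    have hb0 : 0 ≤ 2 - β := by linarith
    by_cases hk0 : k = 0
    · subst hk0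
      have h3 : 1 ≤ (LSeries a 2).re := by
        have h4 : ∀ n, 0 ≤ (LSeries.term a 2 n).re := by
          intro n
          exact (Complex.nonneg_iff.mp (LSeries.term_nonneg (ha n) 2)).1
        have h5 := (Complex.hasSum_re hsum2.hasSum)
        have h6 := le_hasSum h5 1 (fun n _ => h4 n)
        rw [LSeries.term_of_ne_zero one_ne_zero] at h6
        have h7 := (Complex.le_def.mp ha1).1
        simp at h6 h7
        exact h7.trans h6
      simp
      linarith
    · simp only [hk0, if_false]
      have : 0 ≤ (2 - β) ^ k / k.factorial * ((-1) ^ k * iteratedDeriv k (LSeries a) 2).re := by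
        positivity
      linarith
  obtain ⟨K, hK1, hK2⟩ := exists_pow_le_half hM (r := 1 - β) (by linarith)
  have hgeo : HasSum (fun k : ℕ => 6 * M * (27 / 32 : ℝ) ^ (k + K))
      (6 * M * (32 / 5) * (27 / 32) ^ K) := by
    have := (hasSum_geometric_of_lt_one (r := (27 / 32 : ℝ)) (by norm_num) (by norm_num)).mul_left
      (6 * M * (27 / 32 : ℝ) ^ K)
    rw [show (1 - 27 / 32 : ℝ)⁻¹ = 32 / 5 by norm_num] at this
    rw [show 6 * M * (27 / 32) ^ K * (32 / 5) = 6 * M * (32 / 5) * (27 / 32) ^ K by ring] at this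
    refine HasSum.congr_fun this fun k => ?_
    rw [pow_add]
    ring
  have htail : -(1 / 2) ≤ (f β).re - ∑ k ∈ range K, u k := by
    have h1 := (hasSum_nat_add_iff' K).mpr hsum
    have h2 := h1.norm_le_of_bounded hgeo (fun k => by simpa using hub (k + K))
    rw [Real.norm_eq_abs] at h2
    linarith [(abs_le.mp h2).1]
  have hhead : 1 - l * (((2 - β) ^ K - 1) / (1 - β)) ≤ ∑ k ∈ range K, u k := by
    have hKpos : 0 < K := by
      rcases Nat.eq_zero_or_pos K with h | h
      · rw [h, pow_zero] at hK1
        linarith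
      · exact h
    calc _ = ∑ k ∈ range K, (-(l * (2 - β) ^ k) + (if k = 0 then 1 else 0)) := by
          rw [sum_add_distrib, sum_neg_distrib, ← mul_sum, geom_sum_eq (by linarith)]
          simp [hKpos]
          ring
      _ ≤ _ := sum_le_sum fun k _ => hulow k
  have hfβ : (f β).re ≤ l / (1 - β) := by
    have e1 : f β = (((β - 1)⁻¹ : ℝ) : ℂ) * (H β - H 1) := by
      rw [hfne β (by exact_mod_cast hβ1.ne)]
      push_cast
      rfl
    rw [e1, Complex.re_ofReal_mul, Complex.sub_re, ← hl, div_eq_inv_mul,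
      show (β - 1)⁻¹ = -(1 - β)⁻¹ by rw [← inv_neg, neg_sub]]
    have : 0 < (1 - β)⁻¹ := inv_pos.mpr (by linarith)
    nlinarith
  have hb : 0 < 1 - β := by linarith
  have hmain : 1 / 2 ≤ l * (2 - β) ^ K / (1 - β) := by
    have : l * (((2 - β) ^ K - 1) / (1 - β)) = l * (2 - β) ^ K / (1 - β) - l / (1 - β) := by
      field_simp
    linarith
  rw [le_div_iff₀ hb] at hmain
  rw [show 1 + (1 - β) = 2 - β by ring] at hK2
  have hE := Real.exp_pos ((1 - β) * (7 * Real.log (77 * M) + 1))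
  rw [Real.exp_neg, ← div_eq_mul_inv, div_le_iff₀ hE]
  have hl0 : 0 ≤ l := by
    by_contra hneg
    push Not at hneg
    have : 0 < (2 - β) ^ K := pow_pos (by linarith) K
    nlinarith
  calc (1 - β) / 2 ≤ l * (2 - β) ^ K := by linarith
    _ ≤ _ := by gcongr

lemma ArithmeticFunction.mul_apply_prime_pow (f g : ArithmeticFunction ℂ) {p : ℕ} (hp : p.Prime)
    (k : ℕ) : (f * g) (p ^ k) = ∑ i ∈ range (k + 1), f (p ^ i) * g (p ^ (k - i)) := by
  rw [ArithmeticFunction.mul_apply,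
    Nat.sum_divisorsAntidiagonal (fun a b => f a * g b), Nat.sum_divisors_prime_pow hp]
  refine sum_congr rfl fun i hi => ?_
  rw [mem_range] at hi
  rw [Nat.pow_div (by omega) hp.pos]

section
open ComplexOrder

lemma zeta_mul_prime_pow {f : ArithmeticFunction ℂ} {p : ℕ} (hp : p.Prime) {x : ℂ}
    (hf : ∀ k, f (p ^ k) = x ^ k) (k : ℕ) :
    ((ArithmeticFunction.zeta : ArithmeticFunction ℂ) * f) (p ^ k) = ∑ u ∈ range (k + 1),
        x ^ u := by
  rw [ArithmeticFunction.coe_zeta_mul_apply, Nat.sum_divisors_prime_pow hp]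
  simp only [hf]

lemma zeta_mul_prime_pow_nonneg {f : ArithmeticFunction ℂ} {p : ℕ} (hp : p.Prime) {x : ℂ}
    (hf : ∀ k, f (p ^ k) = x ^ k) (hx : x = 0 ∨ x = 1 ∨ x = -1) (k : ℕ) :
    0 ≤ ((ArithmeticFunction.zeta : ArithmeticFunction ℂ) * f) (p ^ k) := by
  rw [zeta_mul_prime_pow hp hf]
  rcases hx with rfl | rfl | rfl
  · exact sum_nonneg fun i _ => pow_nonneg le_rfl i
  · exact sum_nonneg fun i _ => by simp
  · rw [neg_one_geom_sum]
    split_ifs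
    exacts [le_rfl, zero_le_one]

lemma mul_prime_pow_eq_pow_mul {f g h : ArithmeticFunction ℂ} {p : ℕ} (hp : p.Prime) {x y : ℂ}
    (hf : ∀ k, f (p ^ k) = x ^ k) (hg : ∀ k, g (p ^ k) = y ^ k)
    (hh : ∀ k, h (p ^ k) = (x * y) ^ k) (k : ℕ) :
    (g * h) (p ^ k) = y ^ k * ((ArithmeticFunction.zeta : ArithmeticFunction ℂ) * f) (p ^ k) := by
  rw [zeta_mul_prime_pow hp hf, ArithmeticFunction.mul_apply_prime_pow _ _ hp,
    ← sum_range_reflect, mul_sum]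
  refine sum_congr rfl fun i hi => ?_
  rw [mem_range] at hi
  rw [hg, hh, show k + 1 - 1 - i = k - i by omega, show k - (k - i) = i by omega, mul_pow,
    ← mul_assoc, mul_comm (y ^ (k - i)), mul_assoc, ← pow_add, show k - i + i = k by omega,
        mul_comm]

lemma zeta_mul_mul_mul_prime_pow_nonneg {f g h : ArithmeticFunction ℂ} {p : ℕ} (hp : p.Prime)
    {x y : ℂ} (hf : ∀ k, f (p ^ k) = x ^ k) (hg : ∀ k, g (p ^ k) = y ^ k)
    (hh : ∀ k, h (p ^ k) = (x * y) ^ k) (hx : x = 0 ∨ x = 1 ∨ x = -1) (hy : y = 0 ∨ y = 1 ∨ y = -1)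
    (k : ℕ) :
    0 ≤ (((ArithmeticFunction.zeta : ArithmeticFunction ℂ) * f) * (g * h)) (p ^ k) := by
  have main : ∀ {f g : ArithmeticFunction ℂ} {x y : ℂ}, (∀ k, f (p ^ k) = x ^ k) →
      (∀ k, g (p ^ k) = y ^ k) → (∀ k, h (p ^ k) = (x * y) ^ k) → (x = 0 ∨ x = 1 ∨ x = -1) →
      0 ≤ y → 0 ≤ (((ArithmeticFunction.zeta : ArithmeticFunction ℂ) * f) * (g * h)) (p ^ k) := by
    intro f g x y hf hg hh hx hy
    rw [ArithmeticFunction.mul_apply_prime_pow _ _ hp]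
    refine sum_nonneg fun i _ => mul_nonneg (zeta_mul_prime_pow_nonneg hp hf hx i) ?_
    rw [mul_prime_pow_eq_pow_mul hp hf hg hh]
    exact mul_nonneg (pow_nonneg hy _) (zeta_mul_prime_pow_nonneg hp hf hx _)
  have hswap : ((ArithmeticFunction.zeta : ArithmeticFunction ℂ) * f) * (g * h)
      = ((ArithmeticFunction.zeta : ArithmeticFunction ℂ) * g) * (f * h) := by ring
  rcases hy with hy0 | hy0 | hy0
  · exact main hf hg hh hx hy0.ge
  · exact main hf hg hh hx (hy0 ▸ zero_le_one)
  rcases hx with hx0 | hx0 | hx0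
  · rw [hswap]
    exact main hg hf (by simpa only [mul_comm] using hh) (Or.inr (Or.inr hy0)) hx0.ge
  · rw [hswap]
    exact main hg hf (by simpa only [mul_comm] using hh) (Or.inr (Or.inr hy0)) (hx0 ▸ zero_le_one)
  · rw [ArithmeticFunction.mul_apply_prime_pow _ _ hp]
    refine sum_nonneg fun i _ => mul_nonneg
      (zeta_mul_prime_pow_nonneg hp hf (Or.inr (Or.inr hx0)) i) ?_
    rw [mul_prime_pow_eq_pow_mul hp hf hg hh, zeta_mul_prime_pow hp hf, hx0, hy0, neg_one_geom_sum]
    split_ifs with hev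
    · simp
    · rw [Nat.not_even_iff_odd, Nat.odd_add_one, Nat.not_odd_iff_even] at hev
      simp [hev.neg_one_pow]

lemma ArithmeticFunction.IsMultiplicative.nonneg_of_prime_pow {f : ArithmeticFunction ℂ}
    (hf : f.IsMultiplicative) (h : ∀ p : ℕ, p.Prime → ∀ k, 0 ≤ f (p ^ k)) (n : ℕ) : 0 ≤ f n := by
  rcases eq_or_ne n 0 with rfl | hn
  · simp
  · rw [hf.multiplicative_factorization _ hn]
    exact Finset.prod_nonneg fun p hp => h p (Nat.prime_of_mem_primeFactors hp) _

end

lemma DirichletCharacter.toArithmeticFunction_prime_pow {q : ℕ} (χ : DirichletCharacter ℂ q)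
    {p : ℕ} (hp : p.Prime) (k : ℕ) :
    toArithmeticFunction (fun n : ℕ => χ (n : ZMod q)) (p ^ k) = χ (p : ZMod q) ^ k := by
  rw [← DirichletCharacter.apply_eq_toArithmeticFunction_apply χ (pow_ne_zero k hp.ne_zero)]
  simp

lemma DirichletCharacter.LSeries_toArithmeticFunction {q : ℕ} (χ : DirichletCharacter ℂ q) {s : ℂ}
    (hs : 1 < s.re) :
    LSeriesSummable (fun n => toArithmeticFunction (fun n : ℕ => χ (n : ZMod q)) n) s ∧
    LSeries (fun n => toArithmeticFunction (fun n : ℕ => χ (n : ZMod q)) n) s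
      = LSeries (fun n : ℕ => χ (n : ZMod q)) s := by
  have h : ∀ {n : ℕ}, n ≠ 0 → toArithmeticFunction (fun n : ℕ => χ (n : ZMod q)) n
      = χ (n : ZMod q) := fun hn => (χ.apply_eq_toArithmeticFunction_apply hn).symm
  exact ⟨(LSeriesSummable_congr s h).mpr (χ.LSeriesSummable_of_one_lt_re hs), LSeries_congr h s⟩

/-- The product of two characters of possibly different moduli. -/
noncomputable def DirichletCharacter.mulLevel {q r : ℕ} (χ : DirichletCharacter ℂ q)
    (ψ : DirichletCharacter ℂ r) : DirichletCharacter ℂ (q * r) :=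
  changeLevel (dvd_mul_right q r) χ * changeLevel (dvd_mul_left r q) ψ

lemma DirichletCharacter.mulLevel_apply {q r : ℕ} (χ : DirichletCharacter ℂ q)
    (ψ : DirichletCharacter ℂ r) (n : ℕ) :
    χ.mulLevel ψ (n : ZMod (q * r)) = χ (n : ZMod q) * ψ (n : ZMod r) := by
  by_cases h : n.Coprime (q * r)
  · obtain ⟨u, hu⟩ := (ZMod.isUnit_iff_coprime n (q * r)).mpr h
    rw [mulLevel, MulChar.mul_apply, ← hu, changeLevel_eq_cast_of_dvd, changeLevel_eq_cast_of_dvd,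
      hu, ZMod.cast_natCast (dvd_mul_right q r), ZMod.cast_natCast (dvd_mul_left r q)]
  · rw [MulChar.map_nonunit _ (by rwa [ZMod.isUnit_iff_coprime])]
    rw [Nat.coprime_mul_iff_right, not_and_or] at h
    rcases h with h | h
    · rw [MulChar.map_nonunit χ (by rwa [ZMod.isUnit_iff_coprime]), zero_mul]
    · rw [MulChar.map_nonunit ψ (by rwa [ZMod.isUnit_iff_coprime]), mul_zero]

lemma DirichletCharacter.mulLevel_ne_one {q r : ℕ} [NeZero q] [NeZero r]
    {χ : DirichletCharacter ℂ q} {ψ : DirichletCharacter ℂ r} (hχ : χ.IsPrimitive)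
    (hψ : ψ.IsPrimitive) (hψ2 : ψ ^ 2 = 1) (hqr : q ≠ r) : χ.mulLevel ψ ≠ 1 := by
  intro h
  have : NeZero (q * r) := ⟨mul_ne_zero (NeZero.ne q) (NeZero.ne r)⟩
  have h1 : changeLevel (dvd_mul_right q r) χ = changeLevel (dvd_mul_left r q) ψ := by
    have h2 : changeLevel (dvd_mul_left r q) ψ * changeLevel (dvd_mul_left r q) ψ = 1 := by
      rw [← map_mul, ← sq, hψ2, map_one]
    calc _ = changeLevel (dvd_mul_right q r) χ *
          (changeLevel (dvd_mul_left r q) ψ * changeLevel (dvd_mul_left r q) ψ) := by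
          rw [h2, mul_one]
      _ = χ.mulLevel ψ * changeLevel (dvd_mul_left r q) ψ := by rw [mulLevel, mul_assoc]
      _ = _ := by rw [h, one_mul]
  have h3 := conductor_changeLevel χ (dvd_mul_right q r)
  rw [h1, conductor_changeLevel ψ (dvd_mul_left r q), hψ, hχ] at h3
  exact hqr h3.symm

/-- The function `(s - 1) ζ(s)`, as an entire function. -/
lemma exists_entire_zeta : ∃ Z : ℂ → ℂ, Differentiable ℂ Z ∧ Z 1 = 1 ∧ ∀ s : ℂ, 1 < s.re →
    Z s = (s - 1) * LSeries (fun n => (ArithmeticFunction.zeta : ArithmeticFunction ℂ) n) s := by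
  refine ⟨DirichletCharacter.LFunctionTrivChar₁ 1,
    DirichletCharacter.differentiable_LFunctionTrivChar₁ 1, ?_, ?_⟩
  · rw [DirichletCharacter.LFunctionTrivChar₁, Function.update_self]
    simp
  · intro s hs
    have hs1 : s ≠ 1 := by rintro rfl; simp at hs
    rw [DirichletCharacter.LFunctionTrivChar₁, Function.update_of_ne hs1,
      DirichletCharacter.LFunctionTrivChar, DirichletCharacter.LFunction_modOne_eq,
      ← ArithmeticFunction.LSeries_zeta_eq_riemannZeta hs]
    simp only [ArithmeticFunction.natCoe_apply]

lemma eq_zero_or_one_or_neg_one {q : ℕ} {χ : DirichletCharacter ℂ q}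
    (hχ2 : χ ^ 2 = 1) (a : ZMod q) : χ a = 0 ∨ χ a = 1 ∨ χ a = -1 :=
  MulChar.isQuadratic_iff_sq_eq_one.mpr hχ2 a

section
variable {q : ℕ} [NeZero q] {χ : DirichletCharacter ℂ q}

lemma norm_LFunction_le_of_mem_closedBall (hχ : χ ≠ 1) {z : ℂ}
    (hz : z ∈ Metric.closedBall (2 : ℂ) (4 / 3)) : ‖χ.LFunction z‖ ≤ 6 * q := by
  rw [mem_closedBall_iff_norm] at hz
  have h1 := (abs_le.mp ((Complex.abs_re_le_norm (z - 2)).trans hz)).1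
  rw [Complex.sub_re, Complex.re_ofNat] at h1
  have h2 : ‖z‖ ≤ 10 / 3 := by
    have := norm_le_norm_add_norm_sub' z 2
    norm_num at this
    linarith
  have h3 : 2 / 3 ≤ z.re := by linarith
  have h := (tendsto_sum_Ico_LFunction_and_norm_sub_le hχ (by linarith : 0 < z.re)).2 1 le_rfl
  rw [Ico_self, sum_empty, sub_zero, Nat.cast_one, Real.one_rpow, mul_one] at h
  refine h.trans ?_
  rw [mul_comm (6 : ℝ)]
  refine mul_le_mul_of_nonneg_left ?_ (by positivity)
  have : ‖z‖ / z.re ≤ (10 / 3) / (2 / 3) := by gcongr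
  linarith

lemma im_LFunction_ofReal (hχ : χ ≠ 1) (hχ2 : χ ^ 2 = 1) {β : ℝ} (hβ : 0 < β) :
    (χ.LFunction β).im = 0 := by
  have h := (tendsto_sum_Ico_LFunction_and_norm_sub_le hχ
    (by simpa using hβ : 0 < ((β : ℂ)).re)).1
  have h2 := (Complex.continuous_im.tendsto _).comp h
  refine tendsto_nhds_unique h2 ?_
  refine tendsto_const_nhds.congr fun n => ?_
  simp only [Function.comp]
  rw [Complex.im_sum]
  refine (sum_eq_zero fun i _ => ?_).symm
  have e1 : (i : ℂ) ^ (-(β : ℂ)) = (((i : ℝ) ^ (-β) : ℝ) : ℂ) := by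
    rw [Complex.ofReal_cpow (by positivity)]
    push_cast
    rfl
  rw [e1, Complex.im_mul_ofReal]
  rcases eq_zero_or_one_or_neg_one hχ2 (i : ZMod q) with h | h | h <;> simp [h]

lemma re_LFunction_nonneg_of_ne_zero (hχ : χ ≠ 1) (hχ2 : χ ^ 2 = 1) {b : ℝ} (hb : 0 < b)
    (hne : ∀ β : ℝ, b ≤ β → β < 1 → χ.LFunction β ≠ 0) : 0 ≤ (χ.LFunction b).re := by
  by_contra hneg
  push Not at hneg
  have hlim : Filter.Tendsto (fun x : ℝ => LSeries (fun n : ℕ => χ (n : ZMod q)) x) Filter.atTop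
      (nhds 1) := by
    have := LSeries.tendsto_atTop (f := fun n : ℕ => χ (n : ZMod q))
      ((LSeries.abscissaOfAbsConv_le_of_forall_lt_LSeriesSummable (x := 1) fun y hy =>
        χ.LSeriesSummable_of_one_lt_re (by simpa using hy)).trans_lt (EReal.coe_lt_top 1))
    simpa using this
  have hlim2 := (Complex.continuous_re.tendsto _).comp hlim
  obtain ⟨x, hx1, hx2, hx3⟩ := ((hlim2.eventually (lt_mem_nhds
      (by simp : (0 : ℝ) < (1 : ℂ).re))).and
    ((Filter.eventually_gt_atTop 1).and (Filter.eventually_ge_atTop b))).exists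
  simp only [Function.comp] at hx1
  rw [← χ.LFunction_eq_LSeries (by simpa using hx2)] at hx1
  have hcont : Continuous fun y : ℝ => (χ.LFunction y).re :=
    Complex.continuous_re.comp
      ((DirichletCharacter.differentiable_LFunction hχ).continuous.comp Complex.continuous_ofReal)
  obtain ⟨y, hy, hy0⟩ := intermediate_value_Icc hx3 hcont.continuousOn ⟨hneg.le, hx1.le⟩
  have hy00 : χ.LFunction y = 0 :=
    Complex.ext hy0 (im_LFunction_ofReal hχ hχ2 (hb.trans_le hy.1))
  rcases lt_or_ge y 1 with h | h
  · exact hne y hy.1 h hy00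
  · exact DirichletCharacter.LFunction_ne_zero_of_one_le_re χ (Or.inl hχ) (by simpa using h) hy00

end

lemma exp_neg_mul_log_eq {E r : ℝ} (hE : 0 < E) {q : ℕ} [NeZero q] :
    Real.exp (-(r * (7 * Real.log (77 * (E * (q : ℝ) ^ 2)) + 1)))
      = Real.exp (-(r * (7 * Real.log (77 * E) + 1))) * (q : ℝ) ^ (-(14 * r)) := by
  have hq : (0 : ℝ) < q := by exact_mod_cast NeZero.pos q
  rw [← mul_assoc, Real.log_mul (by positivity) (by positivity), Real.log_pow,
    Real.rpow_def_of_pos hq, ← Real.exp_add]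
  congr 1
  push_cast
  ring

open ComplexOrder in
lemma le_norm_LFunction_one_of_re_nonneg {Z : ℂ → ℂ} (hZ : Differentiable ℂ Z) (hZ1 : Z 1 = 1)
    (hZL : ∀ s : ℂ, 1 < s.re →
      Z s = (s - 1) * LSeries (fun n => (ArithmeticFunction.zeta : ArithmeticFunction ℂ) n) s)
    {D : ℝ} (hD : 1 ≤ D) (hZD : ∀ z ∈ Metric.closedBall (2 : ℂ) (4 / 3), ‖Z z‖ ≤ D)
    {q : ℕ} [NeZero q] {χ : DirichletCharacter ℂ q} (hχ : χ ≠ 1) (hχ2 : χ ^ 2 = 1) {β : ℝ}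
    (hβ : 7 / 8 ≤ β) (hβ1 : β < 1) (hpos : 0 ≤ (Z β * χ.LFunction β).re) :
    (1 - β) / 2 * Real.exp (-((1 - β) * (7 * Real.log (77 * (6 * D)) + 1)))
      * (q : ℝ) ^ (-(14 * (1 - β))) ≤ ‖χ.LFunction 1‖ := by
  have hq : (1 : ℝ) ≤ q := by exact_mod_cast NeZero.pos q
  have hM : 1 ≤ 6 * D * (q : ℝ) ^ 2 := one_le_mul_of_one_le_of_one_le (by linarith) (one_le_pow₀ hq)
  have hsum : ∀ s : ℂ, 1 < s.re → LSeriesSummable (fun n => χ.zetaMul n) s := fun s hs =>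
    χ.LSeriesSummable_zetaMul hs
  have h := le_re_apply_one_of_LSeries (H := fun s => Z s * χ.LFunction s)
    (a := fun n => χ.zetaMul n) (hZ.mul (DirichletCharacter.differentiable_LFunction hχ))
    (fun n => DirichletCharacter.zetaMul_nonneg hχ2 n)
    (by rw [χ.isMultiplicative_zetaMul.map_one])
    (LSeries.abscissaOfAbsConv_le_of_forall_lt_LSeriesSummable (x := 1) fun y hy =>
      hsum y (by simpa using hy)) ?_ hM ?_ hβ hβ1 hpos
  · rw [exp_neg_mul_log_eq (by linarith), ← mul_assoc] at h
    refine h.trans ((Complex.re_le_norm _).trans ?_)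
    rw [hZ1, one_mul]
  · intro s hs
    obtain ⟨h1, h2⟩ := χ.LSeries_toArithmeticFunction hs
    have hz1 : LSeriesSummable
        (fun n => (ArithmeticFunction.zeta : ArithmeticFunction ℂ) n) s :=
      ArithmeticFunction.LSeriesSummable_zeta_iff.mpr hs
    have h3 := ArithmeticFunction.LSeries_mul' hz1 h1
    rw [hZL s hs, χ.LFunction_eq_LSeries hs, ← h2, mul_assoc, ← h3]
    rfl
  · intro z hz
    rw [norm_mul]
    calc _ ≤ D * (6 * q) := mul_le_mul (hZD z hz) (norm_LFunction_le_of_mem_closedBall hχ hz)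
          (norm_nonneg _) (by linarith)
      _ ≤ _ := by nlinarith [mul_le_mul_of_nonneg_left hq (by positivity : (0 : ℝ) ≤ D * q)]

open ComplexOrder in
lemma le_norm_LFunction_one_of_zero {Z : ℂ → ℂ} (hZ : Differentiable ℂ Z) (hZ1 : Z 1 = 1)
    (hZL : ∀ s : ℂ, 1 < s.re →
      Z s = (s - 1) * LSeries (fun n => (ArithmeticFunction.zeta : ArithmeticFunction ℂ) n) s)
    {D : ℝ} (hD : 1 ≤ D) (hZD : ∀ z ∈ Metric.closedBall (2 : ℂ) (4 / 3), ‖Z z‖ ≤ D)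
    {r : ℕ} [NeZero r] {ψ : DirichletCharacter ℂ r} (hψ : ψ ≠ 1) (hψ2 : ψ ^ 2 = 1) {β : ℝ}
    (hβ : 7 / 8 ≤ β) (hβ1 : β < 1) (h0 : ψ.LFunction β = 0)
    {q : ℕ} [NeZero q] {χ : DirichletCharacter ℂ q} (hχ : χ ≠ 1) (hχ2 : χ ^ 2 = 1)
    (hne : ψ.mulLevel χ ≠ 1) :
    have : NeZero (r * q) := ⟨mul_ne_zero (NeZero.ne r) (NeZero.ne q)⟩
    (1 - β) / 2 * Real.exp (-((1 - β) * (7 * Real.log (77 * (216 * D * r ^ 2)) + 1)))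
      * (q : ℝ) ^ (-(14 * (1 - β)))
      ≤ ‖ψ.LFunction 1‖ * ‖χ.LFunction 1‖ * ‖(ψ.mulLevel χ).LFunction 1‖ := by
  have : NeZero (r * q) := ⟨mul_ne_zero (NeZero.ne r) (NeZero.ne q)⟩
  have hq : (1 : ℝ) ≤ q := by exact_mod_cast NeZero.pos q
  have hr : (1 : ℝ) ≤ r := by exact_mod_cast NeZero.pos r
  have hr2 : (1 : ℝ) ≤ (r : ℝ) ^ 2 := one_le_pow₀ hr
  have hE : 1 ≤ 216 * D * (r : ℝ) ^ 2 := one_le_mul_of_one_le_of_one_le (by linarith) hr2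
  have hM : 1 ≤ 216 * D * (r : ℝ) ^ 2 * (q : ℝ) ^ 2 :=
    one_le_mul_of_one_le_of_one_le hE (one_le_pow₀ hq)
  set F := toArithmeticFunction (fun n : ℕ => ψ (n : ZMod r)) with hF
  set G := toArithmeticFunction (fun n : ℕ => χ (n : ZMod q)) with hG
  set P := toArithmeticFunction (fun n : ℕ => ψ.mulLevel χ (n : ZMod (r * q))) with hP
  set z : ArithmeticFunction ℂ := (ArithmeticFunction.zeta : ArithmeticFunction ℂ) with hz
  have hmul : ((z * F) * (G * P)).IsMultiplicative :=
    (ArithmeticFunction.isMultiplicative_zeta.natCast.mul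
      ψ.isMultiplicative_toArithmeticFunction).mul
      (χ.isMultiplicative_toArithmeticFunction.mul
        (ψ.mulLevel χ).isMultiplicative_toArithmeticFunction)
  have hser : ∀ s : ℂ, 1 < s.re → LSeriesSummable (fun n => ((z * F) * (G * P)) n) s ∧
      LSeries (fun n => ((z * F) * (G * P)) n) s = (LSeries (fun n => z n) s * ψ.LFunction s)
        * (χ.LFunction s * (ψ.mulLevel χ).LFunction s) := by
    intro s hs
    have hz1 : LSeriesSummable (fun n => z n) s :=
        ArithmeticFunction.LSeriesSummable_zeta_iff.mpr hs
    obtain ⟨f1, f2⟩ := ψ.LSeries_toArithmeticFunction hs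
    obtain ⟨g1, g2⟩ := χ.LSeries_toArithmeticFunction hs
    obtain ⟨p1, p2⟩ := (ψ.mulLevel χ).LSeries_toArithmeticFunction hs
    have hzf := ArithmeticFunction.LSeriesSummable_mul hz1 f1
    have hgp := ArithmeticFunction.LSeriesSummable_mul g1 p1
    refine ⟨ArithmeticFunction.LSeriesSummable_mul hzf hgp, ?_⟩
    rw [ArithmeticFunction.LSeries_mul' hzf hgp, ArithmeticFunction.LSeries_mul' hz1 f1,
      ArithmeticFunction.LSeries_mul' g1 p1, f2, g2, p2, ψ.LFunction_eq_LSeries hs,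
      χ.LFunction_eq_LSeries hs, (ψ.mulLevel χ).LFunction_eq_LSeries hs]
  have h := le_re_apply_one_of_LSeries
    (H := fun s => (Z s * ψ.LFunction s) * (χ.LFunction s * (ψ.mulLevel χ).LFunction s))
    (a := fun n => ((z * F) * (G * P)) n)
    ((hZ.mul (DirichletCharacter.differentiable_LFunction hψ)).mul
      ((DirichletCharacter.differentiable_LFunction hχ).mul
        (DirichletCharacter.differentiable_LFunction hne)))
    (fun n => hmul.nonneg_of_prime_pow (fun p hp k => zeta_mul_mul_mul_prime_pow_nonneg hp
      (ψ.toArithmeticFunction_prime_pow hp) (χ.toArithmeticFunction_prime_pow hp)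
      (fun k => by
        rw [hP, (ψ.mulLevel χ).toArithmeticFunction_prime_pow hp,
            DirichletCharacter.mulLevel_apply])
      (eq_zero_or_one_or_neg_one hψ2 _) (eq_zero_or_one_or_neg_one hχ2 _) k) n)
    (by rw [hmul.map_one])
    (LSeries.abscissaOfAbsConv_le_of_forall_lt_LSeriesSummable (x := 1) fun y hy =>
      (hser y (by simpa using hy)).1) ?_ hM ?_ hβ hβ1 (by simp [h0])
  · rw [exp_neg_mul_log_eq (by linarith), ← mul_assoc] at h
    refine h.trans ((Complex.re_le_norm _).trans (le_of_eq ?_))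
    rw [hZ1, one_mul, norm_mul, norm_mul, mul_assoc]
  · intro s hs
    rw [(hser s hs).2, hZL s hs, mul_assoc, mul_assoc, mul_assoc]
  · intro w hw
    rw [norm_mul, norm_mul, norm_mul]
    have e1 := hZD w hw
    have e2 := norm_LFunction_le_of_mem_closedBall hψ hw
    have e3 := norm_LFunction_le_of_mem_closedBall hχ hw
    have e4 := norm_LFunction_le_of_mem_closedBall hne hw
    push_cast at e4
    calc _ ≤ (D * (6 * r)) * ((6 * q) * (6 * (r * q))) := by gcongr
      _ = _ := by ring

/-- **Siegel's theorem**. -/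
theorem exists_le_norm_LFunction_one {ε : ℝ} (hε : 0 < ε) (hε1 : ε ≤ 1) : ∃ c > 0,
    ∀ (q : ℕ) [NeZero q] (χ : DirichletCharacter ℂ q), χ.IsPrimitive → χ ≠ 1 → χ ^ 2 = 1 →
      c * (q : ℝ) ^ (-ε) ≤ ‖χ.LFunction 1‖ := by
  obtain ⟨Z, hZ, hZ1, hZL⟩ := exists_entire_zeta
  obtain ⟨D', hD'⟩ := (isCompact_closedBall (2 : ℂ) (4 / 3)).exists_bound_of_continuousOn
    hZ.continuous.continuousOn
  set D := max D' 1 with hDdef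
  have hD : 1 ≤ D := le_max_right _ _
  have hZD : ∀ z ∈ Metric.closedBall (2 : ℂ) (4 / 3), ‖Z z‖ ≤ D := fun z hz =>
    (hD' z hz).trans (le_max_left _ _)
  have hZcont : Continuous fun y : ℝ => (Z y).re :=
    Complex.continuous_re.comp (hZ.continuous.comp Complex.continuous_ofReal)
  obtain ⟨d, hd, hdZ⟩ := Metric.eventually_nhds_iff.mp
    ((hZcont.tendsto 1).eventually (lt_mem_nhds (by simp [hZ1] : (0 : ℝ) < (Z ((1 : ℝ) : ℂ)).re)))
  set η := min (ε / 28) (min (d / 2) (1 / 8)) with hη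
  have hη0 : 0 < η := by positivity
  have hηε : η ≤ ε / 28 := min_le_left _ _
  have hηd : η ≤ d / 2 := (min_le_right _ _).trans (min_le_left _ _)
  have hη8 : η ≤ 1 / 8 := (min_le_right _ _).trans (min_le_right _ _)
  by_cases hex : ∃ (r : ℕ) (_ : NeZero r) (ψ : DirichletCharacter ℂ r) (β : ℝ), ψ.IsPrimitive ∧
      ψ ≠ 1 ∧ ψ ^ 2 = 1 ∧ 1 - η ≤ β ∧ β < 1 ∧ ψ.LFunction β = 0
  · obtain ⟨r, _, ψ, β, hψp, hψ, hψ2, hβ, hβ1, h0⟩ := hex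
    have hr : (1 : ℝ) ≤ r := by exact_mod_cast NeZero.pos r
    obtain ⟨χ₀, hχ₀⟩ := Finite.exists_min
      fun χ : DirichletCharacter ℂ r => if χ = 1 then 1 else ‖χ.LFunction 1‖
    set c₁ := (if χ₀ = 1 then 1 else ‖χ₀.LFunction 1‖) with hc₁
    have hc₁0 : 0 < c₁ := by
      rw [hc₁]
      split_ifs with h
      · exact one_pos
      · exact norm_pos_iff.mpr (DirichletCharacter.LFunction_apply_one_ne_zero h)
    set A := (1 - β) / 2 * Real.exp (-((1 - β) * (7 * Real.log (77 * (216 * D * r ^ 2)) + 1)))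
      with hA
    have hA0 : 0 < A := mul_pos (by linarith) (Real.exp_pos _)
    set p := ‖ψ.LFunction 1‖ with hp
    have hp0 : 0 < p := norm_pos_iff.mpr (DirichletCharacter.LFunction_apply_one_ne_zero hψ)
    set K := (10 + 4 / (ε / 2)) * (r * 2 : ℝ) ^ (ε / 2) with hK
    have hK0 : 0 < K := by positivity
    refine ⟨min c₁ (A / (p * K)), by positivity, fun q _ χ hχp hχ hχ2 => ?_⟩
    have hq : (1 : ℝ) ≤ q := by exact_mod_cast NeZero.pos q
    have hq0 : (0 : ℝ) < q := by linarith
    by_cases hqr : r = q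
    · subst hqr
      have h1 := hχ₀ χ
      rw [if_neg hχ] at h1
      refine le_trans ?_ h1
      calc _ ≤ c₁ * 1 := mul_le_mul (min_le_left _ _)
            (Real.rpow_le_one_of_one_le_of_nonpos hq (by linarith)) (by positivity) hc₁0.le
        _ = c₁ := mul_one _
    · have hne := DirichletCharacter.mulLevel_ne_one hψp hχp hχ2 hqr
      have : NeZero (r * q) := ⟨mul_ne_zero (NeZero.ne r) (NeZero.ne q)⟩
      have h1 := le_norm_LFunction_one_of_zero hZ hZ1 hZL hD hZD hψ hψ2 (by linarith) hβ1 h0 hχ hχ2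
        hne
      rw [← hA, ← hp] at h1
      have h2 := norm_LFunction_le hne (by linarith : 0 < ε / 2) (by linarith) (T := 0) (s := 1)
        (by simp) (by simp; linarith) (by simp)
      have h3 : ‖(ψ.mulLevel χ).LFunction 1‖ ≤ K * (q : ℝ) ^ (ε / 2) := by
        refine h2.trans (le_of_eq ?_)
        rw [hK, mul_assoc, ← Real.mul_rpow (by positivity) (by positivity)]
        push_cast
        congr 2
        ring
      have h4 : A * (q : ℝ) ^ (-(ε / 2)) ≤ p * K * ‖χ.LFunction 1‖ * (q : ℝ) ^ (ε / 2) := by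
        calc _ ≤ A * (q : ℝ) ^ (-(14 * (1 - β))) := by
              refine mul_le_mul_of_nonneg_left ?_ hA0.le
              exact Real.rpow_le_rpow_of_exponent_le hq (by linarith)
          _ ≤ _ := h1
          _ ≤ p * ‖χ.LFunction 1‖ * (K * (q : ℝ) ^ (ε / 2)) :=
              mul_le_mul_of_nonneg_left h3 (by positivity)
          _ = _ := by ring
      have h5 : (q : ℝ) ^ (-(ε / 2)) = (q : ℝ) ^ (-ε) * (q : ℝ) ^ (ε / 2) := by
        rw [← Real.rpow_add hq0]
        congr 1
        ring
      rw [h5, ← mul_assoc] at h4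
      have h6 := le_of_mul_le_mul_right h4 (by positivity)
      calc _ ≤ A / (p * K) * (q : ℝ) ^ (-ε) :=
            mul_le_mul_of_nonneg_right (min_le_right _ _) (by positivity)
        _ ≤ _ := by
            rw [div_mul_eq_mul_div, div_le_iff₀ (by positivity)]
            linarith
  · refine ⟨η / 2 * Real.exp (-(η * (7 * Real.log (77 * (6 * D)) + 1))), by positivity,
      fun q _ χ hχp hχ hχ2 => ?_⟩
    have hq : (1 : ℝ) ≤ q := by exact_mod_cast NeZero.pos q
    have hne : ∀ β : ℝ, 1 - η ≤ β → β < 1 → χ.LFunction β ≠ 0 := fun β h1 h2 h3 =>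
      hex ⟨q, inferInstance, χ, β, hχp, hχ, hχ2, h1, h2, h3⟩
    have hL := re_LFunction_nonneg_of_ne_zero hχ hχ2 (by linarith) hne
    have hLi := im_LFunction_ofReal hχ hχ2 (by linarith : 0 < 1 - η)
    have hZp : 0 < (Z ((1 - η : ℝ) : ℂ)).re := hdZ (by
      rw [Real.dist_eq, sub_sub_cancel_left, abs_neg, abs_of_pos hη0]
      linarith)
    have h := le_norm_LFunction_one_of_re_nonneg hZ hZ1 hZL hD hZD hχ hχ2
      (by linarith : 7 / 8 ≤ 1 - η) (by linarith) (by
        rw [Complex.mul_re, hLi, mul_zero, sub_zero]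
        exact mul_nonneg hZp.le hL)
    rw [sub_sub_cancel] at h
    refine le_trans (mul_le_mul_of_nonneg_left ?_ (by positivity)) h
    exact Real.rpow_le_rpow_of_exponent_le hq (by linarith)

lemma one_le_mul_norm_of_pow_four {f : ℝ → ℂ} {Q : ℝ} (hQ : 1 ≤ Q)
    (hf : ∀ x, 0 < x → x ≤ 1 / 2 → x ^ 3 ≤ Q ^ 4 * ‖f x‖ ^ 4)
    (hl : ∀ x x', 0 < x → x ≤ 1 / 2 → 0 < x' → x' ≤ 1 / 2 → ‖f x' - f x‖ ≤ Q * |x' - x|)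
    {x : ℝ} (hx : 0 < x) (hx2 : x ≤ 1 / 2) : 1 ≤ 16 * Q ^ 7 * ‖f x‖ := by
  set w := 1 / (2 * Q ^ 2) with hw
  have hw0 : 0 < w := by positivity
  have hwQ : w * (2 * Q ^ 2) = 1 := by
    rw [hw]
    field_simp
  have hw1 : w ≤ 1 / 2 := by
    rw [hw]
    gcongr
    nlinarith
  have hr : w ^ 4 ≤ 1 / 2 := by
    calc w ^ 4 ≤ w ^ 1 := pow_le_pow_of_le_one hw0.le (by linarith) (by norm_num)
      _ ≤ _ := by rw [pow_one]; exact hw1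
  have key : ∀ x, w ^ 4 ≤ x → x ≤ 1 / 2 → w ^ 3 ≤ Q * ‖f x‖ := by
    intro x h1 h2
    have h3 := hf x (lt_of_lt_of_le (by positivity) h1) h2
    have h4 : (w ^ 3) ^ 4 ≤ (Q * ‖f x‖) ^ 4 := by
      calc (w ^ 3) ^ 4 = (w ^ 4) ^ 3 := by ring
        _ ≤ x ^ 3 := by gcongr
        _ ≤ _ := by rw [mul_pow]; exact h3
    exact le_of_pow_le_pow_left₀ (by norm_num) (by positivity) h4
  have hfin : w ^ 3 / 2 ≤ Q * ‖f x‖ := by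
    rcases le_or_gt (w ^ 4) x with h | h
    · exact le_trans (by linarith [pow_pos hw0 3]) (key x h hx2)
    · have h1 := key (w ^ 4) le_rfl hr
      have h2 := hl x (w ^ 4) hx hx2 (by positivity) hr
      rw [abs_of_pos (by linarith)] at h2
      have h3 := norm_sub_norm_le (f (w ^ 4)) (f x)
      have h4 : Q * (w ^ 4 - x) ≤ Q * w ^ 4 := by gcongr; linarith
      have h5 : Q * ‖f (w ^ 4)‖ ≤ Q * (‖f x‖ + Q * w ^ 4) := by gcongr; linarith
      have h6 : Q * (Q * w ^ 4) = w ^ 3 / 2 := by linear_combination w ^ 3 / 2 * hwQ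
      nlinarith
  have h8 : (w * (2 * Q ^ 2)) ^ 3 ≤ 16 * Q ^ 7 * ‖f x‖ := by
    calc (w * (2 * Q ^ 2)) ^ 3 = w ^ 3 / 2 * (16 * Q ^ 6) := by ring
      _ ≤ Q * ‖f x‖ * (16 * Q ^ 6) := by gcongr
      _ = _ := by ring
  rwa [hwQ, one_pow] at h8

lemma pow_three_le_mul_norm_LFunction {q : ℕ} [NeZero q] (χ : DirichletCharacter ℂ q) {x y Q : ℝ}
    (hx : 0 < x)
    (h1 : ‖LSeries (fun n : ℕ => (1 : DirichletCharacter ℂ q) (n : ZMod q)) (1 + x)‖ ≤ Q / x)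
    (h2 : ‖LSeries (fun n : ℕ => (χ ^ 2) (n : ZMod q)) (1 + x + 2 * Complex.I * y)‖ ≤ Q) :
    x ^ 3 ≤ Q ^ 4 * ‖χ.LFunction (1 + x + Complex.I * y)‖ ^ 4 := by
  have hQ : 0 ≤ Q := (norm_nonneg _).trans h2
  have h := χ.norm_LSeries_product_ge_one hx y
  rw [norm_mul, norm_mul, norm_pow, norm_pow] at h
  rw [χ.LFunction_eq_LSeries (by simpa using hx)]
  have h3 : 1 ≤ (Q / x) ^ 3 * ‖LSeries (fun n : ℕ => χ (n : ZMod q)) (1 + x + Complex.I * y)‖ ^ 4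
      * Q := by
    refine h.le.trans ?_
    gcongr
  rw [div_pow, div_mul_eq_mul_div, div_mul_eq_mul_div, le_div_iff₀ (by positivity)] at h3
  linarith

set_option maxHeartbeats 1000000 in
theorem exists_le_norm_LFunction {ε : ℝ} (hε : 0 < ε) (hε1 : ε ≤ 1) : ∃ c > 0,
    ∀ (q : ℕ) [NeZero q] (χ : DirichletCharacter ℂ q), χ.IsPrimitive → χ ≠ 1 → ∀ (s : ℂ) (T : ℝ),
      1 < s.re → s.re ≤ 3 / 2 → |s.im| ≤ T → c * (q * (T + 2)) ^ (-ε) ≤ ‖χ.LFunction s‖ := by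
  set a := ε / 14 with ha
  have ha0 : 0 < a := by positivity
  have ha1 : a ≤ 1 := by linarith
  obtain ⟨c₀, hc₀, hS⟩ := exists_le_norm_LFunction_one ha0 ha1
  set c := min c₀ 1 with hc
  have hc0 : 0 < c := by positivity
  have hc1 : c ≤ 1 := min_le_right _ _
  set K := 2 * (80 / a + 32 / a ^ 2) + 20 with hK
  have hK20 : 20 ≤ K := by
    have : 0 < 80 / a + 32 / a ^ 2 := by positivity
    linarith
  have hK1 : 2 * (10 + 4 / a) ≤ K := by
    have h1 : 4 / a ≤ 80 / a := by gcongr; norm_num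
    have h2 : 0 < 32 / a ^ 2 := by positivity
    linarith
  have hK2 : 80 / a + 32 / a ^ 2 ≤ K := by
    have : 0 < 80 / a + 32 / a ^ 2 := by positivity
    linarith
  have hK0 : 0 < K := by linarith
  set N := K + 8 * K / c with hN
  have hN0 : 0 < N := by positivity
  have h8 : 8 * K ≤ 8 * K / c := le_div_self (by positivity) hc0 hc1
  refine ⟨1 / (16 * N ^ 7), by positivity, fun q _ χ hχp hχ s T hs1 hs2 hT => ?_⟩
  have hT0 : 0 ≤ T := (abs_nonneg _).trans hT
  have hV2 := two_le_natCast_mul q hT0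
  set V := (q : ℝ) * (T + 2) with hV
  have hV0 : 0 < V := by linarith
  have hq : (1 : ℝ) ≤ q := by exact_mod_cast NeZero.pos q
  have hqV : (q : ℝ) * 2 ≤ V := by
    rw [hV]
    gcongr
    linarith
  set v := V ^ a with hv
  have hv1 : 1 ≤ v := Real.one_le_rpow (by linarith) ha0.le
  have hv0 : 0 < v := by linarith
  have hvv : v ≤ v ^ 2 := by nlinarith
  have hVε : V ^ (-ε) = (v ^ 14)⁻¹ := by
    rw [hv, ← Real.rpow_natCast, ← Real.rpow_mul hV0.le, ← Real.rpow_neg hV0.le, ha]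
    congr 1
    push_cast
    ring
  set Q := N * v ^ 2 with hQ
  have hQ1 : 1 ≤ Q := by
    have : 1 ≤ N := by linarith
    exact one_le_mul_of_one_le_of_one_le this (one_le_pow₀ hv1)
  suffices h : 1 ≤ 16 * Q ^ 7 * ‖χ.LFunction s‖ by
    rw [hVε, ← div_eq_mul_inv, div_div, div_le_iff₀ (by positivity)]
    calc 1 ≤ _ := h
      _ = _ := by rw [hQ]; ring
  set x := s.re - 1 with hx
  set y := s.im with hy
  have hs : s = 1 + x + Complex.I * y := by
    apply Complex.ext <;> simp [hx, hy]
  have hx0 : 0 < x := by linarith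
  have hx2 : x ≤ 1 / 2 := by linarith
  have hone : ∀ x : ℝ, 0 < x → x ≤ 1 / 2 →
      ‖LSeries (fun n : ℕ => (1 : DirichletCharacter ℂ q) (n : ZMod q)) (1 + x)‖ ≤ Q / x := by
    intro x hx0 hx2
    have h := norm_LSeries_one_le (q := q) ha0 ha1 (s := 1 + x) (T := 0) (by simp) (by simpa)
      (by simp; linarith)
    refine h.trans ?_
    rw [add_sub_cancel_left, Complex.norm_real, Real.norm_of_nonneg hx0.le, zero_add]
    have h1 : ((q : ℝ) * 2) ^ a ≤ v := Real.rpow_le_rpow (by positivity) hqV ha0.le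
    have h2 : (10 + 4 / a) * ((q : ℝ) * 2) ^ a ≤ K * v := by
      refine mul_le_mul ?_ h1 (by positivity) (by positivity)
      have : 0 < 10 + 4 / a := by positivity
      linarith
    have h3 : K * v + 2 ≤ Q := by
      rw [hQ, hN]
      nlinarith
    rw [le_div_iff₀ hx0, add_mul, div_mul_cancel₀ _ hx0.ne']
    have h4 : (10 + 4 / a) * ((q : ℝ) * 2) ^ a * x ≤ K * v * 1 := by
      refine mul_le_mul h2 (by linarith) hx0.le (by positivity)
    linarith
  have h2T : ((q : ℝ) * (2 * T + 2)) ^ a ≤ 2 * v := by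
    calc ((q : ℝ) * (2 * T + 2)) ^ a ≤ (2 * V) ^ a := by
          refine Real.rpow_le_rpow (by positivity) ?_ ha0.le
          rw [hV]
          nlinarith
      _ = 2 ^ a * v := Real.mul_rpow (by norm_num) hV0.le
      _ ≤ 2 * v := by
          refine mul_le_mul_of_nonneg_right ?_ hv0.le
          calc (2 : ℝ) ^ a ≤ 2 ^ (1 : ℝ) := Real.rpow_le_rpow_of_exponent_le (by norm_num) ha1
            _ = 2 := by norm_num
  have hK2T : (10 + 4 / a) * ((q : ℝ) * (2 * T + 2)) ^ a ≤ K * v := by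
    calc _ ≤ (10 + 4 / a) * (2 * v) := by gcongr
      _ = 2 * (10 + 4 / a) * v := by ring
      _ ≤ _ := by gcongr
  have him : ∀ x : ℝ, |(1 + x + 2 * Complex.I * y : ℂ).im| ≤ 2 * T := by
    intro x
    simp only [Complex.add_im, Complex.one_im, Complex.ofReal_im, Complex.mul_im, Complex.mul_re,
      Complex.re_ofNat, Complex.im_ofNat, Complex.I_re, Complex.I_im, Complex.ofReal_re]
    norm_num
    exact hT
  have hlip : ∀ z w : ℂ, |z.im| ≤ T → |w.im| ≤ T → 1 ≤ z.re → z.re ≤ 2 → 1 ≤ w.re → w.re ≤ 2 →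
      ‖χ.LFunction z - χ.LFunction w‖ ≤ K * v * ‖z - w‖ := by
    intro z w h1 h2 h3 h4 h5 h6
    refine (norm_LFunction_sub_le hχ ha0 ha1 h1 h2 (by linarith) h4 (by linarith) h6).trans ?_
    gcongr
  have hKQ : K * v ≤ Q := by
    rw [hQ]
    exact mul_le_mul (by linarith) hvv hv0.le hN0.le
  have hlip' : ∀ x x', 0 < x → x ≤ 1 / 2 → 0 < x' → x' ≤ 1 / 2 →
      ‖χ.LFunction (1 + (x' : ℝ) + Complex.I * y) - χ.LFunction (1 + (x : ℝ) + Complex.I * y)‖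
        ≤ Q * |x' - x| := by
    intro x x' h1 h2 h3 h4
    refine (hlip _ _ (by simpa using hT) (by simpa using hT) (by simp; linarith)
      (by simp; linarith) (by simp; linarith) (by simp; linarith)).trans ?_
    have e1 : (1 + (x' : ℝ) + Complex.I * y : ℂ) - (1 + (x : ℝ) + Complex.I * y)
        = ((x' - x : ℝ) : ℂ) := by push_cast; ring
    rw [e1, Complex.norm_real, Real.norm_eq_abs]
    gcongr
  by_cases hχ2 : χ ^ 2 = 1
  · set r := c / (4 * K * v ^ 2) with hr
    have hr0 : 0 < r := by positivity
    have h2r : 2 / r = 8 * K / c * v ^ 2 := by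
      rw [hr]
      field_simp
      ring
    have hrQ : K * v + 2 / r ≤ Q := by
      rw [h2r, hQ, hN, add_mul]
      have := mul_le_mul_of_nonneg_left hvv hK0.le
      linarith
    have hsq : ∀ x : ℝ, 0 < x → x ≤ 1 / 2 → (r ≤ x ∨ r ≤ 2 * |y|) →
        ‖LSeries (fun n : ℕ => (χ ^ 2) (n : ZMod q)) (1 + x + 2 * Complex.I * y)‖ ≤ Q := by
      intro x h1 h2 h3
      rw [hχ2]
      refine (norm_LSeries_one_le (q := q) ha0 ha1 (him x) (by simpa) (by simp; linarith)).trans ?_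
      refine le_trans (add_le_add hK2T ?_) hrQ
      refine div_le_div_of_nonneg_left (by norm_num) hr0 ?_
      rcases h3 with h3 | h3
      · refine le_trans ?_ (Complex.abs_re_le_norm _)
        simp only [Complex.sub_re, Complex.add_re, Complex.one_re, Complex.ofReal_re,
          Complex.mul_re, Complex.re_ofNat, Complex.im_ofNat, Complex.I_re, Complex.I_im,
          Complex.mul_im, Complex.ofReal_im]
        norm_num
        exact h3.trans (le_abs_self _)
      · refine le_trans ?_ (Complex.abs_im_le_norm _)
        simp only [Complex.sub_im, Complex.add_im, Complex.one_im, Complex.ofReal_re,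
          Complex.mul_re, Complex.re_ofNat, Complex.im_ofNat, Complex.I_re, Complex.I_im,
          Complex.mul_im, Complex.ofReal_im]
        norm_num
        exact h3
    by_cases hy2 : r ≤ 2 * |y|
    · rw [hs]
      exact one_le_mul_norm_of_pow_four (f := fun x : ℝ => χ.LFunction (1 + x + Complex.I * y)) hQ1
        (fun x h1 h2 => pow_three_le_mul_norm_LFunction χ h1 (hone x h1 h2)
          (hsq x h1 h2 (Or.inr hy2))) hlip' hx0 hx2
    · push Not at hy2
      by_cases hxr : r ≤ x
      · have h1 := pow_three_le_mul_norm_LFunction χ hx0 (hone x hx0 hx2)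
            (hsq x hx0 hx2 (Or.inl hxr))
        rw [← hs] at h1
        have h2 : 1 ≤ Q * r := by
          have : 2 / r ≤ Q := by nlinarith
          rw [div_le_iff₀ hr0] at this
          linarith
        have h3 : 1 ≤ (Q ^ 2 * ‖χ.LFunction s‖) ^ 4 := by
          calc (1 : ℝ) ≤ (Q * r) ^ 3 := one_le_pow₀ h2
            _ ≤ (Q * x) ^ 3 := by gcongr
            _ = Q ^ 3 * x ^ 3 := by ring
            _ ≤ Q ^ 3 * (Q ^ 4 * ‖χ.LFunction s‖ ^ 4) := by gcongr
            _ ≤ Q ^ 4 * (Q ^ 4 * ‖χ.LFunction s‖ ^ 4) := by gcongr; norm_num [hQ1]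
            _ = _ := by ring
        have h4 : 1 ≤ Q ^ 2 * ‖χ.LFunction s‖ :=
          (one_le_pow_iff_of_nonneg (by positivity) (by norm_num)).mp h3
        refine h4.trans (mul_le_mul_of_nonneg_right ?_ (norm_nonneg _))
        have : Q ^ 2 ≤ Q ^ 7 := pow_le_pow_right₀ hQ1 (by norm_num)
        have : 0 < Q ^ 7 := by positivity
        linarith
      · push Not at hxr
        have h1 : c * v⁻¹ ≤ ‖χ.LFunction 1‖ := by
          refine le_trans ?_ (hS q χ hχp hχ hχ2)
          refine mul_le_mul (min_le_left _ _) ?_ (by positivity) hc₀.le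
          rw [hv, ← Real.rpow_neg hV0.le]
          exact Real.rpow_le_rpow_of_nonpos (by positivity) (by linarith) (by linarith)
        have h2 := hlip 1 s (by simpa using hT0) hT (by simp) (by simp) hs1.le (by linarith)
        have h3 : ‖1 - s‖ ≤ 3 / 2 * r := by
          rw [norm_sub_rev]
          refine (Complex.norm_le_abs_re_add_abs_im _).trans ?_
          rw [Complex.sub_re, Complex.sub_im, Complex.one_re, Complex.one_im, sub_zero, ← hx, ← hy,
            abs_of_pos hx0]
          linarith
        have h4 : K * v * ‖1 - s‖ ≤ 3 / 8 * (c * v⁻¹) := by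
          calc _ ≤ K * v * (3 / 2 * r) := by gcongr
            _ = _ := by
              rw [hr]
              field_simp
              ring
        have h5 := norm_sub_norm_le (χ.LFunction 1) (χ.LFunction s)
        have h6 : c * v⁻¹ / 2 ≤ ‖χ.LFunction s‖ := by
          have : 0 < c * v⁻¹ := by positivity
          linarith
        have h7 : 1 ≤ Q * (c * v⁻¹ / 2) := by
          have : 8 * K / c * v ^ 2 ≤ Q := by
            rw [hQ]
            gcongr
            linarith
          calc (1 : ℝ) ≤ 4 * K * v := by nlinarith
            _ = 8 * K / c * v ^ 2 * (c * v⁻¹ / 2) := by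
                field_simp
                ring
            _ ≤ _ := by gcongr
        calc 1 ≤ Q * (c * v⁻¹ / 2) := h7
          _ ≤ 16 * Q ^ 7 * ‖χ.LFunction s‖ := by
              refine mul_le_mul ?_ h6 (by positivity) (by positivity)
              have : Q ^ 1 ≤ Q ^ 7 := pow_le_pow_right₀ hQ1 (by norm_num)
              linarith
  · rw [hs]
    refine one_le_mul_norm_of_pow_four (f := fun x : ℝ => χ.LFunction (1 + x + Complex.I * y)) hQ1
      (fun x h1 h2 => pow_three_le_mul_norm_LFunction χ h1 (hone x h1 h2) ?_) hlip' hx0 hx2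
    rw [← DirichletCharacter.LFunction_eq_LSeries (χ ^ 2) (by simpa)]
    refine (norm_LFunction_le hχ2 ha0 ha1 (him x) ?_ ?_).trans (hK2T.trans hKQ)
    · simp
      linarith
    · simp
      linarith

lemma logMul_iterate_apply (f : ℕ → ℂ) (k n : ℕ) :
    LSeries.logMul^[k] f n = (Real.log n : ℂ) ^ k * f n := by
  induction k with
  | zero => simp
  | succ k ih =>
    rw [Function.iterate_succ_apply', LSeries.logMul, ih, pow_succ, ← Complex.natCast_log]
    ring

lemma abscissaOfAbsConv_twist_vonMangoldt_le {q : ℕ} (χ : DirichletCharacter ℂ q) :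
    LSeries.abscissaOfAbsConv
      ((fun n : ℕ => χ (n : ZMod q)) * fun n => (ArithmeticFunction.vonMangoldt n : ℂ)) ≤ 1 :=
  LSeries.abscissaOfAbsConv_le_of_forall_lt_LSeriesSummable (x := 1) fun y hy =>
    χ.LSeriesSummable_twist_vonMangoldt (by simpa using hy)

set_option maxHeartbeats 1000000 in
theorem exists_norm_LSeries_logMul_vonMangoldt_le (k : ℕ) {ε : ℝ} (hε : 0 < ε) (hε1 : ε ≤ 1) :
    ∃ K > 0, ∀ (q : ℕ) [NeZero q] (χ : DirichletCharacter ℂ q), χ.IsPrimitive → χ ≠ 1 →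
      ∀ (s : ℂ), 1 < s.re → s.re ≤ 5 / 4 →
        ‖LSeries (LSeries.logMul^[k] ((fun n : ℕ => χ (n : ZMod q)) *
          fun n => (ArithmeticFunction.vonMangoldt n : ℂ))) s‖ ≤ K * (q * (|s.im| + 2)) ^ ε := by
  set a := ε / (2 * (k + 1)) with ha
  have hk1 : (1 : ℝ) ≤ k + 1 := by linarith [k.cast_nonneg (α := ℝ)]
  have ha0 : 0 < a := by positivity
  have ha1 : a ≤ 1 := by
    rw [ha, div_le_one (by positivity)]
    linarith
  obtain ⟨c, hc, hlow⟩ := exists_le_norm_LFunction ha0 ha1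
  set L := 80 / a + 32 / a ^ 2 with hL
  have hL0 : 0 < L := by positivity
  set N := 2 * L / c + 4 / a + 4 with hN
  have hN4 : 4 ≤ N := by
    have : 0 < 2 * L / c + 4 / a := by positivity
    linarith
  have hN0 : 0 < N := by positivity
  refine ⟨k.factorial * N ^ (k + 1) * 2, by positivity, fun q _ χ hχp hχ s hs1 hs2 => ?_⟩
  set V := (q : ℝ) * (|s.im| + 1 + 2) with hV
  have hV2 := two_le_natCast_mul q (by positivity : 0 ≤ |s.im| + 1)
  rw [← hV] at hV2
  have hV0 : 0 < V := by linarith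
  set v := V ^ a with hv
  have hv1 : 1 ≤ v := Real.one_le_rpow (by linarith) ha0.le
  have hv0 : 0 < v := by linarith
  have hva : V ^ (-a) = v⁻¹ := Real.rpow_neg hV0.le _
  set W := N * v ^ 2 with hW
  have hNW : N ≤ W := le_mul_of_one_le_right hN0.le (one_le_pow₀ hv1)
  have hW0 : 0 < W := by positivity
  have hball : ∀ z ∈ Metric.closedBall s W⁻¹, |z.im| ≤ |s.im| + 1 ∧ 1 - a / 4 ≤ z.re ∧ z.re ≤ 2 ∧
      c / 2 * v⁻¹ ≤ ‖χ.LFunction z‖ := by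
    intro z hz
    rw [mem_closedBall_iff_norm] at hz
    have h4W : W⁻¹ ≤ 4⁻¹ := by gcongr; linarith
    have haW : W⁻¹ ≤ a / 4 := by
      rw [inv_le_comm₀ hW0 (by positivity), inv_div]
      have : 0 < 2 * L / c := by positivity
      linarith
    have h1 := abs_le.mp ((Complex.abs_re_le_norm (z - s)).trans hz)
    have h2 := (Complex.abs_im_le_norm (z - s)).trans hz
    rw [Complex.sub_re] at h1
    rw [Complex.sub_im] at h2
    have h3 : |z.im| ≤ |s.im| + 1 := by
      have := abs_sub_abs_le_abs_sub z.im s.im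
      linarith
    refine ⟨h3, by linarith, by linarith, ?_⟩
    have h5 := norm_LFunction_sub_le hχ ha0 ha1 (z := s) (w := z) (T := |s.im| + 1) (by linarith) h3
      (by linarith) (by linarith) (by linarith) (by linarith)
    have h6 := hlow q χ hχp hχ s (|s.im| + 1) hs1 (by linarith) (by linarith)
    rw [← hV, hva] at h6
    rw [← hV, ← hv, ← hL, norm_sub_rev s z] at h5
    have h7 : L * v * ‖z - s‖ ≤ c / 2 * v⁻¹ := by
      calc L * v * ‖z - s‖ ≤ L * v * W⁻¹ := by gcongr
        _ ≤ L * v * (2 * L / c * v ^ 2)⁻¹ := by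
          rw [hW]
          gcongr
          have : 0 < 4 / a := by positivity
          linarith
        _ = _ := by
          field_simp
    have h8 := norm_sub_norm_le (χ.LFunction s) (χ.LFunction z)
    linarith
  set F : ℂ → ℂ := fun z => -deriv χ.LFunction z / χ.LFunction z with hF
  have hdiff := DirichletCharacter.differentiable_LFunction hχ
  have hne : ∀ z ∈ Metric.closedBall s W⁻¹, χ.LFunction z ≠ 0 := fun z hz =>
    norm_pos_iff.mp (lt_of_lt_of_le (by positivity) (hball z hz).2.2.2)
  have hFd : DiffContOnCl ℂ F (Metric.ball s W⁻¹) := by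
    refine DifferentiableOn.diffContOnCl ?_
    rw [closure_ball _ (by positivity)]
    refine DifferentiableOn.div ?_ hdiff.differentiableOn hne
    exact (hdiff.contDiff.differentiable_deriv_two.neg).differentiableOn
  have hFb : ∀ z ∈ Metric.sphere s W⁻¹, ‖F z‖ ≤ W := by
    intro z hz
    obtain ⟨h1, h2, h3, h4⟩ := hball z (Metric.sphere_subset_closedBall hz)
    have h5 := norm_deriv_LFunction_le hχ ha0 ha1 h1 h2 h3
    rw [← hV, ← hv, ← hL] at h5
    rw [hF, norm_div, norm_neg]
    calc _ ≤ L * v / (c / 2 * v⁻¹) := by gcongr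
      _ = 2 * L / c * v ^ 2 := by field_simp
      _ ≤ W := by
        rw [hW]
        gcongr
        have : 0 < 4 / a := by positivity
        linarith
  have hC := Complex.norm_iteratedDeriv_le_of_forall_mem_sphere_norm_le k (by positivity) hFd hFb
  have hev : F =ᶠ[nhds s] LSeries ((fun n : ℕ => χ (n : ZMod q)) *
      fun n => (ArithmeticFunction.vonMangoldt n : ℂ)) := by
    filter_upwards [(isOpen_lt continuous_const Complex.continuous_re).mem_nhds hs1] with z hz
    rw [χ.LSeries_twist_vonMangoldt_eq hz, ← χ.deriv_LFunction_eq_deriv_LSeries hz,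
      ← χ.LFunction_eq_LSeries hz]
  rw [hev.iteratedDeriv_eq, LSeries_iteratedDeriv _
    ((abscissaOfAbsConv_twist_vonMangoldt_le χ).trans_lt (by exact_mod_cast hs1)), norm_mul,
    norm_pow, norm_neg, norm_one, one_pow, one_mul] at hC
  refine hC.trans ?_
  have hvV : (v ^ 2) ^ (k + 1) = V ^ ε := by
    rw [← pow_mul, hv, ← Real.rpow_natCast, ← Real.rpow_mul hV0.le, ha]
    congr 1
    push_cast
    field_simp
  have hVV : V ^ ε ≤ 2 * ((q : ℝ) * (|s.im| + 2)) ^ ε := by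
    calc V ^ ε ≤ (2 * ((q : ℝ) * (|s.im| + 2))) ^ ε := by
          refine Real.rpow_le_rpow hV0.le ?_ hε.le
          rw [hV, ← mul_assoc, mul_comm 2, mul_assoc]
          gcongr
          linarith [abs_nonneg s.im]
      _ = 2 ^ ε * ((q : ℝ) * (|s.im| + 2)) ^ ε := Real.mul_rpow (by norm_num) (by positivity)
      _ ≤ _ := by
          refine mul_le_mul_of_nonneg_right ?_ (by positivity)
          calc (2 : ℝ) ^ ε ≤ 2 ^ (1 : ℝ) := Real.rpow_le_rpow_of_exponent_le (by norm_num) hε1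
            _ = 2 := by norm_num
  calc k.factorial * W / W⁻¹ ^ k = k.factorial * N ^ (k + 1) * (v ^ 2) ^ (k + 1) := by
        rw [inv_pow, div_inv_eq_mul, hW]
        ring_nf
    _ ≤ k.factorial * N ^ (k + 1) * (2 * ((q : ℝ) * (|s.im| + 2)) ^ ε) := by
        rw [hvV]
        gcongr
    _ = _ := by ring

/-- The function `max (1 - u) 0` on the positive reals. -/
noncomputable def tent (u : ℝ) : ℂ :=
  (Set.Ioc 0 1).indicator (fun _ => (1 : ℂ)) u
    - (Set.Ioc 0 1).indicator (fun t : ℝ => (t : ℂ) ^ (1 : ℂ)) u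

lemma tent_of_le {u : ℝ} (h0 : 0 < u) (h1 : u ≤ 1) : tent u = 1 - u := by
  have h : u ∈ Set.Ioc (0 : ℝ) 1 := ⟨h0, h1⟩
  rw [tent, Set.indicator_of_mem h, Set.indicator_of_mem h, Complex.cpow_one]

lemma tent_of_ge {u : ℝ} (h1 : 1 ≤ u) : tent u = 0 := by
  rcases h1.eq_or_lt with rfl | h
  · rw [tent_of_le one_pos le_rfl]
    simp
  · rw [tent, Set.indicator_of_notMem (fun h' => (h'.2.trans_lt h).false),
      Set.indicator_of_notMem (fun h' => (h'.2.trans_lt h).false), sub_zero]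

lemma continuousAt_tent {u : ℝ} (hu : 0 < u) : ContinuousAt tent u := by
  have h : Continuous fun u : ℝ => ((max (1 - u) 0 : ℝ) : ℂ) := by fun_prop
  refine h.continuousAt.congr ?_
  filter_upwards [lt_mem_nhds hu] with v hv
  rcases le_total v 1 with h | h
  · rw [tent_of_le hv h, max_eq_left (by linarith)]
    push_cast
    rfl
  · rw [tent_of_ge h, max_eq_right (by linarith), Complex.ofReal_zero]

lemma hasMellin_tent {s : ℂ} (hs : 0 < s.re) : HasMellin tent s (1 / s - 1 / (s + 1)) := by
  have h1 := hasMellin_one_Ioc hs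
  have h2 := hasMellin_cpow_Ioc 1 (by simp; linarith : 0 < s.re + (1 : ℂ).re)
  have h3 := hasMellin_sub h1.1 h2.1
  rw [h1.2, h2.2] at h3
  exact h3

lemma norm_one_div_sub_le {σ : ℝ} (hσ : 1 ≤ σ) (y : ℝ) :
    ‖1 / (σ + y * Complex.I : ℂ) - 1 / (σ + y * Complex.I + 1)‖ ≤ 4 * (1 + |y|) ^ (-2 : ℝ) := by
  have key : ∀ τ : ℝ, 1 ≤ τ → (1 + |y|) / 2 ≤ ‖(τ + y * Complex.I : ℂ)‖ := by
    intro τ hτ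
    have h1 := Complex.abs_re_le_norm (τ + y * Complex.I : ℂ)
    have h2 := Complex.abs_im_le_norm (τ + y * Complex.I : ℂ)
    simp only [Complex.add_re, Complex.ofReal_re, Complex.re_ofReal_mul, Complex.I_re, mul_zero,
      add_zero, Complex.add_im, Complex.ofReal_im, Complex.im_ofReal_mul, Complex.I_im, mul_one,
      zero_add] at h1 h2
    have := le_abs_self τ
    linarith
  have h1 := key σ hσ
  have h2 := key (σ + 1) (by linarith)
  have e1 : ((σ + 1 : ℝ) + y * Complex.I : ℂ) = σ + y * Complex.I + 1 := by push_cast; ring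
  rw [e1] at h2
  have hy := abs_nonneg y
  have n1 : (σ + y * Complex.I : ℂ) ≠ 0 := norm_pos_iff.mp (by linarith)
  have n2 : (σ + y * Complex.I + 1 : ℂ) ≠ 0 := norm_pos_iff.mp (by linarith)
  rw [div_sub_div _ _ n1 n2, norm_div, norm_mul]
  have e2 : ‖1 * (σ + y * Complex.I + 1 : ℂ) - (σ + y * Complex.I) * 1‖ = 1 := by
    rw [one_mul, mul_one, add_sub_cancel_left, norm_one]
  rw [e2, Real.rpow_neg (by linarith), Real.rpow_ofNat]
  calc _ ≤ 1 / ((1 + |y|) / 2 * ((1 + |y|) / 2)) := by gcongr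
    _ = _ := by
      field_simp
      norm_num

lemma exists_norm_sum_mul_one_sub_div_le : ∃ C > 0, ∀ (a : ℕ → ℂ) (σ x M : ℝ), 1 ≤ σ → 0 < x →
    LSeriesSummable a σ →
    (∀ y : ℝ, ‖LSeries a (σ + y * Complex.I)‖ ≤ M * (|y| + 2) ^ (1 / 2 : ℝ)) →
    ‖∑ n ∈ Ioc 0 ⌊x⌋₊, a n * (1 - (n / x : ℝ))‖ ≤ C * M * x ^ σ := by
  have hinteg : MeasureTheory.Integrable fun y : ℝ => (1 + ‖y‖) ^ (-(3 / 2) : ℝ) :=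
    integrable_one_add_norm (by rw [Module.finrank_self]; norm_num)
  have hint2 : MeasureTheory.Integrable fun y : ℝ => (1 + ‖y‖) ^ (-2 : ℝ) :=
    integrable_one_add_norm (by rw [Module.finrank_self]; norm_num)
  set C := ∫ y : ℝ, (1 + ‖y‖) ^ (-(3 / 2) : ℝ) with hC
  have hC0 : 0 ≤ C := MeasureTheory.integral_nonneg fun y => by positivity
  refine ⟨8 * C + 1, by positivity, fun a σ x M hσ hx ha hM => ?_⟩
  have hM0 : 0 ≤ M := by
    have := (norm_nonneg _).trans (hM 0)
    exact nonneg_of_mul_nonneg_left this (by positivity)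
  set G : ℝ → ℂ := fun y => 1 / (σ + y * Complex.I : ℂ) - 1 / (σ + y * Complex.I + 1) with hG
  have hGb : ∀ y, ‖G y‖ ≤ 4 * (1 + ‖y‖) ^ (-2 : ℝ) := fun y => norm_one_div_sub_le hσ y
  have hre : ∀ y : ℝ, (σ + y * Complex.I : ℂ).re = σ := by simp
  have hGc : Continuous G := by
    have n1 : ∀ y : ℝ, (σ + y * Complex.I : ℂ) ≠ 0 := fun y h => by
      have := congrArg Complex.re h
      rw [hre, Complex.zero_re] at this
      linarith
    have n2 : ∀ y : ℝ, (σ + y * Complex.I + 1 : ℂ) ≠ 0 := fun y h => by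
      have := congrArg Complex.re h
      rw [Complex.add_re, hre, Complex.zero_re, Complex.one_re] at this
      linarith
    exact (Continuous.div (by fun_prop) (by fun_prop) n1).sub
      (Continuous.div (by fun_prop) (by fun_prop) n2)
  have hGi : MeasureTheory.Integrable G :=
    (hint2.const_mul 4).mono' hGc.aestronglyMeasurable (Filter.Eventually.of_forall hGb)
  have hmel : ∀ y : ℝ, mellin tent (σ + y * Complex.I) = G y := fun y =>
    (hasMellin_tent (by rw [hre]; linarith)).2
  have hinv : ∀ u : ℝ, 0 < u →
      ∫ y : ℝ, (u : ℂ) ^ (-(σ + y * Complex.I)) * G y = 2 * Real.pi * tent u := by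
    intro u hu
    have h := mellinInv_mellin_eq σ tent hu (hasMellin_tent (by simpa using by linarith)).1
      (by
        rw [Complex.VerticalIntegrable]
        simp only [hmel]
        exact hGi) (continuousAt_tent hu)
    rw [mellinInv] at h
    simp only [hmel, smul_eq_mul] at h
    rw [← h, Complex.real_smul, ← mul_assoc]
    push_cast
    rw [mul_one_div_cancel (by norm_num [Real.pi_ne_zero]), one_mul]
  set F : ℕ → ℝ → ℂ := fun n y =>
    LSeries.term a (σ + y * Complex.I) n * ((x : ℂ) ^ (σ + y * Complex.I) * G y) with hF
  have hxn : ∀ y : ℝ, ‖(x : ℂ) ^ (σ + y * Complex.I)‖ = x ^ σ := fun y => by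
    rw [Complex.norm_cpow_eq_rpow_re_of_pos hx, hre]
  have hFn : ∀ n y, ‖F n y‖ = ‖LSeries.term a σ n‖ * x ^ σ * ‖G y‖ := by
    intro n y
    rw [hF, norm_mul, norm_mul, hxn, LSeries.norm_term_eq, LSeries.norm_term_eq, hre,
      Complex.ofReal_re, mul_assoc]
  have hFc : ∀ n, Continuous (F n) := by
    intro n
    refine Continuous.mul ?_ (Continuous.mul ?_ hGc)
    · rcases eq_or_ne n 0 with rfl | hn
      · simp only [LSeries.term_zero]
        exact continuous_const
      · simp only [LSeries.term_of_ne_zero hn]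
        refine continuous_const.div (Continuous.const_cpow (by fun_prop) (Or.inl ?_)) fun y => ?_
        · exact_mod_cast hn
        · rw [Complex.cpow_ne_zero_iff]
          exact Or.inl (by exact_mod_cast hn)
    · exact Continuous.const_cpow (by fun_prop) (Or.inl (by exact_mod_cast hx.ne'))
  have hFi : ∀ n, MeasureTheory.Integrable (F n) := fun n =>
    (hGi.norm.const_mul (‖LSeries.term a σ n‖ * x ^ σ)).mono' (hFc n).aestronglyMeasurable
      (Filter.Eventually.of_forall fun y => (hFn n y).le)
  have hFs : Summable fun n => ∫ y, ‖F n y‖ := by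
    simp only [hFn, MeasureTheory.integral_const_mul]
    exact (ha.norm.mul_right _).mul_right _
  have hsum := MeasureTheory.hasSum_integral_of_summable_integral_norm hFi hFs
  have hval : ∀ n, n ≠ 0 → ∫ y, F n y = a n * (2 * Real.pi * tent (n / x)) := by
    intro n hn
    have hn0 : (0 : ℝ) < n := by positivity
    rw [← hinv _ (div_pos hn0 hx), ← MeasureTheory.integral_const_mul]
    refine MeasureTheory.integral_congr_ae (Filter.Eventually.of_forall fun y => ?_)
    have h1 : (n : ℂ) ^ (σ + y * Complex.I : ℂ)
        = ((n / x : ℝ) : ℂ) ^ (σ + y * Complex.I : ℂ) * (x : ℂ) ^ (σ + y * Complex.I : ℂ) := by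
      rw [← Complex.mul_cpow_ofReal_nonneg (by positivity) hx.le, ← Complex.ofReal_mul,
        div_mul_cancel₀ _ hx.ne', Complex.ofReal_natCast]
    have h2 : (x : ℂ) ^ (σ + y * Complex.I : ℂ) ≠ 0 := by
      rw [Complex.cpow_ne_zero_iff]
      exact Or.inl (by exact_mod_cast hx.ne')
    have h3 : ((n / x : ℝ) : ℂ) ^ (σ + y * Complex.I : ℂ) ≠ 0 := by
      rw [Complex.cpow_ne_zero_iff]
      exact Or.inl (by exact_mod_cast (div_pos hn0 hx).ne')
    simp only [hF, LSeries.term_of_ne_zero hn]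
    rw [h1, Complex.cpow_neg]
    field_simp
  have hfin : HasSum (fun n => ∫ y, F n y) (∑ n ∈ Ioc 0 ⌊x⌋₊, ∫ y, F n y) := by
    refine hasSum_sum_of_ne_finset_zero fun n hn => ?_
    rcases eq_or_ne n 0 with rfl | hn0
    · simp [hF]
    · rw [hval n hn0, tent_of_ge, mul_zero, mul_zero]
      rw [one_le_div hx]
      rw [mem_Ioc, not_and, not_le] at hn
      exact (Nat.lt_of_floor_lt (hn (by omega))).le
  have heq := hfin.unique hsum
  have hleft : ∑ n ∈ Ioc 0 ⌊x⌋₊, ∫ y, F n y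
      = 2 * Real.pi * ∑ n ∈ Ioc 0 ⌊x⌋₊, a n * (1 - (n / x : ℝ)) := by
    rw [mul_sum]
    refine sum_congr rfl fun n hn => ?_
    rw [mem_Ioc] at hn
    have hn0 : (0 : ℝ) < n := by exact_mod_cast hn.1
    have : (n : ℝ) ≤ x := (Nat.le_floor_iff hx.le).mp hn.2
    rw [hval n (by omega), tent_of_le (by positivity) ((div_le_one hx).mpr this)]
    ring
  have hright : ‖∫ y, ∑' n, F n y‖ ≤ M * x ^ σ * 8 * C := by
    rw [hC, ← MeasureTheory.integral_const_mul]
    refine MeasureTheory.norm_integral_le_of_norm_le (hinteg.const_mul _)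
      (Filter.Eventually.of_forall fun y => ?_)
    have e1 : ∑' n, F n y
        = LSeries a (σ + y * Complex.I) * ((x : ℂ) ^ (σ + y * Complex.I) * G y) := by
      rw [LSeries, ← tsum_mul_right]
    have hy := abs_nonneg y
    rw [e1, norm_mul, norm_mul, hxn]
    calc _ ≤ M * (|y| + 2) ^ (1 / 2 : ℝ) * (x ^ σ * (4 * (1 + ‖y‖) ^ (-2 : ℝ))) := by
          gcongr
          · exact hM y
          · exact hGb y
      _ ≤ M * (2 * (1 + ‖y‖) ^ (1 / 2 : ℝ)) * (x ^ σ * (4 * (1 + ‖y‖) ^ (-2 : ℝ))) := by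
          gcongr
          rw [Real.norm_eq_abs]
          calc (|y| + 2) ^ (1 / 2 : ℝ) ≤ (4 * (1 + |y|)) ^ (1 / 2 : ℝ) := by
                refine Real.rpow_le_rpow (by positivity) (by linarith) (by norm_num)
            _ = 4 ^ (1 / 2 : ℝ) * (1 + |y|) ^ (1 / 2 : ℝ) :=
                Real.mul_rpow (by norm_num) (by positivity)
            _ = _ := by
                rw [← Real.sqrt_eq_rpow, (by norm_num : (4 : ℝ) = 2 ^ 2),
                  Real.sqrt_sq (by norm_num)]
      _ = M * x ^ σ * 8 * ((1 + ‖y‖) ^ (1 / 2 : ℝ) * (1 + ‖y‖) ^ (-2 : ℝ)) := by ring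
      _ = _ := by
          rw [← Real.rpow_add (by positivity)]
          norm_num
  rw [← heq, hleft, norm_mul] at hright
  have hpi : (1 : ℝ) ≤ ‖(2 * Real.pi : ℂ)‖ := by
    rw [norm_mul, Complex.norm_real, Real.norm_of_nonneg Real.pi_pos.le]
    norm_num
    linarith [Real.pi_gt_three]
  have h0 : 0 ≤ M * x ^ σ := by positivity
  calc _ ≤ ‖(2 * Real.pi : ℂ)‖ * ‖∑ n ∈ Ioc 0 ⌊x⌋₊, a n * (1 - (n / x : ℝ))‖ :=
        le_mul_of_one_le_left (norm_nonneg _) hpi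
    _ ≤ _ := hright
    _ ≤ _ := by nlinarith

lemma exists_norm_sum_logMul_mul_sub_le (k : ℕ) {ε : ℝ} (hε : 0 < ε) (hε1 : ε ≤ 1 / 2) :
    ∃ K > 0, ∀ (q : ℕ) [NeZero q] (χ : DirichletCharacter ℂ q), χ.IsPrimitive → χ ≠ 1 →
      ∀ x : ℝ, Real.exp 4 ≤ x →
        ‖∑ n ∈ Ioc 0 ⌊x⌋₊, LSeries.logMul^[k] ((fun n : ℕ => χ (n : ZMod q)) *
          fun n => (ArithmeticFunction.vonMangoldt n : ℂ)) n * ((x - n : ℝ) : ℂ)‖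
          ≤ K * (q : ℝ) ^ ε * x ^ 2 := by
  obtain ⟨K, hK, hL⟩ := exists_norm_LSeries_logMul_vonMangoldt_le k hε (by linarith)
  obtain ⟨C, hC, hP⟩ := exists_norm_sum_mul_one_sub_div_le
  refine ⟨C * K * Real.exp 1, by positivity, fun q _ χ hχp hχ x hx => ?_⟩
  have hx0 : 0 < x := (Real.exp_pos 4).trans_le hx
  have hl : 4 ≤ Real.log x := (Real.le_log_iff_exp_le hx0).mpr hx
  have hq : (1 : ℝ) ≤ q := by exact_mod_cast NeZero.pos q
  set σ := 1 + 1 / Real.log x with hσ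
  have hl4 : 1 / Real.log x ≤ 1 / 4 := by gcongr
  have hl0 : 0 < 1 / Real.log x := by positivity
  set a := LSeries.logMul^[k] ((fun n : ℕ => χ (n : ZMod q)) *
          fun n => (ArithmeticFunction.vonMangoldt n : ℂ)) with ha
  have hsum : LSeriesSummable a σ := by
    refine LSeriesSummable_of_abscissaOfAbsConv_lt_re ?_
    rw [ha, LSeries.absicssaOfAbsConv_logPowMul]
    refine (abscissaOfAbsConv_twist_vonMangoldt_le χ).trans_lt ?_
    rw [Complex.ofReal_re]
    exact_mod_cast (by linarith : 1 < σ)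
  have h := hP a σ x (K * (q : ℝ) ^ ε) (by linarith) hx0 hsum (fun y => by
    refine (hL q χ hχp hχ (σ + y * Complex.I) (by simp; linarith) (by simp; linarith)).trans ?_
    rw [mul_assoc]
    refine mul_le_mul_of_nonneg_left ?_ hK.le
    have e1 : (σ + y * Complex.I : ℂ).im = y := by simp
    rw [e1, Real.mul_rpow (by positivity) (by positivity)]
    refine mul_le_mul_of_nonneg_left ?_ (by positivity)
    exact Real.rpow_le_rpow_of_exponent_le (by linarith [abs_nonneg y]) hε1)
  have e2 : ∑ n ∈ Ioc 0 ⌊x⌋₊, a n * ((x - n : ℝ) : ℂ)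
      = x * ∑ n ∈ Ioc 0 ⌊x⌋₊, a n * (1 - (n / x : ℝ)) := by
    rw [mul_sum]
    refine sum_congr rfl fun n _ => ?_
    have : (x : ℂ) ≠ 0 := by exact_mod_cast hx0.ne'
    push_cast
    field_simp
  have e3 : x ^ σ = x * Real.exp 1 := by
    rw [hσ, Real.rpow_add hx0, Real.rpow_one, Real.rpow_def_of_pos hx0,
      mul_one_div_cancel (by positivity)]
  rw [e2, norm_mul, Complex.norm_real, Real.norm_of_nonneg hx0.le]
  calc _ ≤ x * (C * (K * (q : ℝ) ^ ε) * x ^ σ) := by gcongr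
    _ = _ := by
      rw [e3]
      ring

lemma norm_sum_le_of_norm_sum_mul_sub_le {a : ℕ → ℂ} {E : ℝ} (m : ℕ)
    (ha : ∀ n : ℕ, 0 < n → ‖a n‖ ≤ Real.log n ^ (2 * m + 1))
    (hW : ∀ x : ℝ, Real.exp 4 ≤ x → ‖∑ n ∈ Ioc 0 ⌊x⌋₊, a n * ((x - n : ℝ) : ℂ)‖ ≤ E * x ^ 2)
    {x : ℝ} (hx : Real.exp 4 ≤ x) :
    ‖∑ n ∈ Ioc 0 ⌊x⌋₊, a n‖
      ≤ (5 * E + (1 + m.factorial) * 2 ^ (2 * m + 1)) * (x * Real.log x ^ (m + 1)) := by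
  have hx0 : 0 < x := (Real.exp_pos 4).trans_le hx
  have hx2 : 2 ≤ x := by
    have := Real.add_one_le_exp 4
    linarith
  have hl : 4 ≤ Real.log x := (Real.le_log_iff_exp_le hx0).mpr hx
  set l := Real.log x with hldef
  have hl0 : 0 < l := by linarith
  have hE : 0 ≤ E := by
    have := (norm_nonneg _).trans (hW x hx)
    exact nonneg_of_mul_nonneg_left this (by positivity)
  set h := x / l ^ m with hh
  have hh0 : 0 < h := by positivity
  have hhx : h ≤ x := div_le_self hx0.le (one_le_pow₀ (by linarith))
  have hfl : ⌊x⌋₊ ≤ ⌊x + h⌋₊ := Nat.floor_le_floor (by linarith)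
  have hid : (h : ℂ) * ∑ n ∈ Ioc 0 ⌊x⌋₊, a n
      = ∑ n ∈ Ioc 0 ⌊x + h⌋₊, a n * ((x + h - n : ℝ) : ℂ)
        - ∑ n ∈ Ioc 0 ⌊x⌋₊, a n * ((x - n : ℝ) : ℂ)
        - ∑ n ∈ Ioc ⌊x⌋₊ ⌊x + h⌋₊, a n * ((x + h - n : ℝ) : ℂ) := by
    rw [← sum_Ioc_consecutive _ (Nat.zero_le _) hfl, add_sub_right_comm, add_sub_cancel_right,
      ← sum_sub_distrib, mul_sum]
    refine sum_congr rfl fun n _ => ?_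
    push_cast
    ring
  have h1 : ‖∑ n ∈ Ioc ⌊x⌋₊ ⌊x + h⌋₊, a n * ((x + h - n : ℝ) : ℂ)‖
      ≤ (h + 1) * ((2 * l) ^ (2 * m + 1) * h) := by
    refine (norm_sum_le _ _).trans
      ((sum_le_sum (g := fun _ => (2 * l) ^ (2 * m + 1) * h) fun n hn => ?_).trans ?_)
    · rw [mem_Ioc] at hn
      have hn1 : x < n := Nat.lt_of_floor_lt hn.1
      have hn2 : (n : ℝ) ≤ x + h := (Nat.le_floor_iff (by linarith)).mp hn.2
      have hn0 : (0 : ℝ) < n := by linarith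
      rw [norm_mul, Complex.norm_real, Real.norm_of_nonneg (by linarith)]
      refine mul_le_mul ((ha n (by exact_mod_cast hn0)).trans ?_) (by linarith) (by linarith)
        (by positivity)
      refine pow_le_pow_left₀ (Real.log_nonneg (by linarith)) ?_ _
      calc Real.log n ≤ Real.log (x * x) := Real.log_le_log hn0 (by nlinarith)
        _ = 2 * l := by
          rw [Real.log_mul hx0.ne' hx0.ne']
          ring
    · rw [sum_const, Nat.card_Ioc, nsmul_eq_mul]
      refine mul_le_mul_of_nonneg_right ?_ (by positivity)
      rw [Nat.cast_sub hfl]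
      have := Nat.floor_le (by linarith : 0 ≤ x + h)
      have := Nat.lt_floor_add_one x
      linarith
  have h2 : h * ‖∑ n ∈ Ioc 0 ⌊x⌋₊, a n‖
      ≤ E * (x + h) ^ 2 + E * x ^ 2 + (h + 1) * ((2 * l) ^ (2 * m + 1) * h) := by
    have := congrArg norm hid
    rw [norm_mul, Complex.norm_real, Real.norm_of_nonneg hh0.le] at this
    rw [this]
    refine (norm_sub_le _ _).trans (add_le_add ((norm_sub_le _ _).trans (add_le_add ?_ ?_)) h1)
    · exact hW _ (by linarith)
    · exact hW x hx
  have h3 : E * (x + h) ^ 2 ≤ E * (2 * x) ^ 2 := by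
    gcongr
    linarith
  have hhl : h * l ^ m = x := by
    rw [hh]
    field_simp
  have h4 : ‖∑ n ∈ Ioc 0 ⌊x⌋₊, a n‖ ≤ 5 * E * (x * l ^ m) + (h + 1) * (2 * l) ^ (2 * m + 1) := by
    refine le_of_mul_le_mul_left ?_ hh0
    calc _ ≤ _ := h2
      _ ≤ 5 * E * (x * x) + (h + 1) * ((2 * l) ^ (2 * m + 1) * h) := by linarith
      _ = 5 * E * (x * (h * l ^ m)) + (h + 1) * ((2 * l) ^ (2 * m + 1) * h) := by rw [hhl]
      _ = _ := by ring
  have h5 : l ^ m ≤ m.factorial * x := by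
    have := Real.pow_div_factorial_le_exp l hl0.le m
    rw [hldef, Real.exp_log hx0, div_le_iff₀ (by positivity)] at this
    linarith
  have h6 : (h + 1) * l ^ m ≤ (1 + m.factorial) * x := by
    rw [add_mul, hhl]
    linarith
  have h7 : l ^ m ≤ l ^ (m + 1) := pow_le_pow_right₀ (by linarith) (by omega)
  calc _ ≤ _ := h4
    _ = 5 * E * (x * l ^ m) + 2 ^ (2 * m + 1) * (((h + 1) * l ^ m) * l ^ (m + 1)) := by
        rw [mul_pow]
        ring
    _ ≤ 5 * E * (x * l ^ (m + 1)) + 2 ^ (2 * m + 1) * (((1 + m.factorial) * x) * l ^ (m + 1)) := by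
        gcongr
    _ = _ := by ring

lemma sum_Ico_norm_sub_of_antitoneOn {f : ℕ → ℝ} {m n : ℕ} (hmn : m ≤ n)
    (hf : ∀ i, m ≤ i → f (i + 1) ≤ f i) :
    ∑ i ∈ Ico m n, ‖(f (i + 1) : ℂ) - f i‖ = f m - f n := by
  induction n, hmn using Nat.le_induction with
  | base => simp
  | succ n hmn ih =>
    rw [sum_Ico_succ_top hmn, ih, ← Complex.ofReal_sub, Complex.norm_real, Real.norm_eq_abs,
      abs_of_nonpos (sub_nonpos.mpr (hf n hmn))]
    ring

lemma norm_sum_vonMangoldt_le_mul_log {q : ℕ} (χ : DirichletCharacter ℂ q) (N : ℕ) :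
    ‖∑ n ∈ Ioc 0 N, χ (n : ZMod q) * (ArithmeticFunction.vonMangoldt n : ℂ)‖
      ≤ N * Real.log N := by
  refine (norm_sum_le _ _).trans
    ((sum_le_sum (g := fun _ => Real.log N) fun n hn => ?_).trans (by simp))
  rw [mem_Ioc] at hn
  rw [norm_mul, Complex.norm_real, Real.norm_of_nonneg ArithmeticFunction.vonMangoldt_nonneg]
  calc _ ≤ 1 * ArithmeticFunction.vonMangoldt n :=
        mul_le_mul_of_nonneg_right (DirichletCharacter.norm_le_one χ _)
          ArithmeticFunction.vonMangoldt_nonneg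
    _ ≤ Real.log n := by
        rw [one_mul]
        exact ArithmeticFunction.vonMangoldt_le_log
    _ ≤ Real.log N := Real.log_le_log (by exact_mod_cast hn.1) (by exact_mod_cast hn.2)

lemma exists_norm_sum_logMul_le (m : ℕ) {ε : ℝ} (hε : 0 < ε) (hε1 : ε ≤ 1 / 2) :
    ∃ K > 0, ∀ (q : ℕ) [NeZero q] (χ : DirichletCharacter ℂ q), χ.IsPrimitive → χ ≠ 1 →
      ∀ x : ℝ, Real.exp 4 ≤ x →
        ‖∑ n ∈ Ioc 0 ⌊x⌋₊, LSeries.logMul^[2 * m] ((fun n : ℕ => χ (n : ZMod q)) *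
          fun n => (ArithmeticFunction.vonMangoldt n : ℂ)) n‖
          ≤ K * (q : ℝ) ^ ε * (x * Real.log x ^ (m + 1)) := by
  obtain ⟨K, hK, hL⟩ := exists_norm_sum_logMul_mul_sub_le (2 * m) hε hε1
  refine ⟨5 * K + (1 + m.factorial) * 2 ^ (2 * m + 1), by positivity, fun q _ χ hχp hχ x hx => ?_⟩
  have hq : (1 : ℝ) ≤ q := by exact_mod_cast NeZero.pos q
  have hx0 : 0 < x := (Real.exp_pos 4).trans_le hx
  have hl : 4 ≤ Real.log x := (Real.le_log_iff_exp_le hx0).mpr hx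
  have hqe : 1 ≤ (q : ℝ) ^ ε := Real.one_le_rpow hq hε.le
  refine (norm_sum_le_of_norm_sum_mul_sub_le m (fun n hn => ?_) (hL q χ hχp hχ) hx).trans ?_
  · have hlog : 0 ≤ Real.log n := Real.log_natCast_nonneg n
    rw [logMul_iterate_apply, Pi.mul_apply, norm_mul, norm_mul, norm_pow, Complex.norm_real,
      Complex.norm_real, Real.norm_of_nonneg hlog,
      Real.norm_of_nonneg ArithmeticFunction.vonMangoldt_nonneg, pow_succ]
    refine mul_le_mul_of_nonneg_left ?_ (by positivity)
    calc _ ≤ 1 * ArithmeticFunction.vonMangoldt n :=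
          mul_le_mul_of_nonneg_right (DirichletCharacter.norm_le_one χ _)
            ArithmeticFunction.vonMangoldt_nonneg
      _ ≤ Real.log n := by
          rw [one_mul]
          exact ArithmeticFunction.vonMangoldt_le_log
  · refine mul_le_mul_of_nonneg_right ?_ (by positivity)
    rw [add_mul]
    have : (1 + m.factorial : ℝ) * 2 ^ (2 * m + 1)
        ≤ (1 + m.factorial : ℝ) * 2 ^ (2 * m + 1) * (q : ℝ) ^ ε :=
      le_mul_of_one_le_right (by positivity) hqe
    linarith

/-- The **Siegel–Walfisz theorem** for sums over primitive characters. -/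
theorem siegel_walfisz (m : ℕ) {C : ℝ} (hC : 0 < C) : ∃ K > 0, ∀ x : ℝ, Real.exp 16 ≤ x →
    ∀ (q : ℕ) [NeZero q] (χ : DirichletCharacter ℂ q), χ.IsPrimitive → χ ≠ 1 →
      (q : ℝ) ≤ Real.log x ^ C → ∀ N ≤ ⌊x⌋₊,
        ‖∑ n ∈ Ioc 0 N, χ (n : ZMod q) * (ArithmeticFunction.vonMangoldt n : ℂ)‖
          ≤ K * (x / Real.log x ^ m) := by
  set ε := min (1 / 2) (1 / C) with hε
  have hε0 : 0 < ε := by positivity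
  obtain ⟨K, hK, hA⟩ := exists_norm_sum_logMul_le (m + 2) hε0 (min_le_left _ _)
  refine ⟨2 ^ (m + 1) * (m + 1).factorial + 2 * 2 ^ (2 * (m + 2)) * K, by positivity,
    fun x hx q _ χ hχp hχ hq N hN => ?_⟩
  have hx0 : 0 < x := (Real.exp_pos 16).trans_le hx
  have hl : 16 ≤ Real.log x := (Real.le_log_iff_exp_le hx0).mpr hx
  set l := Real.log x with hldef
  have hl0 : 0 < l := by linarith
  have hq1 : (1 : ℝ) ≤ q := by exact_mod_cast NeZero.pos q
  have hqe : (q : ℝ) ^ ε ≤ l := by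
    calc (q : ℝ) ^ ε ≤ (l ^ C) ^ ε := Real.rpow_le_rpow (by positivity) hq hε0.le
      _ = l ^ (C * ε) := (Real.rpow_mul hl0.le _ _).symm
      _ ≤ l ^ (1 : ℝ) := by
          refine Real.rpow_le_rpow_of_exponent_le (by linarith) ?_
          calc C * ε ≤ C * (1 / C) := by gcongr; exact min_le_right _ _
            _ = 1 := by field_simp
      _ = l := Real.rpow_one _
  set y := Real.exp (l / 2) with hy
  have hyx : y * y = x := by
    rw [hy, ← Real.exp_add, add_halves, hldef, Real.exp_log hx0]
  have hy8 : Real.exp 8 ≤ y := Real.exp_le_exp.mpr (by linarith)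
  have hy4 : Real.exp 4 + 1 ≤ y := by
    have h1 := Real.add_one_le_exp 4
    have h2 : Real.exp 8 = Real.exp 4 * Real.exp 4 := by rw [← Real.exp_add]; norm_num
    nlinarith
  have hy0 : 0 < y := Real.exp_pos _
  have hy1 : 1 ≤ y := by linarith [Real.exp_pos 4]
  have hyx1 : y ≤ x := by nlinarith
  set M := ⌊y⌋₊ with hM
  have hMy : (M : ℝ) ≤ y := Nat.floor_le hy0.le
  have hMy1 : y < M + 1 := Nat.lt_floor_add_one y
  have hM4 : Real.exp 4 ≤ M := by linarith
  have hly : Real.log y = l / 2 := Real.log_exp _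
  have hsmall : ∀ j ≤ M, ‖∑ n ∈ Ioc 0 j, χ (n : ZMod q) * (ArithmeticFunction.vonMangoldt n : ℂ)‖
      ≤ 2 ^ (m + 1) * (m + 1).factorial * (x / l ^ m) := by
    intro j hj
    refine (norm_sum_vonMangoldt_le_mul_log χ j).trans ?_
    have hjM : (j : ℝ) ≤ y := le_trans (by exact_mod_cast hj) hMy
    have h1 : (j : ℝ) * Real.log j ≤ y * l := by
      refine mul_le_mul hjM ?_ (Real.log_natCast_nonneg j) hy0.le
      rcases Nat.eq_zero_or_pos j with rfl | h
      · simpa using hl0.le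
      · exact Real.log_le_log (by exact_mod_cast h) (hjM.trans hyx1)
    refine h1.trans ?_
    have h2 := Real.pow_div_factorial_le_exp (l / 2) (by positivity) (m + 1)
    rw [← hy, div_le_iff₀ (by positivity), div_pow, div_le_iff₀ (by positivity)] at h2
    rw [mul_div_assoc', le_div_iff₀ (by positivity), ← hyx]
    calc y * l * l ^ m = y * l ^ (m + 1) := by ring
      _ ≤ y * (y * (m + 1).factorial * 2 ^ (m + 1)) := by gcongr
      _ = _ := by ring
  have hpos2 : 0 ≤ 2 * 2 ^ (2 * (m + 2)) * K * (x / l ^ m) := by positivity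
  rcases le_or_gt N M with hNM | hNM
  · refine (hsmall N hNM).trans ?_
    rw [add_mul]
    linarith
  rw [← sum_Ioc_consecutive _ (Nat.zero_le M) hNM.le, add_mul]
  refine (norm_add_le _ _).trans (add_le_add (hsmall M le_rfl) ?_)
  set a := LSeries.logMul^[2 * (m + 2)] ((fun n : ℕ => χ (n : ZMod q)) *
          fun n => (ArithmeticFunction.vonMangoldt n : ℂ)) with ha
  set f : ℕ → ℝ := fun n => (Real.log n ^ (2 * (m + 2)))⁻¹ with hf
  set S := K * l * (x * l ^ (m + 2 + 1)) with hS
  have hMpos : 2 ≤ M := by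
    have h1 := Real.add_one_le_exp 4
    have : (2 : ℝ) ≤ M := by linarith
    exact_mod_cast this
  have hAj : ∀ j, M ≤ j → j ≤ N → ‖∑ n ∈ Ioc 0 j, a n‖ ≤ S := by
    intro j h1 h2
    have hj1 : (M : ℝ) ≤ j := by exact_mod_cast h1
    have hj0 : (0 : ℝ) < j := by linarith [Real.exp_pos 4]
    have hj2 : (j : ℝ) ≤ x := (Nat.le_floor_iff hx0.le).mp (h2.trans hN)
    have h3 := hA q χ hχp hχ j (hM4.trans hj1)
    rw [Nat.floor_natCast] at h3
    refine h3.trans ?_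
    have hlj : Real.log j ≤ l := Real.log_le_log hj0 hj2
    have hlj0 : 0 ≤ Real.log j := Real.log_natCast_nonneg j
    rw [hS]
    gcongr
  have hpart : ∀ k, M + 1 ≤ k → k ≤ N + 1 → ‖∑ i ∈ Ico (M + 1) k, a i‖ ≤ 2 * S := by
    intro k h1 h2
    obtain ⟨j, rfl⟩ : ∃ j, k = j + 1 := ⟨k - 1, by omega⟩
    have e1 : Ico (M + 1) (j + 1) = Ioc M j := by
      ext i
      simp only [mem_Ico, mem_Ioc]
      omega
    have e2 : ∑ i ∈ Ioc M j, a i = ∑ i ∈ Ioc 0 j, a i - ∑ i ∈ Ioc 0 M, a i := by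
      rw [← sum_Ioc_consecutive _ (Nat.zero_le M) (by omega : M ≤ j)]
      ring
    rw [e1, e2, two_mul]
    exact (norm_sub_le _ _).trans (add_le_add (hAj j (by omega) (by omega)) (hAj M le_rfl hNM.le))
  have hlogpos : ∀ i : ℕ, M + 1 ≤ i → 0 < Real.log i := fun i hi =>
    Real.log_pos (by exact_mod_cast (by omega : 1 < i))
  have e3 : ∑ n ∈ Ioc M N, χ (n : ZMod q) * (ArithmeticFunction.vonMangoldt n : ℂ)
      = ∑ i ∈ Ico (M + 1) (N + 1), a i * (f i : ℂ) := by
    have e1 : Ico (M + 1) (N + 1) = Ioc M N := by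
      ext i
      simp only [mem_Ico, mem_Ioc]
      omega
    rw [e1]
    refine sum_congr rfl fun n hn => ?_
    rw [mem_Ioc] at hn
    have := hlogpos n hn.1
    have : (Real.log n : ℂ) ≠ 0 := by exact_mod_cast this.ne'
    rw [ha, logMul_iterate_apply, hf, Pi.mul_apply]
    push_cast [-Complex.natCast_log]
    field_simp
  have hanti : ∀ i, M + 1 ≤ i → f (i + 1) ≤ f i := by
    intro i hi
    have h1 := hlogpos i hi
    have h2 : Real.log i ≤ Real.log (i + 1 : ℕ) :=
      Real.log_le_log (by exact_mod_cast (by omega : 0 < i)) (by push_cast; linarith)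
    simp only [hf]
    gcongr
  have hfN : 0 ≤ f (N + 1) := by positivity
  rw [e3]
  refine (norm_sum_mul_le_abel a (fun i => (f i : ℂ)) (by omega) hpart).trans ?_
  rw [sum_Ico_norm_sub_of_antitoneOn (by omega) hanti, Complex.norm_real, Real.norm_of_nonneg hfN,
    add_sub_cancel]
  have hfM : f (M + 1) ≤ ((l / 2) ^ (2 * (m + 2)))⁻¹ := by
    simp only [hf]
    rw [← hly]
    have : Real.log y ≤ Real.log (M + 1 : ℕ) := Real.log_le_log hy0 (by push_cast; linarith)
    have : 0 < Real.log y := by rw [hly]; positivity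
    gcongr
  calc 2 * S * f (M + 1) ≤ 2 * S * ((l / 2) ^ (2 * (m + 2)))⁻¹ := by gcongr
    _ = _ := by
      rw [hS, div_pow, inv_div]
      have e5 : l ^ (2 * (m + 2)) = l * l ^ (m + 2 + 1) * l ^ m := by ring
      rw [e5]
      field_simp

lemma norm_e_sub_e_le (a b : ℝ) : ‖e a - e b‖ ≤ 2 * Real.pi * |a - b| := by
  have h1 : e a - e b = e b * (e (a - b) - 1) := by
    have : e a = e b * e (a - b) := by rw [← e_add]; congr 1; ring
    rw [this]; ring
  have h2 : e (a - b) = Complex.exp (Complex.I * ((2 * Real.pi * (a - b) : ℝ) : ℂ)) := by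
    rw [e]; congr 1; push_cast; ring
  rw [h1, norm_mul, norm_e, one_mul, h2]
  refine Real.norm_exp_I_mul_ofReal_sub_one_le.trans (le_of_eq ?_)
  rw [Real.norm_eq_abs, abs_mul, abs_of_pos (by positivity)]

lemma sum_norm_e_rpow_sub_le {c : ℝ} (hc : 0 ≤ c) (t : ℝ) {m n : ℕ} (hmn : m ≤ n) :
    ∑ i ∈ Ico m n, ‖e (t * ((i + 1 : ℕ) : ℝ) ^ c) - e (t * (i : ℝ) ^ c)‖
      ≤ 2 * Real.pi * (|t| * (n : ℝ) ^ c) := by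
  have h1 : ∀ i ∈ Ico m n, ‖e (t * ((i + 1 : ℕ) : ℝ) ^ c) - e (t * (i : ℝ) ^ c)‖
      ≤ 2 * Real.pi * |t| * (((i + 1 : ℕ) : ℝ) ^ c - (i : ℝ) ^ c) := by
    intro i _
    refine (norm_e_sub_e_le _ _).trans (le_of_eq ?_)
    have : (i : ℝ) ^ c ≤ ((i + 1 : ℕ) : ℝ) ^ c :=
      Real.rpow_le_rpow (by positivity) (by push_cast; linarith) hc
    rw [← mul_sub, abs_mul, abs_of_nonneg (sub_nonneg.mpr this)]
    ring
  refine (sum_le_sum h1).trans ?_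
  rw [← mul_sum, sum_Ico_sub (fun i : ℕ => (i : ℝ) ^ c) hmn, mul_assoc]
  gcongr
  have : (0 : ℝ) ≤ (m : ℝ) ^ c := by positivity
  linarith

lemma norm_sum_mul_e_rpow_le {c X S : ℝ} (hc : 0 ≤ c) (hX : 1 ≤ X) (t : ℝ) (a : ℕ → ℂ) {M : ℕ}
    (hM : M ≤ ⌊X⌋₊) (ha : ∀ N ≤ ⌊X⌋₊, ‖∑ n ∈ Ioc 0 N, a n‖ ≤ S) :
    ‖∑ n ∈ Ioc M ⌊X⌋₊, a n * e (t * (n : ℝ) ^ c)‖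
      ≤ 2 * S * (1 + 2 * Real.pi * 2 ^ c * (|t| * X ^ c)) := by
  have hS : 0 ≤ S := (norm_nonneg _).trans (ha 0 (by simp))
  have e1 : ∀ N, Ioc M N = Ico (M + 1) (N + 1) := by
    intro N; ext n; simp only [mem_Ioc, mem_Ico]; omega
  have hpart : ∀ k, M + 1 ≤ k → k ≤ ⌊X⌋₊ + 1 → ‖∑ i ∈ Ico (M + 1) k, a i‖ ≤ 2 * S := by
    intro k hk1 hk2
    obtain ⟨N, rfl⟩ : ∃ N, k = N + 1 := ⟨k - 1, by omega⟩
    have e2 : ∑ i ∈ Ico (M + 1) (N + 1), a i = ∑ i ∈ Ioc 0 N, a i - ∑ i ∈ Ioc 0 M, a i := by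
      rw [← e1, ← sum_Ioc_consecutive a (Nat.zero_le M) (by omega : M ≤ N)]; ring
    rw [e2]
    have := norm_sub_le (∑ i ∈ Ioc 0 N, a i) (∑ i ∈ Ioc 0 M, a i)
    have := ha N (by omega)
    have := ha M hM
    linarith
  rw [e1]
  refine (norm_sum_mul_le_abel a (fun i : ℕ => e (t * (i : ℝ) ^ c)) (by omega) hpart).trans ?_
  refine mul_le_mul_of_nonneg_left ?_ (by positivity)
  rw [norm_e]
  refine add_le_add le_rfl ((sum_norm_e_rpow_sub_le hc t (by omega)).trans ?_)
  have h1 : ((⌊X⌋₊ + 1 : ℕ) : ℝ) ≤ 2 * X := by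
    have := Nat.floor_le (by linarith : (0 : ℝ) ≤ X)
    push_cast; linarith
  have h2 : ((⌊X⌋₊ + 1 : ℕ) : ℝ) ^ c ≤ 2 ^ c * X ^ c := by
    rw [← Real.mul_rpow (by norm_num) (by linarith)]
    exact Real.rpow_le_rpow (by positivity) h1 hc
  calc 2 * Real.pi * (|t| * ((⌊X⌋₊ + 1 : ℕ) : ℝ) ^ c)
      ≤ 2 * Real.pi * (|t| * (2 ^ c * X ^ c)) := by gcongr
    _ = _ := by ring

lemma minor_arc_terms_le {X L C E δ T q : ℝ} {D : ℕ} (hX : 1 ≤ X) (hL : 1 ≤ L)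
    (hq : q ≤ L ^ C) (hT : L ^ (4 * D) ≤ T) (hTX : T ≤ X ^ (2 / 3 - δ)) (hD : E + 2 ≤ D)
    (h1 : L ^ (C + 2 + E) ≤ X ^ (δ / 2)) (h2 : L ^ (2 + E) ≤ X ^ (1 / 12 : ℝ)) :
    L ^ 2 * (q * X ^ (2 / 3 : ℝ) * √T + X / √T + (X ^ (11 / 12 : ℝ) + X / √√T))
      ≤ 4 * (X / L ^ E) := by
  have hX0 : 0 < X := by linarith
  have hL0 : 0 < L := by linarith
  have hLE : 0 < L ^ E := by positivity
  have hss : L ^ D ≤ √√T := by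
    rw [Real.le_sqrt (by positivity) (by positivity), Real.le_sqrt (by positivity)
      ((by positivity : (0 : ℝ) ≤ L ^ (4 * D)).trans hT)]
    exact le_trans (le_of_eq (by ring)) hT
  have hss1 : 1 ≤ √√T := (one_le_pow₀ hL).trans hss
  have hs : √√T ≤ √T := by
    have : √√T * √√T = √T := Real.mul_self_sqrt (by positivity)
    nlinarith
  have hLD : L ^ 2 * L ^ E ≤ L ^ D := by
    rw [← Real.rpow_natCast L D, ← Real.rpow_natCast L 2, ← Real.rpow_add hL0]
    exact Real.rpow_le_rpow_of_exponent_le hL (by push_cast; linarith)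
  have t4 : L ^ 2 * (X / √√T) ≤ X / L ^ E := by
    rw [le_div_iff₀ hLE, mul_div_assoc', div_mul_eq_mul_div, div_le_iff₀ (by linarith)]
    nlinarith
  have t2 : L ^ 2 * (X / √T) ≤ X / L ^ E :=
    le_trans (by gcongr) t4
  have t3 : L ^ 2 * X ^ (11 / 12 : ℝ) ≤ X / L ^ E := by
    rw [le_div_iff₀ hLE]
    have e1 : X ^ (11 / 12 : ℝ) * X ^ (1 / 12 : ℝ) = X := by
      rw [← Real.rpow_add hX0]; norm_num
    have e2 : L ^ 2 * L ^ E = L ^ (2 + E) := by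
      rw [Real.rpow_add hL0, Real.rpow_ofNat]
    calc L ^ 2 * X ^ (11 / 12 : ℝ) * L ^ E = X ^ (11 / 12 : ℝ) * (L ^ 2 * L ^ E) := by ring
      _ ≤ X ^ (11 / 12 : ℝ) * X ^ (1 / 12 : ℝ) := by rw [e2]; gcongr
      _ = X := e1
  have t1 : L ^ 2 * (q * X ^ (2 / 3 : ℝ) * √T) ≤ X / L ^ E := by
    rw [le_div_iff₀ hLE]
    have e1 : √T ≤ X ^ (1 / 3 - δ / 2) := by
      rw [Real.sqrt_le_left (by positivity), ← Real.rpow_mul_natCast hX0.le]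
      refine hTX.trans (le_of_eq ?_)
      congr 1; push_cast; ring
    have e2 : L ^ 2 * L ^ C * L ^ E = L ^ (C + 2 + E) := by
      rw [Real.rpow_add hL0, Real.rpow_add hL0, Real.rpow_ofNat]; ring
    have e3 : X ^ (δ / 2) * (X ^ (2 / 3 : ℝ) * X ^ (1 / 3 - δ / 2)) = X := by
      rw [← Real.rpow_add hX0, ← Real.rpow_add hX0]
      convert Real.rpow_one X using 2; ring
    calc L ^ 2 * (q * X ^ (2 / 3 : ℝ) * √T) * L ^ E
        ≤ L ^ 2 * (L ^ C * X ^ (2 / 3 : ℝ) * X ^ (1 / 3 - δ / 2)) * L ^ E := by gcongr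
      _ = (L ^ 2 * L ^ C * L ^ E) * (X ^ (2 / 3 : ℝ) * X ^ (1 / 3 - δ / 2)) := by ring
      _ ≤ X ^ (δ / 2) * (X ^ (2 / 3 : ℝ) * X ^ (1 / 3 - δ / 2)) := by rw [e2]; gcongr
      _ = X := e3
  linarith

lemma eventually_log_rpow_le_rpow (r : ℝ) {s : ℝ} (hs : 0 < s) :
    ∀ᶠ X : ℝ in Filter.atTop, Real.log X ^ r ≤ X ^ s := by
  filter_upwards [(isLittleO_log_rpow_rpow_atTop r hs).bound one_pos,
    Filter.eventually_ge_atTop (1 : ℝ)] with X h1 h2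
  rw [one_mul, Real.norm_of_nonneg (Real.rpow_nonneg (Real.log_nonneg h2) _),
    Real.norm_of_nonneg (by positivity)] at h1
  exact h1

lemma exists_norm_sum_vonMangoldt_primitive_le (μ c C E δ : ℝ) (hμ0 : 0 < μ) (hμ1 : μ < 1)
    (hc : 1 < c) (hC : 0 < C) (hδ : 0 < δ) :
    ∃ K > 0, ∀ᶠ X : ℝ in Filter.atTop, ∀ t : ℝ, |t| ≤ X ^ (2 / 3 - c - δ) →
      ∀ (q : ℕ) [NeZero q] (χ : DirichletCharacter ℂ q), χ.IsPrimitive → χ ≠ 1 →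
        (q : ℝ) ≤ Real.log X ^ C →
        ‖∑ n ∈ Ioc ⌊μ * X⌋₊ ⌊X⌋₊,
            (ArithmeticFunction.vonMangoldt n : ℂ) * χ (n : ZMod q) * e (t * (n : ℝ) ^ c)‖
          ≤ K * (X / Real.log X ^ E) := by
  set D : ℕ := ⌈E + 2⌉₊ with hD
  have hED : E + 2 ≤ D := Nat.le_ceil _
  set m : ℕ := 4 * D + D with hm
  obtain ⟨K₁, hK₁, H₁⟩ := exists_norm_sum_vonMangoldt_le μ c hμ0 hμ1 hc
  obtain ⟨K₂, hK₂, H₂⟩ := siegel_walfisz m hC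
  refine ⟨4 * K₁ + 2 * K₂ * (1 + 2 * Real.pi * 2 ^ c), by positivity, ?_⟩
  filter_upwards [Filter.eventually_ge_atTop (Real.exp 16), Filter.eventually_ge_atTop (4 / μ ^ 2),
    Real.tendsto_log_atTop.eventually_ge_atTop (1 / μ),
    eventually_log_rpow_le_rpow (C + 2 + E) (by positivity : 0 < δ / 2),
    eventually_log_rpow_le_rpow (2 + E) (by norm_num : (0 : ℝ) < 1 / 12),
    eventually_log_rpow_le_rpow (C + 1) (by norm_num : (0 : ℝ) < 1 / 3)]
    with X hX16 hXμ hLμ h1 h2 h3 t ht q _ χ hprim hχ hq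
  have hX0 : 0 < X := (Real.exp_pos _).trans_le hX16
  have hX1 : 1 ≤ X := (Real.one_le_exp (by norm_num)).trans hX16
  have hL16 : 16 ≤ Real.log X := (Real.le_log_iff_exp_le hX0).mpr hX16
  set L := Real.log X with hL
  have hL0 : 0 < L := by linarith
  have hL1 : 1 ≤ L := by linarith
  have hXL : 0 ≤ X / L ^ E := by positivity
  rcases le_total (|t| * X ^ c) (L ^ (4 * D)) with hT | hT
  · have hM : ⌊μ * X⌋₊ ≤ ⌊X⌋₊ := Nat.floor_le_floor (by nlinarith)
    have h := norm_sum_mul_e_rpow_le (by linarith : 0 ≤ c) hX1 t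
      (fun n : ℕ => χ (n : ZMod q) * (ArithmeticFunction.vonMangoldt n : ℂ)) hM
      (fun N hN => H₂ X hX16 q χ hprim hχ hq N hN)
    have e1 : ∀ n : ℕ, (ArithmeticFunction.vonMangoldt n : ℂ) * χ (n : ZMod q)
        * e (t * (n : ℝ) ^ c) = χ (n : ZMod q) * (ArithmeticFunction.vonMangoldt n : ℂ)
        * e (t * (n : ℝ) ^ c) := fun n => by ring
    simp only [e1]
    refine h.trans ?_
    have hLD1 : 1 ≤ L ^ (4 * D) := one_le_pow₀ hL1
    have e2 : 1 + 2 * Real.pi * 2 ^ c * (|t| * X ^ c)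
        ≤ (1 + 2 * Real.pi * 2 ^ c) * L ^ (4 * D) := by
      rw [add_mul, one_mul]
      gcongr
    have e3 : L ^ (4 * D) * (X / L ^ m) = X / L ^ D := by
      rw [hm, pow_add]; field_simp
    have e4 : X / L ^ D ≤ X / L ^ E := by
      rw [← Real.rpow_natCast L D]
      refine div_le_div_of_nonneg_left hX0.le (by positivity) ?_
      exact Real.rpow_le_rpow_of_exponent_le hL1 (by linarith)
    calc 2 * (K₂ * (X / L ^ m)) * (1 + 2 * Real.pi * 2 ^ c * (|t| * X ^ c))
        ≤ 2 * (K₂ * (X / L ^ m)) * ((1 + 2 * Real.pi * 2 ^ c) * L ^ (4 * D)) := by gcongr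
      _ = 2 * K₂ * (1 + 2 * Real.pi * 2 ^ c) * (L ^ (4 * D) * (X / L ^ m)) := by ring
      _ ≤ 2 * K₂ * (1 + 2 * Real.pi * 2 ^ c) * (X / L ^ E) := by rw [e3]; gcongr
      _ ≤ _ := by rw [add_mul]; have := mul_nonneg (by positivity : 0 ≤ 4 * K₁) hXL; linarith
  · have hT0 : 0 < |t| * X ^ c := lt_of_lt_of_le (by positivity) hT
    have ht0 : t ≠ 0 := by rintro rfl; simp at hT0
    have hTX : |t| * X ^ c ≤ X ^ (2 / 3 - δ) := by
      calc |t| * X ^ c ≤ X ^ (2 / 3 - c - δ) * X ^ c := by gcongr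
        _ = X ^ (2 / 3 - δ) := by rw [← Real.rpow_add hX0]; congr 1; ring
    have hTX' : |t| * X ^ c ≤ X ^ (2 / 3 : ℝ) :=
      hTX.trans (Real.rpow_le_rpow_of_exponent_le hX1 (by linarith))
    have hqX : (q : ℝ) ≤ μ * X ^ (1 / 3 : ℝ) := by
      have : 1 ≤ μ * L := by rw [div_le_iff₀ hμ0] at hLμ; linarith
      calc (q : ℝ) ≤ L ^ C := hq
        _ ≤ L ^ C * (μ * L) := le_mul_of_one_le_right (by positivity) this
        _ = μ * L ^ (C + 1) := by rw [Real.rpow_add hL0, Real.rpow_one]; ring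
        _ ≤ _ := by gcongr
    have h := H₁ X t q χ ht0 (le_trans (Real.exp_le_exp.mpr (by norm_num)) hX16) hXμ
      (Nat.pos_of_ne_zero (NeZero.ne q)) hqX hTX'
    have h' := minor_arc_terms_le hX1 hL1 hq hT hTX hED h1 h2
    refine h.trans ?_
    rw [mul_assoc]
    refine (mul_le_mul_of_nonneg_left h' hK₁.le).trans ?_
    have := mul_nonneg (by positivity : 0 ≤ 2 * K₂ * (1 + 2 * Real.pi * 2 ^ c)) hXL
    rw [add_mul]; linarith

lemma sum_character_le_totient_mul {q : ℕ} [NeZero q] (f : DirichletCharacter ℂ q → ℝ) {b : ℝ}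
    (hf : ∀ χ, f χ ≤ b) : ∑ χ : DirichletCharacter ℂ q, f χ ≤ q.totient * b := by
  refine (sum_le_sum fun χ _ => hf χ).trans (le_of_eq ?_)
  rw [sum_const, card_univ, ← Nat.card_eq_fintype_card,
    DirichletCharacter.card_eq_totient_of_hasEnoughRootsOfUnity ℂ q, nsmul_eq_mul]

/-- Bound on the average over primitive characters of exponential sums over primes. -/
theorem avg_primitive_char_exponential_sum (μ c B C : ℝ) (hμ0 : 0 < μ) (hμ1 : μ < 1)
    (hc : 1 < c) (hB : 0 < B) (hC : 0 < C) :
    ∃ δ₀ > 0, ∀ δ : ℝ, 0 < δ → δ ≤ δ₀ →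
      ∃ K > 0, ∃ X₀ : ℝ, ∀ X : ℝ, X₀ ≤ X →
        ∀ t : ℝ, |t| ≤ X ^ (2 / 3 - c - δ) →
          ∑ q ∈ Ioc 1 ⌊Real.log X ^ C⌋₊, (1 / (Nat.totient q : ℝ)) *
              ∑ χ : DirichletCharacter ℂ q,
                (if χ.IsPrimitive then
                  ‖∑ n ∈ Ioc ⌊μ * X⌋₊ ⌊X⌋₊,
                      (ArithmeticFunction.vonMangoldt n : ℂ) * χ (n : ZMod q)
                        * e (t * (n : ℝ) ^ c)‖
                else 0)
            ≤ K * (X / Real.log X ^ B) := by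
  refine ⟨1, one_pos, fun δ hδ _ => ?_⟩
  obtain ⟨K, hK, H⟩ := exists_norm_sum_vonMangoldt_primitive_le μ c C (B + C) δ hμ0 hμ1 hc hC hδ
  obtain ⟨X₀, hX₀⟩ := Filter.eventually_atTop.mp H
  refine ⟨K, hK, max X₀ (Real.exp 1), fun X hX t ht => ?_⟩
  have hXe : Real.exp 1 ≤ X := (le_max_right _ _).trans hX
  have hX0 : 0 < X := (Real.exp_pos _).trans_le hXe
  have hL1 : 1 ≤ Real.log X := (Real.le_log_iff_exp_le hX0).mpr hXe
  have hL0 : 0 < Real.log X := by linarith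
  have hLC : 0 ≤ Real.log X ^ C := by positivity
  have hb : 0 ≤ K * (X / Real.log X ^ (B + C)) := by positivity
  have hterm : ∀ q ∈ Ioc 1 ⌊Real.log X ^ C⌋₊, (1 / (Nat.totient q : ℝ)) *
      ∑ χ : DirichletCharacter ℂ q,
        (if χ.IsPrimitive then
          ‖∑ n ∈ Ioc ⌊μ * X⌋₊ ⌊X⌋₊,
              (ArithmeticFunction.vonMangoldt n : ℂ) * χ (n : ZMod q) * e (t * (n : ℝ) ^ c)‖
        else 0) ≤ K * (X / Real.log X ^ (B + C)) := by
    intro q hq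
    rw [mem_Ioc] at hq
    have hq0 : 0 < q := by omega
    have : NeZero q := ⟨hq0.ne'⟩
    have hφ : (0 : ℝ) < q.totient := by exact_mod_cast Nat.totient_pos.mpr hq0
    rw [one_div, inv_mul_le_iff₀ hφ]
    refine sum_character_le_totient_mul _ fun χ => ?_
    split_ifs with hχ
    · refine hX₀ X ((le_max_left _ _).trans hX) t ht q χ hχ ?_ ?_
      · rintro rfl
        rw [DirichletCharacter.isPrimitive_def, DirichletCharacter.conductor_one] at hχ
        omega
      · exact (Nat.le_floor_iff hLC).mp hq.2
    · exact hb
  refine (sum_le_card_nsmul _ _ _ hterm).trans ?_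
  rw [Nat.card_Ioc, nsmul_eq_mul]
  have hcard : ((⌊Real.log X ^ C⌋₊ - 1 : ℕ) : ℝ) ≤ Real.log X ^ C :=
    le_trans (by exact_mod_cast Nat.sub_le _ _) (Nat.floor_le hLC)
  refine (mul_le_mul_of_nonneg_right hcard hb).trans (le_of_eq ?_)
  rw [Real.rpow_add hL0]
  field_simp
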